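/- Fix an integer n ≥ 1. For admissible T → ∞, ∑_{0<γ≤T} ζ^{(n)}(ρ) = (−1)^{n+1} ∑_{mr ≤ T/2π} Λ(r) log^n r + O(T^{1/2} log^{n+2} T), where the right-hand sum runs over all ordered pairs (m, r) of positive integers with mr ≤ T/2π. -/

import Mathlib

open Complex Filter Finset

/-- The order of vanishing of the Riemann zeta function at a point `ρ`:
the least `k` such that the `k`-th derivative of `ζ` is nonzero at `ρ`. -/
noncomputable def zetaZeroOrder (ρ : ℂ) : ℕ :=
  sInf {k : ℕ | iteratedDeriv k riemannZeta ρ ≠ 0}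

/-- A non-trivial zero of the Riemann zeta function. -/
def IsNontrivialZero (ρ : ℂ) : Prop :=
  riemannZeta ρ = 0 ∧ 0 < ρ.re ∧ ρ.re < 1

/-- `∑_{0<γ≤T} ζ^{(n)}(ρ)`, the sum of the `n`-th derivative of `ζ` over the
non-trivial zeros `ρ = β + iγ` with `0 < γ ≤ T`, counted with multiplicity. -/
noncomputable def zetaZeroSum (n : ℕ) (T : ℝ) : ℂ :=
  ∑ᶠ ρ ∈ {ρ : ℂ | IsNontrivialZero ρ ∧ 0 < ρ.im ∧ ρ.im ≤ T},
    (zetaZeroOrder ρ : ℂ) * iteratedDeriv n riemannZeta ρ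

/-- `T` is admissible: `|T - γ| ≥ δ / log T` for every ordinate `γ` of a
non-trivial zero of `ζ`. -/
def AdmissibleHeight (δ T : ℝ) : Prop :=
  ∀ ρ : ℂ, IsNontrivialZero ρ → δ / Real.log T ≤ |T - ρ.im|

/-- `∑_{mr ≤ Y} Λ(r) log^n r`, summed over all ordered pairs `(m, r)` of
positive integers with `mr ≤ Y`. -/
noncomputable def vonMangoldtPairSum (n : ℕ) (Y : ℝ) : ℝ :=
  ∑ p ∈ (Finset.Icc 1 ⌊Y⌋₊ ×ˢ Finset.Icc 1 ⌊Y⌋₊).filter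
      (fun p : ℕ × ℕ => ((p.1 : ℝ) * (p.2 : ℝ) ≤ Y)),
    ArithmeticFunction.vonMangoldt p.2 * Real.log p.2 ^ n

lemma norm_gauss (z : ℂ) (T : ℝ) :
    ‖cexp ((z - T * I) ^ 2)‖ = Real.exp (z.re ^ 2 - (z.im - T) ^ 2) := by
  rw [Complex.norm_exp]
  congr 1
  simp [sq]

lemma one_add_pow_mul_exp_le (k : ℕ) (x : ℝ) (hx : 0 ≤ x) :
    (1 + x) ^ k * Real.exp (-x ^ 2) ≤ Real.exp ((k : ℝ) ^ 2) := by
  have h1 : (1 + x) ^ k ≤ Real.exp (k * x) := by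
    rw [Real.exp_nat_mul]
    gcongr
    linarith [Real.add_one_le_exp x]
  calc (1 + x) ^ k * Real.exp (-x ^ 2) ≤ Real.exp (k * x) * Real.exp (-x ^ 2) := by gcongr
    _ = Real.exp (k * x - x ^ 2) := by rw [← Real.exp_add]; ring_nf
    _ ≤ _ := by
      apply Real.exp_le_exp.mpr
      nlinarith [sq_nonneg ((k : ℝ) - x), sq_nonneg (k : ℝ), sq_nonneg x]

/-- Hadamard three lines with a Gaussian localisation. -/
lemma three_lines_gauss {f : ℂ → ℂ} {l u T A B K H : ℝ} (k : ℕ) (hul : l < u) (hl : -H ≤ l)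
    (hu : u ≤ H) (hA : 0 ≤ A) (hB : 0 ≤ B)
    (hd : DiffContOnCl ℂ f (HadamardThreeLines.verticalStrip l u))
    (hK : ∀ z : ℂ, l ≤ z.re → z.re ≤ u → ‖f z‖ ≤ K * Real.exp (K * |z.im|))
    (hAl : ∀ z : ℂ, z.re = l → ‖f z‖ ≤ A * (1 + |z.im - T|) ^ k)
    (hBu : ∀ z : ℂ, z.re = u → ‖f z‖ ≤ B * (1 + |z.im - T|) ^ k)
    (σ : ℝ) (h1 : l ≤ σ) (h2 : σ ≤ u) :
    ‖f (σ + T * I)‖ ≤ Real.exp (H ^ 2 + (k : ℝ) ^ 2) *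
      (A ^ (1 - (σ - l) / (u - l)) * B ^ ((σ - l) / (u - l))) := by
  set E := Real.exp (H ^ 2 + (k : ℝ) ^ 2) with hE
  have hsq : ∀ x : ℝ, l ≤ x → x ≤ u → x ^ 2 ≤ H ^ 2 := fun x hx hx' => by nlinarith
  have key : ∀ (z : ℂ) (A : ℝ), 0 ≤ A → l ≤ z.re → z.re ≤ u →
      ‖f z‖ ≤ A * (1 + |z.im - T|) ^ k →
      ‖f z * cexp ((z - T * I) ^ 2)‖ ≤ A * E := by
    intro z A hA hz1 hz2 hz
    rw [norm_mul, norm_gauss]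
    calc ‖f z‖ * Real.exp (z.re ^ 2 - (z.im - T) ^ 2)
        ≤ (A * (1 + |z.im - T|) ^ k) * (Real.exp (H ^ 2) * Real.exp (-|z.im - T| ^ 2)) := by
          gcongr
          rw [← Real.exp_add, sq_abs]
          apply Real.exp_le_exp.mpr
          linarith [hsq _ hz1 hz2]
      _ = A * (Real.exp (H ^ 2) * ((1 + |z.im - T|) ^ k * Real.exp (-|z.im - T| ^ 2))) := by ring
      _ ≤ A * (Real.exp (H ^ 2) * Real.exp ((k : ℝ) ^ 2)) := by
          gcongr
          exact one_add_pow_mul_exp_le k _ (abs_nonneg _)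
      _ = A * E := by rw [hE, Real.exp_add]
  have hθ0 : 0 ≤ (σ - l) / (u - l) := div_nonneg (by linarith) (by linarith)
  have hre : ((σ : ℂ) + T * I).re = σ := by simp
  have main := HadamardThreeLines.norm_le_interp_of_mem_verticalClosedStrip'
    (f := fun z => f z * cexp ((z - T * I) ^ 2)) (z := σ + T * I) (a := A * E) (b := B * E)
    hul (by simp [HadamardThreeLines.verticalClosedStrip, h1, h2]) ?_ ?_ ?_ ?_
  · rw [hre] at main
    have e1 : (A * E) ^ (1 - (σ - l) / (u - l)) * (B * E) ^ ((σ - l) / (u - l)) =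
        E * (A ^ (1 - (σ - l) / (u - l)) * B ^ ((σ - l) / (u - l))) := by
      have hEp : 0 < E := Real.exp_pos _
      rw [Real.mul_rpow hA hEp.le, Real.mul_rpow hB hEp.le]
      have : E = E ^ (1 - (σ - l) / (u - l)) * E ^ ((σ - l) / (u - l)) := by
        rw [← Real.rpow_add hEp]; simp
      conv_rhs => rw [this]
      ring
    rw [e1, norm_mul, norm_gauss] at main
    refine le_trans ?_ main
    have : 1 ≤ Real.exp (((σ : ℂ) + T * I).re ^ 2 - (((σ : ℂ) + T * I).im - T) ^ 2) := by
      apply Real.one_le_exp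
      simp
      positivity
    exact le_mul_of_one_le_right (norm_nonneg _) this
  · have hg : Differentiable ℂ (fun z : ℂ => cexp ((z - T * I) ^ 2)) := by fun_prop
    exact ⟨hd.1.mul hg.differentiableOn, hd.2.mul hg.continuous.continuousOn⟩
  · refine ⟨|K| * (Real.exp (H ^ 2) * (Real.exp (|K| * |T|) * Real.exp (|K| ^ 2))), ?_⟩
    rintro _ ⟨z, hz, rfl⟩
    simp only [HadamardThreeLines.verticalClosedStrip, Set.mem_preimage, Set.mem_Icc] at hz
    simp only [Function.comp, norm_mul, norm_gauss]
    have hb := hK z hz.1 hz.2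
    have h3 : |z.im| ≤ |T| + |z.im - T| := by
      have := abs_add_le T (z.im - T); simpa using this
    calc ‖f z‖ * Real.exp (z.re ^ 2 - (z.im - T) ^ 2)
        ≤ (|K| * Real.exp (|K| * (|T| + |z.im - T|))) * (Real.exp (H ^ 2) * Real.exp (-|z.im - T| ^ 2)) := by
          gcongr
          · refine hb.trans ?_
            gcongr
            · exact le_abs_self K
            · exact le_abs_self K
          rw [← Real.exp_add, sq_abs]
          apply Real.exp_le_exp.mpr
          linarith [hsq _ hz.1 hz.2]
      _ = |K| * (Real.exp (H ^ 2) * (Real.exp (|K| * |T|) * Real.exp (|K| * |z.im - T| - |z.im - T| ^ 2))) := by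
          rw [mul_add, Real.exp_add, Real.exp_sub, Real.exp_neg]; ring
      _ ≤ _ := by
          gcongr
          nlinarith [sq_nonneg (|K| - |z.im - T|), sq_nonneg (|K|), sq_nonneg (|z.im - T|)]
  · intro z hz
    simp only [Set.mem_preimage, Set.mem_singleton_iff] at hz
    exact key z A hA hz.ge (by rw [hz]; exact hul.le) (hAl z hz)
  · intro z hz
    simp only [Set.mem_preimage, Set.mem_singleton_iff] at hz
    exact key z B hB (by rw [hz]; exact hul.le) hz.le (hBu z hz)

/-- Exact modulus on the line `1/2`, as an inequality. -/
lemma norm_Gamma_half_le (y : ℝ) :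
    ‖Gamma (1 / 2 + y * I)‖ ≤ Real.sqrt (2 * Real.pi) * Real.exp (-Real.pi * |y| / 2) := by
  have h := Complex.Gamma_mul_Gamma_one_sub (1 / 2 + y * I)
  have hc : (1 : ℂ) - (1 / 2 + y * I) = (starRingEnd ℂ) (1 / 2 + y * I) := by
    simp [Complex.ext_iff]; norm_num
  rw [hc, Complex.Gamma_conj, Complex.mul_conj, Complex.normSq_eq_norm_sq] at h
  have hs : sin (Real.pi * (1 / 2 + y * I)) = (Real.cosh (Real.pi * y) : ℝ) := by
    rw [show (Real.pi : ℂ) * (1 / 2 + y * I) = (Real.pi * y : ℝ) * I + Real.pi / 2 by push_cast; ring,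
      Complex.sin_add_pi_div_two, Complex.cos_mul_I]
    simp
  rw [hs] at h
  have h' : ‖Gamma (1 / 2 + y * I)‖ ^ 2 = Real.pi / Real.cosh (Real.pi * y) := by
    exact_mod_cast h
  have hcosh : Real.exp (Real.pi * |y|) ≤ 2 * Real.cosh (Real.pi * y) := by
    rw [← Real.cosh_abs, abs_mul, abs_of_pos Real.pi_pos, Real.cosh_eq]
    linarith [Real.exp_pos (-(Real.pi * |y|))]
  apply (sq_le_sq₀ (norm_nonneg _) (by positivity)).mp
  rw [h', mul_pow, Real.sq_sqrt (by positivity), ← Real.exp_nat_mul,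
    show ((2 : ℕ) : ℝ) * (-Real.pi * |y| / 2) = -(Real.pi * |y|) by push_cast; ring, Real.exp_neg,
    ← div_eq_mul_inv, div_le_div_iff₀ (Real.cosh_pos _) (Real.exp_pos _)]
  nlinarith [Real.pi_pos]

lemma norm_Gamma_le_Gamma_re {s : ℂ} (hs : 0 < s.re) : ‖Gamma s‖ ≤ Real.Gamma s.re := by
  rw [Complex.Gamma_eq_integral hs, Real.Gamma_eq_integral hs, Complex.GammaIntegral]
  refine (MeasureTheory.norm_integral_le_integral_norm _).trans (le_of_eq ?_)
  apply MeasureTheory.setIntegral_congr_fun measurableSet_Ioi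
  intro x hx
  simp only [norm_mul]
  rw [norm_cpow_eq_rpow_re_of_pos hx]
  simp [Complex.norm_exp]

lemma norm_exp_rot (z : ℂ) : ‖cexp (-(I * Real.pi * z / 2))‖ = Real.exp (Real.pi * z.im / 2) := by
  rw [Complex.norm_exp]
  congr 1
  simp
  ring

lemma Gamma_mid_pos : ∃ C > 0, ∀ σ t : ℝ, 1 / 2 ≤ σ → σ ≤ 3 / 2 → 0 ≤ t →
    ‖Gamma (σ + t * I)‖ ≤ C * (1 + t) ^ (σ - 1 / 2) * Real.exp (-Real.pi * t / 2) := by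
  set S := Real.sqrt (2 * Real.pi) with hS
  have hS0 : 0 < S := by positivity
  obtain ⟨M, hM⟩ : ∃ M, ∀ x ∈ Set.Icc (1/2 : ℝ) (3/2), ‖Real.Gamma x‖ ≤ M := by
    apply isCompact_Icc.exists_bound_of_continuousOn
    intro x hx
    apply ContinuousAt.continuousWithinAt
    apply DifferentiableAt.continuousAt (𝕜 := ℝ)
    apply Real.differentiableAt_Gamma
    intro m
    have := hx.1
    have : (0:ℝ) ≤ m := by positivity
    linarith
  refine ⟨Real.exp ((3/2 : ℝ) ^ 2 + ((1 : ℕ) : ℝ) ^ 2) * S, by positivity, ?_⟩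
  intro σ t h1 h2 ht
  have hrot : ∀ z : ℂ, ‖Gamma z * cexp (-(I * Real.pi * z / 2))‖ =
      ‖Gamma z‖ * Real.exp (Real.pi * z.im / 2) := by
    intro z; rw [norm_mul, norm_exp_rot]
  have hhalf : ∀ y : ℝ, ‖Gamma (1 / 2 + y * I)‖ * Real.exp (Real.pi * y / 2) ≤ S := by
    intro y
    calc _ ≤ (S * Real.exp (-Real.pi * |y| / 2)) * Real.exp (Real.pi * y / 2) := by
          gcongr; exact norm_Gamma_half_le y
      _ = S * Real.exp (-Real.pi * |y| / 2 + Real.pi * y / 2) := by rw [Real.exp_add]; ring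
      _ ≤ S * 1 := by
          gcongr
          rw [Real.exp_le_one_iff]
          nlinarith [Real.pi_pos, le_abs_self y]
      _ = S := mul_one _
  have hdG : DifferentiableOn ℂ (fun z => Gamma z * cexp (-(I * Real.pi * z / 2))) {z : ℂ | 0 < z.re} := by
    apply DifferentiableOn.mul
    · intro z hz
      apply DifferentiableAt.differentiableWithinAt
      apply Complex.differentiableAt_Gamma
      intro m h
      rw [h] at hz
      simp at hz
      have : (0:ℝ) ≤ m := by positivity
      linarith
    · apply Differentiable.differentiableOn
      fun_prop
  have main := three_lines_gauss (f := fun z => Gamma z * cexp (-(I * Real.pi * z / 2)))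
    (l := 1/2) (u := 3/2) (T := t) (A := S) (B := S * (1 + t)) (K := |M| + Real.pi) (H := 3/2) 1
    (by norm_num) (by norm_num) (by norm_num) hS0.le (by positivity) ?_ ?_ ?_ ?_ σ h1 h2
  · rw [hrot] at main
    have him : ((σ : ℂ) + t * I).im = t := by simp
    rw [him] at main
    rw [show -Real.pi * t / 2 = -(Real.pi * t / 2) by ring, Real.exp_neg, ← div_eq_mul_inv,
      le_div_iff₀ (Real.exp_pos _)]
    refine main.trans (le_of_eq ?_)
    rw [show ((σ - 1 / 2) / (3 / 2 - 1 / 2)) = σ - 1/2 by ring, Real.mul_rpow hS0.le (by positivity)]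
    have : S = S ^ (1 - (σ - 1/2)) * S ^ (σ - 1/2) := by rw [← Real.rpow_add hS0]; simp
    conv_rhs => rw [this]
    ring
  · apply DifferentiableOn.diffContOnCl
    apply hdG.mono
    intro z hz
    have : z ∈ closure (re ⁻¹' Set.Ioo (1/2 : ℝ) (3/2)) := hz
    have h3 : closure (re ⁻¹' Set.Ioo (1/2 : ℝ) (3/2)) ⊆ re ⁻¹' Set.Icc (1/2 : ℝ) (3/2) :=
      closure_minimal (Set.preimage_mono Set.Ioo_subset_Icc_self) (isClosed_Icc.preimage continuous_re)
    have := (h3 this).1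
    show 0 < z.re
    linarith
  · intro z hz1 hz2
    rw [hrot]
    have hb : ‖Gamma z‖ ≤ |M| := by
      refine (norm_Gamma_le_Gamma_re (by linarith)).trans ?_
      exact (le_abs_self _).trans ((hM _ ⟨hz1, hz2⟩).trans (le_abs_self _))
    have : Real.exp (Real.pi * z.im / 2) ≤ Real.exp ((|M| + Real.pi) * |z.im|) := by
      apply Real.exp_le_exp.mpr
      have := le_abs_self z.im
      nlinarith [Real.pi_pos, abs_nonneg z.im, abs_nonneg M, mul_nonneg (abs_nonneg M) (abs_nonneg z.im), mul_nonneg Real.pi_pos.le (abs_nonneg z.im)]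
    gcongr
    linarith [Real.pi_pos]
  · intro z hz
    rw [hrot]
    have : z = 1/2 + z.im * I := by apply Complex.ext <;> simp [hz]
    have h := hhalf z.im
    rw [← this] at h
    refine h.trans ?_
    rw [pow_one]
    exact le_mul_of_one_le_right hS0.le (by linarith [abs_nonneg (z.im - t)])
  · intro z hz
    rw [hrot]
    have hz' : z = (1/2 + z.im * I) + 1 := by apply Complex.ext <;> simp [hz]; norm_num
    have h0 : (1/2 + z.im * I : ℂ) ≠ 0 := by
      intro h; have := congrArg re h; simp at this
    have e : Gamma z = (1/2 + z.im * I) * Gamma (1/2 + z.im * I) := by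
      conv_lhs => rw [hz', Complex.Gamma_add_one _ h0]
    rw [e, norm_mul, mul_assoc]
    have hn : ‖(1/2 + z.im * I : ℂ)‖ ≤ 1 + |z.im| := by
      refine (norm_add_le _ _).trans ?_
      simp; norm_num
    have h3 : |z.im| ≤ |t| + |z.im - t| := by
      have := abs_add_le t (z.im - t); simpa using this
    rw [abs_of_nonneg ht] at h3
    calc _ ≤ (1 + |z.im|) * S := by
          gcongr
          exact hhalf _
      _ ≤ ((1 + t) * (1 + |z.im - t|)) * S := by
          gcongr
          nlinarith [abs_nonneg (z.im - t)]
      _ = _ := by ring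

lemma norm_Gamma_conj (σ t : ℝ) : ‖Gamma (σ + t * I)‖ = ‖Gamma (σ + |t| * I)‖ := by
  rcases le_total 0 t with h | h
  · rw [abs_of_nonneg h]
  · rw [abs_of_nonpos h, ← Complex.norm_conj, ← Complex.Gamma_conj]
    congr 2
    simp

lemma Gamma_mid : ∃ C > 0, ∀ s : ℂ, 1 / 2 ≤ s.re → s.re ≤ 3 / 2 →
    ‖Gamma s‖ ≤ C * (1 + |s.im|) ^ (s.re - 1 / 2) * Real.exp (-Real.pi * |s.im| / 2) := by
  obtain ⟨C, hC, h⟩ := Gamma_mid_pos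
  refine ⟨C, hC, fun s h1 h2 => ?_⟩
  have := h s.re |s.im| h1 h2 (abs_nonneg _)
  rwa [← norm_Gamma_conj, Complex.re_add_im] at this

lemma Gamma_right : ∃ C > 0, ∀ s : ℂ, 1 / 2 ≤ s.re → 1 ≤ |s.im| →
    ‖Gamma s‖ ≤ C * ‖s‖ ^ (s.re - 1 / 2) * Real.exp (-Real.pi * |s.im| / 2) := by
  obtain ⟨C, hC, h⟩ := Gamma_mid
  refine ⟨C * 2, by positivity, ?_⟩
  have key : ∀ (k : ℕ) (s : ℂ), 1/2 ≤ s.re → s.re ≤ 3/2 + k → 1 ≤ |s.im| →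
    ‖Gamma s‖ ≤ C * 2 * ‖s‖ ^ (s.re - 1 / 2) * Real.exp (-Real.pi * |s.im| / 2) := by
    intro k
    induction k with
    | zero =>
      intro s h1 h2 h3
      refine (h s h1 (by simpa using h2)).trans ?_
      gcongr ?_ * _
      rw [mul_assoc]
      gcongr
      simp only [Nat.cast_zero, add_zero] at h2
      calc (1 + |s.im|) ^ (s.re - 1/2) ≤ (2 * ‖s‖) ^ (s.re - 1/2) := by
            apply Real.rpow_le_rpow (by positivity) _ (by linarith)
            linarith [Complex.abs_im_le_norm s]
        _ = 2 ^ (s.re - 1/2) * ‖s‖ ^ (s.re - 1/2) := by rw [Real.mul_rpow (by norm_num) (norm_nonneg _)]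
        _ ≤ 2 * ‖s‖ ^ (s.re - 1/2) := by
            gcongr
            calc (2:ℝ) ^ (s.re - 1/2) ≤ 2 ^ (1:ℝ) := by
                  apply Real.rpow_le_rpow_of_exponent_le (by norm_num) (by linarith)
              _ = 2 := by simp
    | succ k ih =>
      intro s h1 h2 h3
      by_cases hs : s.re ≤ 3/2 + k
      · exact ih s h1 hs h3
      push Not at hs
      have hk : (0:ℝ) ≤ k := by positivity
      push_cast at h2
      have h0 : s - 1 ≠ 0 := by
        intro h0; have := congrArg im h0; simp at this; rw [this] at h3; simp at h3; linarith
      have e : Gamma s = (s - 1) * Gamma (s - 1) := by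
        have := Complex.Gamma_add_one (s-1) h0
        rwa [sub_add_cancel] at this
      have := ih (s - 1) (by simp; linarith) (by simp; linarith) (by simpa using h3)
      simp only [sub_re, one_re, sub_im, one_im, sub_zero] at this
      have hpos : 0 < ‖s - 1‖ := norm_pos_iff.mpr h0
      have hle : ‖s - 1‖ ≤ ‖s‖ := by
        rw [← sq_le_sq₀ (norm_nonneg _) (norm_nonneg _), ← Complex.normSq_eq_norm_sq, ← Complex.normSq_eq_norm_sq,
          Complex.normSq_apply, Complex.normSq_apply]
        simp
        nlinarith
      rw [e, norm_mul]
      calc _ ≤ ‖s-1‖ * (C * 2 * ‖s-1‖ ^ (s.re - 1 - 1 / 2) * Real.exp (-Real.pi * |s.im| / 2)) := by gcongr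
        _ = C * 2 * (‖s-1‖ ^ (s.re - 1 - 1 / 2) * ‖s-1‖ ^ (1:ℝ)) * Real.exp (-Real.pi * |s.im| / 2) := by
          rw [Real.rpow_one]; ring
        _ = C * 2 * ‖s-1‖ ^ (s.re - 1/2) * Real.exp (-Real.pi * |s.im| / 2) := by
          rw [← Real.rpow_add hpos]; ring_nf
        _ ≤ _ := by
          gcongr
  intro s h1 h3
  obtain ⟨k, hk⟩ := exists_nat_ge s.re
  exact key k s h1 (by linarith) h3

lemma Gamma_left : ∃ C > 0, ∀ s : ℂ, s.re ≤ 3 / 2 → 1 ≤ |s.im| →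
    ‖Gamma s‖ ≤ C * |s.im| ^ (s.re - 1 / 2) * Real.exp (-Real.pi * |s.im| / 2) := by
  obtain ⟨C, hC, h⟩ := Gamma_mid
  refine ⟨C * 2, by positivity, ?_⟩
  have key : ∀ (k : ℕ) (s : ℂ), 1/2 - k ≤ s.re → s.re ≤ 3/2 → 1 ≤ |s.im| →
    ‖Gamma s‖ ≤ C * 2 * |s.im| ^ (s.re - 1 / 2) * Real.exp (-Real.pi * |s.im| / 2) := by
    intro k
    induction k with
    | zero =>
      intro s h1 h2 h3
      simp only [Nat.cast_zero, sub_zero] at h1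
      refine (h s h1 (by simpa using h2)).trans ?_
      gcongr ?_ * _
      rw [mul_assoc]
      gcongr
      calc (1 + |s.im|) ^ (s.re - 1/2) ≤ (2 * |s.im|) ^ (s.re - 1/2) := by
            apply Real.rpow_le_rpow (by positivity) _ (by linarith)
            linarith
        _ = 2 ^ (s.re - 1/2) * |s.im| ^ (s.re - 1/2) := by rw [Real.mul_rpow (by norm_num) (by positivity)]
        _ ≤ 2 * |s.im| ^ (s.re - 1/2) := by
            gcongr
            calc (2:ℝ) ^ (s.re - 1/2) ≤ 2 ^ (1:ℝ) := by
                  apply Real.rpow_le_rpow_of_exponent_le (by norm_num) (by linarith)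
              _ = 2 := by simp
    | succ k ih =>
      intro s h1 h2 h3
      by_cases hs : 1/2 - k ≤ s.re
      · exact ih s hs h2 h3
      push Not at hs
      have hk : (0:ℝ) ≤ k := by positivity
      push_cast at h1
      have h0 : s ≠ 0 := by
        intro h0; rw [h0] at h3; simp at h3; linarith
      have e := Complex.Gamma_add_one s h0
      have := ih (s + 1) (by simp; linarith) (by simp; linarith) (by simpa using h3)
      simp only [add_re, one_re, add_im, one_im, add_zero] at this
      have hpos : 0 < |s.im| := by linarith
      rw [e, norm_mul] at this
      have hle := Complex.abs_im_le_norm s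
      have h4 : |s.im| * ‖Gamma s‖ ≤ |s.im| * (C * 2 * |s.im| ^ (s.re - 1 / 2) * Real.exp (-Real.pi * |s.im| / 2)) := by
        calc |s.im| * ‖Gamma s‖ ≤ ‖s‖ * ‖Gamma s‖ := by gcongr
          _ ≤ _ := this
          _ = C * 2 * |s.im| ^ ((s.re - 1 / 2) + 1) * Real.exp (-Real.pi * |s.im| / 2) := by ring_nf
          _ = _ := by rw [Real.rpow_add hpos, Real.rpow_one]; ring
      exact le_of_mul_le_mul_left h4 hpos
  intro s h1 h3
  obtain ⟨k, hk⟩ := exists_nat_ge (1/2-s.re)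
  exact key k s (by linarith) h1 h3

lemma norm_sin_le (z : ℂ) : ‖sin z‖ ≤ Real.exp |z.im| := by
  rw [Complex.sin, norm_div, norm_mul, norm_I, mul_one]
  have h1 : ‖cexp (-z * I)‖ ≤ Real.exp |z.im| := by
    rw [Complex.norm_exp]; apply Real.exp_le_exp.mpr; simp; exact le_abs_self _
  have h2 : ‖cexp (z * I)‖ ≤ Real.exp |z.im| := by
    rw [Complex.norm_exp]; apply Real.exp_le_exp.mpr; simp; exact neg_le_abs _
  have := norm_sub_le (cexp (-z * I)) (cexp (z * I))
  rw [Complex.norm_ofNat]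
  linarith

lemma norm_cos_le (z : ℂ) : ‖cos z‖ ≤ Real.exp |z.im| := by
  rw [Complex.cos, norm_div]
  have h1 : ‖cexp (-z * I)‖ ≤ Real.exp |z.im| := by
    rw [Complex.norm_exp]; apply Real.exp_le_exp.mpr; simp; exact le_abs_self _
  have h2 : ‖cexp (z * I)‖ ≤ Real.exp |z.im| := by
    rw [Complex.norm_exp]; apply Real.exp_le_exp.mpr; simp; exact neg_le_abs _
  have := norm_add_le (cexp (z * I)) (cexp (-z * I))
  rw [Complex.norm_ofNat]
  linarith

lemma sin_pi_mul_ne_zero_im {s : ℂ} (h : s.im ≠ 0) : sin (Real.pi * s) ≠ 0 := by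
  intro h0
  obtain ⟨k, hk⟩ := Complex.sin_eq_zero_iff.mp h0
  have hpi : (Real.pi : ℂ) ≠ 0 := by exact_mod_cast Real.pi_ne_zero
  have : s = k := by
    apply mul_left_cancel₀ hpi
    rw [hk]; ring
  rw [this] at h
  simp at h

lemma Gamma_inv_eq {s : ℂ} (h : s.im ≠ 0) :
    (Gamma s)⁻¹ = Gamma (1 - s) * sin (Real.pi * s) / Real.pi := by
  have h1 := Complex.Gamma_mul_Gamma_one_sub s
  have h2 := sin_pi_mul_ne_zero_im h
  have hpi : (Real.pi : ℂ) ≠ 0 := by exact_mod_cast Real.pi_ne_zero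
  rw [eq_div_iff h2] at h1
  rw [inv_eq_one_div, div_eq_div_iff _ hpi]
  · rw [one_mul]; linear_combination -h1
  · intro h3; rw [h3] at h1; simp at h1; exact hpi (by exact_mod_cast h1.symm)

lemma Gamma_lower : ∃ C > 0, ∀ s : ℂ, -1 / 2 ≤ s.re → 1 ≤ |s.im| →
    ‖(Gamma s)⁻¹‖ ≤ C * |s.im| ^ (1 / 2 - s.re) * Real.exp (Real.pi * |s.im| / 2) := by
  obtain ⟨C, hC, h⟩ := Gamma_left
  refine ⟨C, hC, fun s h1 h2 => ?_⟩
  have h0 : s.im ≠ 0 := by intro h0; rw [h0] at h2; simp at h2; linarith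
  rw [Gamma_inv_eq h0, norm_div, norm_mul]
  have h3 := h (1 - s) (by simp; linarith) (by simpa using h2)
  simp only [sub_re, one_re, sub_im, one_im, zero_sub, abs_neg] at h3
  have h4 := norm_sin_le (Real.pi * s)
  have h5 : |((Real.pi : ℂ) * s).im| = Real.pi * |s.im| := by
    simp [abs_mul, abs_of_pos Real.pi_pos]
  rw [h5] at h4
  have hpi : ‖(Real.pi : ℂ)‖ = Real.pi := by simp [abs_of_pos Real.pi_pos]
  rw [hpi]
  calc _ ≤ ‖Gamma (1 - s)‖ * ‖sin (Real.pi * s)‖ := by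
        apply div_le_self (by positivity)
        linarith [Real.pi_gt_three]
    _ ≤ (C * |s.im| ^ (1 - s.re - 1 / 2) * Real.exp (-Real.pi * |s.im| / 2)) * Real.exp (Real.pi * |s.im|) := by gcongr
    _ = C * |s.im| ^ (1 - s.re - 1 / 2) * Real.exp (-Real.pi * |s.im| / 2 + Real.pi * |s.im|) := by
      rw [Real.exp_add]; ring
    _ = _ := by ring_nf

lemma Lam0_bound (a b : ℝ) : ∃ C, ∀ s : ℂ, a ≤ s.re → s.re ≤ b → ‖completedRiemannZeta₀ s‖ ≤ C := by
  set P := HurwitzZeta.hurwitzEvenFEPair 0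
  set f := P.f_modif
  have hconv : ∀ s : ℂ, MellinConvergent f s := fun s =>
    (P.isStrongFEPair_toStrongFEPair.hasMellin s).1
  have hIntegr : ∀ x : ℝ, MeasureTheory.IntegrableOn (fun t : ℝ => t ^ (x - 1) * ‖f t‖) (Set.Ioi 0) := by
    intro x
    have := (hconv x).norm
    refine MeasureTheory.IntegrableOn.congr_fun this ?_ measurableSet_Ioi
    intro t ht
    simp only [norm_smul]
    rw [norm_cpow_eq_rpow_re_of_pos ht]
    simp
  refine ⟨(∫ t in Set.Ioi (0:ℝ), (t ^ (a/2 - 1) * ‖f t‖ + t ^ (b/2 - 1) * ‖f t‖)) / 2, ?_⟩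
  intro s h1 h2
  have e : completedRiemannZeta₀ s = mellin f (s/2) / 2 := rfl
  rw [e, norm_div, Complex.norm_ofNat]
  gcongr
  rw [mellin]
  refine MeasureTheory.norm_integral_le_of_norm_le ((hIntegr _).add (hIntegr _)) ?_
  filter_upwards [MeasureTheory.ae_restrict_mem measurableSet_Ioi] with t ht
  rw [norm_smul, norm_cpow_eq_rpow_re_of_pos ht, ← add_mul]
  have hre : (s/2 - 1).re = s.re/2 - 1 := by simp
  rw [hre]
  gcongr
  have ht : (0:ℝ) < t := ht
  rcases le_total t 1 with h | h
  · have := Real.rpow_le_rpow_of_exponent_ge ht h (show a/2 - 1 ≤ s.re/2 - 1 by linarith)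
    have h3 : 0 ≤ t ^ (b/2-1) := by positivity
    linarith
  · have := Real.rpow_le_rpow_of_exponent_le h (show s.re/2 - 1 ≤ b/2 - 1 by linarith)
    have h3 : 0 ≤ t ^ (a/2-1) := by positivity
    linarith

/-- crude exponential growth -/
lemma zeta_crude : ∃ K > 0, ∀ s : ℂ, -1 ≤ s.re → s.re ≤ 4 → 2 ≤ |s.im| →
    ‖riemannZeta s‖ ≤ K * Real.exp (K * |s.im|) := by
  obtain ⟨C, hC⟩ := Lam0_bound (-1) 4
  obtain ⟨D, hD, hG⟩ := Gamma_lower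
  refine ⟨(|C| + 2) * (Real.pi ^ 2 * D) + 4, by positivity, ?_⟩
  intro s h1 h2 h3
  have hs0 : s ≠ 0 := by rintro rfl; simp at h3; linarith
  have hs1 : (1:ℝ) ≤ ‖s‖ := by linarith [Complex.abs_im_le_norm s]
  have hs2 : (1:ℝ) ≤ ‖1 - s‖ := by
    have := Complex.abs_im_le_norm (1 - s); simp at this; linarith
  rw [riemannZeta_eq_completedRiemannZeta₀ hs0, div_eq_mul_inv, mul_inv, norm_mul, norm_mul]
  have g := hG (s/2) (by simp; linarith) (by simp [abs_div]; linarith)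
  have e1 : |(s/2).im| = |s.im|/2 := by simp [abs_div]
  have e2 : (s/2).re = s.re/2 := by simp
  rw [e1, e2] at g
  have b1 : ‖completedRiemannZeta₀ s - 1 / s - 1 / (1 - s)‖ ≤ |C| + 2 := by
    have t1 : ‖1/s‖ ≤ 1 := by rw [norm_div, norm_one]; exact div_le_one_of_le₀ hs1 (norm_nonneg _)
    have t2 : ‖1/(1-s)‖ ≤ 1 := by rw [norm_div, norm_one]; exact div_le_one_of_le₀ hs2 (norm_nonneg _)
    have := norm_sub_le (completedRiemannZeta₀ s - 1 / s) (1 / (1 - s))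
    have := norm_sub_le (completedRiemannZeta₀ s) (1 / s)
    have := hC s h1 h2
    have := le_abs_self C
    linarith
  have b2 : ‖((Real.pi : ℂ) ^ (-s/2))⁻¹‖ ≤ Real.pi ^ 2 := by
    rw [norm_inv, norm_cpow_eq_rpow_re_of_pos Real.pi_pos, ← Real.rpow_neg Real.pi_pos.le]
    rw [← Real.rpow_natCast]
    apply Real.rpow_le_rpow_of_exponent_le (by linarith [Real.pi_gt_three])
    simp; linarith
  have b3 : ‖(Gamma (s/2))⁻¹‖ ≤ D * Real.exp (4 * |s.im|) := by
    refine g.trans ?_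
    rw [mul_assoc]
    gcongr
    have : (|s.im|/2) ^ (1/2 - s.re/2) ≤ Real.exp (|s.im|/2) := by
      calc (|s.im|/2) ^ (1/2 - s.re/2) ≤ (|s.im|/2) ^ (1:ℝ) :=
            Real.rpow_le_rpow_of_exponent_le (by linarith) (by linarith)
        _ ≤ _ := by rw [Real.rpow_one]; linarith [Real.add_one_le_exp (|s.im|/2)]
    calc _ ≤ Real.exp (|s.im|/2) * Real.exp (Real.pi * (|s.im|/2)/2) := by gcongr
      _ = Real.exp (|s.im|/2 + Real.pi * (|s.im|/2)/2) := by rw [Real.exp_add]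
      _ ≤ _ := by
        apply Real.exp_le_exp.mpr
        nlinarith [Real.pi_le_four]
  set K := (|C| + 2) * (Real.pi ^ 2 * D) + 4
  have hK : (|C| + 2) * (Real.pi ^ 2 * D) ≤ K := by simp [K]
  have hK4 : 4 ≤ K := by
    have : 0 ≤ (|C| + 2) * (Real.pi ^ 2 * D) := by positivity
    simp only [K]; linarith
  calc _ ≤ (|C| + 2) * (Real.pi ^ 2 * (D * Real.exp (4 * |s.im|))) := by gcongr
    _ = ((|C| + 2) * (Real.pi ^ 2 * D)) * Real.exp (4 * |s.im|) := by ring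
    _ ≤ _ := by gcongr

/-- the functional equation factor -/
noncomputable def feK (w : ℂ) : ℂ := 2 * (2 * Real.pi) ^ (-w) * Gamma w * cos (Real.pi * w / 2)

lemma zeta_fe {w : ℂ} (h : w.im ≠ 0) : riemannZeta (1 - w) = feK w * riemannZeta w := by
  rw [feK, riemannZeta_one_sub]
  · intro n hn; rw [hn] at h; simp at h
  · intro hn; rw [hn] at h; simp at h

lemma feK_bound : ∃ C > 0, ∀ w : ℂ, 1/2 ≤ w.re → 1 ≤ |w.im| →
    ‖feK w‖ ≤ C * ‖w‖ ^ (w.re - 1/2) := by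
  obtain ⟨C, hC, h⟩ := Gamma_right
  refine ⟨2 * C, by positivity, fun w h1 h2 => ?_⟩
  have g := h w h1 h2
  have c := norm_cos_le (Real.pi * w / 2)
  have h5 : |((Real.pi : ℂ) * w / 2).im| = Real.pi * |w.im| / 2 := by
    simp [abs_mul, abs_div, abs_of_pos Real.pi_pos]
  rw [h5] at c
  rw [feK, norm_mul, norm_mul, norm_mul, Complex.norm_ofNat]
  have p : ‖(2 * Real.pi : ℂ) ^ (-w)‖ ≤ 1 := by
    have : (2 * Real.pi : ℂ) = ((2 * Real.pi : ℝ) : ℂ) := by push_cast; rfl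
    rw [this, norm_cpow_eq_rpow_re_of_pos (by positivity)]
    apply Real.rpow_le_one_of_one_le_of_nonpos
    · linarith [Real.pi_gt_three]
    · simp; linarith
  calc _ ≤ 2 * 1 * (C * ‖w‖ ^ (w.re - 1 / 2) * Real.exp (-Real.pi * |w.im| / 2)) * Real.exp (Real.pi * |w.im| / 2) := by gcongr
    _ = 2 * C * ‖w‖ ^ (w.re - 1 / 2) * (Real.exp (-Real.pi * |w.im| / 2) * Real.exp (Real.pi * |w.im| / 2)) := by ring
    _ = _ := by rw [← Real.exp_add]; ring_nf; simp

lemma zeta_norm_le_real {s : ℂ} {x : ℝ} (hx : 1 < x) (hs : x ≤ s.re) :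
    ‖riemannZeta s‖ ≤ ‖riemannZeta x‖ := by
  have hs' : 1 < s.re := by linarith
  have hsum : Summable (fun n : ℕ => 1 / ((n:ℝ) + 1) ^ x) := by
    have := (Real.summable_one_div_nat_rpow (p := x)).mpr hx
    exact_mod_cast (summable_nat_add_iff 1).mpr this
  have e : riemannZeta x = ((∑' n : ℕ, 1 / ((n:ℝ) + 1) ^ x : ℝ) : ℂ) := by
    rw [zeta_eq_tsum_one_div_nat_add_one_cpow (by simpa using hx), Complex.ofReal_tsum]
    congr 1; ext n
    push_cast
    rw [← Complex.ofReal_natCast, ← Complex.ofReal_one, ← Complex.ofReal_add, Complex.ofReal_cpow (by positivity)]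
  have e2 : ‖riemannZeta x‖ = ∑' n : ℕ, 1 / ((n:ℝ) + 1) ^ x := by
    rw [e, Complex.norm_real, Real.norm_of_nonneg]
    exact tsum_nonneg fun n => by positivity
  rw [e2, zeta_eq_tsum_one_div_nat_add_one_cpow hs']
  apply tsum_of_norm_bounded hsum.hasSum
  intro n
  rw [norm_div, norm_one]
  have : ((n : ℂ) + 1) = ((n + 1 : ℝ) : ℂ) := by push_cast; rfl
  rw [this, norm_cpow_eq_rpow_re_of_pos (by positivity)]
  gcongr
  linarith [(by positivity : (0:ℝ) ≤ n)]
  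
lemma zeta_right : ∃ C > 0, ∀ (η : ℝ) (s : ℂ), 0 < η → η ≤ 1/4 → 1 + η ≤ s.re →
    ‖riemannZeta s‖ ≤ C / η := by
  obtain ⟨M, hM⟩ : ∃ M, ∀ x ∈ Set.Icc (1 : ℝ) (5/4), ‖riemannZeta₁ (x:ℂ)‖ ≤ M := by
    apply isCompact_Icc.exists_bound_of_continuousOn
    exact (differentiable_riemannZeta₁.continuous.comp continuous_ofReal).continuousOn
  refine ⟨|M| + 1, by positivity, fun η s h1 h2 h3 => ?_⟩
  refine (zeta_norm_le_real (by linarith : 1 < 1 + η) h3).trans ?_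
  have h4 := hM (1 + η) ⟨by linarith, by linarith⟩
  have hne : ((1 + η : ℝ) : ℂ) ≠ 1 := by
    intro h; rw [show (1:ℂ) = ((1:ℝ):ℂ) by simp] at h
    have := Complex.ofReal_injective h; linarith
  rw [riemannZeta_eq_inv_sub_mul hne, norm_mul, norm_inv]
  have : ‖((1 + η : ℝ) : ℂ) - 1‖ = η := by
    rw [show ((1 + η : ℝ) : ℂ) - 1 = (η : ℂ) by push_cast; ring]; simp [abs_of_pos h1]
  rw [this, inv_mul_eq_div]
  gcongr
  linarith [le_abs_self M]

lemma zeta1_eq {s : ℂ} (h : s ≠ 1) : riemannZeta₁ s = (s - 1) * riemannZeta s := by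
  rw [riemannZeta_eq_inv_sub_mul h]
  field_simp [sub_ne_zero.mpr h]

lemma zeta1_compact : ∃ M > 0, ∀ s : ℂ, -1 ≤ s.re → s.re ≤ 4 → |s.im| ≤ 2 → ‖riemannZeta₁ s‖ ≤ M := by
  obtain ⟨M, hM⟩ : ∃ M, ∀ x ∈ (Set.Icc (-1 : ℝ) 4 ×ℂ Set.Icc (-2:ℝ) 2), ‖riemannZeta₁ x‖ ≤ M := by
    apply (isCompact_Icc.reProdIm isCompact_Icc).exists_bound_of_continuousOn
    exact (differentiable_riemannZeta₁.continuous).continuousOn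
  refine ⟨|M| + 1, by positivity, fun s h1 h2 h3 => ?_⟩
  have := hM s ⟨⟨h1, h2⟩, abs_le.mp h3⟩
  linarith [le_abs_self M]

lemma zeta1_crude : ∃ K > 0, ∀ s : ℂ, -1 ≤ s.re → s.re ≤ 4 →
    ‖riemannZeta₁ s‖ ≤ K * Real.exp (K * |s.im|) := by
  obtain ⟨K, hK, h⟩ := zeta_crude
  obtain ⟨M, hM0, hM⟩ := zeta1_compact
  refine ⟨M + 6 * K + 1, by positivity, fun s h1 h2 => ?_⟩
  rcases le_total |s.im| 2 with h3 | h3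
  · calc _ ≤ M := hM s h1 h2 h3
      _ ≤ (M + 6 * K + 1) * 1 := by linarith
      _ ≤ _ := by gcongr; apply Real.one_le_exp; positivity
  · have hs : s ≠ 1 := by rintro rfl; simp at h3; linarith
    rw [zeta1_eq hs, norm_mul]
    have e : ‖s - 1‖ ≤ 6 * Real.exp |s.im| := by
      have h4 := Complex.norm_le_abs_re_add_abs_im (s - 1)
      have : |(s-1).re| ≤ 3 := by rw [abs_le]; simp; constructor <;> linarith
      have h5 : |(s-1).im| = |s.im| := by simp
      have := Real.add_one_le_exp |s.im|
      linarith
    calc _ ≤ (6 * Real.exp |s.im|) * (K * Real.exp (K * |s.im|)) := by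
          gcongr; exact h s h1 h2 h3
      _ = (6 * K) * Real.exp (|s.im| + K * |s.im|) := by rw [Real.exp_add]; ring
      _ ≤ _ := by
          gcongr
          · linarith
          · nlinarith [abs_nonneg s.im, mul_nonneg hK.le (abs_nonneg s.im)]

lemma one_add_abs_le (y t : ℝ) : 1 + |y| ≤ (1 + |t|) * (1 + |y - t|) := by
  have h3 : |y| ≤ |t| + |y - t| := by
    have := abs_add_le t (y - t); simpa using this
  nlinarith [mul_nonneg (abs_nonneg t) (abs_nonneg (y - t))]

lemma zeta1_left_line : ∃ C > 0, ∀ (η : ℝ) (z : ℂ), 0 < η → η ≤ 1/4 → z.re = -η →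
    ‖riemannZeta₁ z‖ ≤ C / η * (1 + |z.im|) ^ (3/2 + η) := by
  obtain ⟨M, hM0, hM⟩ := zeta1_compact
  obtain ⟨C1, hC1, h1⟩ := feK_bound
  obtain ⟨C2, hC2, h2⟩ := zeta_right
  refine ⟨M + 2 * C1 * C2, by positivity, fun η z hη hη' hz => ?_⟩
  have hb : 1 ≤ (1 + |z.im|) ^ (3/2 + η) := Real.one_le_rpow (by linarith [abs_nonneg z.im]) (by linarith)
  rcases le_total |z.im| 1 with h3 | h3
  · calc _ ≤ M := hM z (by linarith) (by linarith) (by linarith)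
      _ ≤ (M + 2 * C1 * C2) / η * 1 := by
        rw [mul_one, le_div_iff₀ hη]
        have : 0 < C1 * C2 := by positivity
        nlinarith
      _ ≤ _ := by gcongr
  · have hne : z ≠ 1 := by rintro rfl; simp at h3; linarith
    set w := 1 - z with hw
    have hwre : w.re = 1 + η := by simp [hw, hz]
    have hwim : |w.im| = |z.im| := by simp [hw]
    have hzw : z = 1 - w := by simp [hw]
    have hwi : w.im ≠ 0 := by intro h; rw [h] at hwim; simp at hwim; rw [← hwim] at h3; linarith
    have hwp : 0 < ‖w‖ := by
      apply norm_pos_iff.mpr; intro h; rw [h] at hwi; simp at hwi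
    rw [zeta1_eq hne, hzw, zeta_fe hwi, show (1 - w - 1) = -w by ring, norm_mul, norm_mul, norm_neg]
    have k1 := h1 w (by linarith) (by linarith)
    have k2 := h2 η w hη hη' hwre.ge
    rw [hwre] at k1
    have him : (1 - w).im = z.im := by rw [← hzw]
    rw [him]
    have hn : ‖w‖ ≤ (5/4) * (1 + |z.im|) := by
      have := Complex.norm_le_abs_re_add_abs_im w
      rw [hwre, hwim, abs_of_pos (by linarith)] at this
      linarith
    calc ‖w‖ * (‖feK w‖ * ‖riemannZeta w‖) ≤ ‖w‖ * ((C1 * ‖w‖ ^ (1 + η - 1/2)) * (C2 / η)) := by gcongr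
      _ = C1 * C2 / η * (‖w‖ ^ (1:ℝ) * ‖w‖ ^ (1 + η - 1/2)) := by rw [Real.rpow_one]; ring
      _ = C1 * C2 / η * ‖w‖ ^ (3/2 + η) := by rw [← Real.rpow_add hwp]; ring_nf
      _ ≤ C1 * C2 / η * ((5/4) * (1 + |z.im|)) ^ (3/2 + η) := by gcongr
      _ = C1 * C2 / η * ((5/4) ^ (3/2 + η) * (1 + |z.im|) ^ (3/2 + η)) := by
        rw [Real.mul_rpow (by norm_num) (by positivity)]
      _ ≤ C1 * C2 / η * (2 * (1 + |z.im|) ^ (3/2 + η)) := by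
        gcongr
        calc (5/4 : ℝ) ^ (3/2 + η) ≤ (5/4) ^ (2:ℝ) :=
              Real.rpow_le_rpow_of_exponent_le (by norm_num) (by linarith)
          _ ≤ 2 := by norm_num
      _ = (2 * C1 * C2) / η * (1 + |z.im|) ^ (3/2 + η) := by ring
      _ ≤ _ := by gcongr; linarith

/-- convexity bound -/
lemma zeta_convex : ∃ C > 0, ∀ (η : ℝ) (s : ℂ), 0 < η → η ≤ 1/4 → -η ≤ s.re → s.re ≤ 1 + η →
    1 ≤ |s.im| → ‖riemannZeta s‖ ≤ C / η * (1 + |s.im|) ^ ((1 + η - s.re) / 2) := by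
  obtain ⟨K, hK, hcr⟩ := zeta1_crude
  obtain ⟨C1, hC1, h1⟩ := zeta1_left_line
  obtain ⟨C2, hC2, h2⟩ := zeta_right
  obtain ⟨M, hM0, hM⟩ := zeta1_compact
  set D := C1 + 2 * C2 + M with hD
  refine ⟨2 * (Real.exp ((5/4 : ℝ) ^ 2 + ((2 : ℕ) : ℝ) ^ 2) * D), by positivity, ?_⟩
  intro η s hη hη' hs1 hs2 hs3
  set t := s.im with ht
  have htp : (1:ℝ) ≤ 1 + |t| := by linarith [abs_nonneg t]
  have main := three_lines_gauss (f := riemannZeta₁) (l := -η) (u := 1 + η) (T := t)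
    (A := D / η * (1 + |t|) ^ (3/2 + η)) (B := D / η * (1 + |t|)) (K := K) (H := 5/4) 2
    (by linarith) (by linarith) (by linarith) (by positivity) (by positivity)
    differentiable_riemannZeta₁.diffContOnCl
    (fun z h1 h2 => hcr z (by linarith) (by linarith)) ?_ ?_ s.re hs1 hs2
  · rw [Complex.re_add_im] at main
    have hne : s ≠ 1 := by intro h; rw [ht, h] at hs3; simp at hs3; linarith
    rw [zeta1_eq hne, norm_mul] at main
    have hn : (1 + |t|) / 2 ≤ ‖s - 1‖ := by
      have := Complex.abs_im_le_norm (s - 1)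
      simp only [sub_im, one_im, sub_zero] at this
      rw [← ht] at this; linarith
    have hDη : 0 < D / η := by positivity
    set θ := (s.re - -η) / (1 + η - -η) with hθ
    have e1 : (D / η * (1 + |t|) ^ (3 / 2 + η)) ^ (1 - θ) * (D / η * (1 + |t|)) ^ θ =
      D / η * ((1 + |t|) * (1 + |t|) ^ ((1 + η - s.re) / 2)) := by
      rw [Real.mul_rpow hDη.le (by positivity), Real.mul_rpow hDη.le (by positivity),
        ← Real.rpow_mul (by positivity)]
      have a1 : D / η = (D/η) ^ (1 - θ) * (D/η) ^ θ := by rw [← Real.rpow_add hDη]; simp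
      have a2 : (1 + |t|) * (1 + |t|) ^ ((1 + η - s.re) / 2) =
          (1 + |t|) ^ ((3 / 2 + η) * (1 - θ)) * (1 + |t|) ^ θ := by
        conv_lhs => rw [show (1 + |t|) * (1 + |t|) ^ ((1 + η - s.re) / 2) = (1 + |t|) ^ (1:ℝ) * (1 + |t|) ^ ((1 + η - s.re) / 2) by rw [Real.rpow_one]]
        rw [← Real.rpow_add (by positivity), ← Real.rpow_add (by positivity)]
        congr 1
        rw [hθ]
        have : (1 + η - -η) ≠ 0 := by linarith
        field_simp
        ring
      rw [a2]
      conv_rhs => rw [a1]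
      ring
    rw [e1] at main
    have hpos : 0 < (1 + |t|) / 2 := by positivity
    have := (mul_le_mul_of_nonneg_right hn (norm_nonneg (riemannZeta s))).trans main
    refine le_of_mul_le_mul_left (this.trans (le_of_eq ?_)) hpos
    ring
  · intro z hz
    refine (h1 η z hη hη' hz).trans ?_
    have h3 := one_add_abs_le z.im t
    calc C1 / η * (1 + |z.im|) ^ (3 / 2 + η) ≤ D / η * ((1 + |t|) * (1 + |z.im - t|)) ^ (3/2 + η) := by
          gcongr
          linarith
      _ = D / η * ((1 + |t|) ^ (3/2 + η) * (1 + |z.im - t|) ^ (3/2 + η)) := by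
          rw [Real.mul_rpow (by positivity) (by positivity)]
      _ ≤ D / η * ((1 + |t|) ^ (3/2 + η) * (1 + |z.im - t|) ^ ((2 : ℕ) : ℝ)) := by
          gcongr
          · linarith [abs_nonneg (z.im - t)]
          · push_cast; linarith
      _ = _ := by rw [Real.rpow_natCast]; ring
  · intro z hz
    have h3 := one_add_abs_le z.im t
    have hz1 : (1 + |z.im - t|) ≤ (1 + |z.im - t|)^2 := by nlinarith [abs_nonneg (z.im - t)]
    have hne : z ≠ 1 := by intro h; rw [h] at hz; simp at hz; linarith
    have e : ‖z - 1‖ ≤ 2 * (1 + |z.im|) := by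
      have h4 := Complex.norm_le_abs_re_add_abs_im (z - 1)
      simp only [sub_re, one_re, sub_im, one_im, sub_zero, hz] at h4
      rw [show (1 + η - 1) = η by ring, abs_of_pos hη] at h4
      linarith [abs_nonneg z.im]
    rw [zeta1_eq hne, norm_mul]
    calc _ ≤ (2 * (1 + |z.im|)) * (C2 / η) := by gcongr; exact h2 η z hη hη' hz.ge
      _ ≤ (2 * ((1 + |t|) * (1 + |z.im - t|)^2)) * (C2 / η) := by
        gcongr
        refine h3.trans ?_
        gcongr
      _ = (2 * C2) / η * (1 + |t|) * (1 + |z.im - t|)^2 := by ring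
      _ ≤ _ := by gcongr; linarith

lemma zeta_poly : ∃ C > 0, ∀ s : ℂ, -30 ≤ s.re → 1 ≤ |s.im| →
    ‖riemannZeta s‖ ≤ C * (1 + |s.im|) ^ 31 := by
  obtain ⟨C1, hC1, h1⟩ := feK_bound
  obtain ⟨C2, hC2, h2⟩ := zeta_right
  obtain ⟨C3, hC3, h3⟩ := zeta_convex
  refine ⟨4 * C2 + 4 * C3 + C1 * (4 * C2) * 31 ^ 31, by positivity, fun s hs ht => ?_⟩
  have hb : 1 ≤ (1 + |s.im|) ^ 31 := one_le_pow₀ (by linarith [abs_nonneg s.im])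
  have hr : ∀ z : ℂ, 5/4 ≤ z.re → ‖riemannZeta z‖ ≤ 4 * C2 := by
    intro z hz
    have := h2 (1/4) z (by norm_num) le_rfl (by linarith)
    linarith
  rcases le_total (5/4) s.re with h | h
  · calc _ ≤ 4 * C2 := hr s h
      _ ≤ (4 * C2 + 4 * C3 + C1 * (4 * C2) * 31 ^ 31) * 1 := by
        have : 0 < C1 * (4 * C2) * 31 ^ 31 := by positivity
        linarith
      _ ≤ _ := by gcongr
  rcases le_total (-1/4) s.re with h' | h'
  · have := h3 (1/4) s (by norm_num) le_rfl (by linarith) (by linarith) ht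
    refine this.trans ?_
    have e : (1 + |s.im|) ^ ((1 + 1/4 - s.re)/2) ≤ (1 + |s.im|) ^ 31 := by
      rw [← Real.rpow_natCast]
      apply Real.rpow_le_rpow_of_exponent_le (by linarith [abs_nonneg s.im])
      push_cast; linarith
    calc _ ≤ C3 / (1/4) * (1 + |s.im|) ^ 31 := by gcongr
      _ ≤ _ := by
        gcongr
        have : 0 < C1 * (4 * C2) * 31 ^ 31 := by positivity
        linarith
  · set w := 1 - s with hw
    have hwre : w.re = 1 - s.re := by simp [hw]
    have hwim : |w.im| = |s.im| := by simp [hw]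
    have hzw : s = 1 - w := by simp [hw]
    have hwi : w.im ≠ 0 := by intro h; rw [h] at hwim; simp at hwim; rw [← hwim] at ht; linarith
    have k1 := h1 w (by linarith) (by linarith)
    have k2 := hr w (by linarith)
    have hw1 : 1 ≤ ‖w‖ := by have := Complex.abs_im_le_norm w; linarith
    have hn : ‖w‖ ≤ 31 * (1 + |s.im|) := by
      have := Complex.norm_le_abs_re_add_abs_im w
      rw [hwre, hwim, abs_of_pos (by linarith)] at this
      linarith
    have e : ‖w‖ ^ (w.re - 1/2) ≤ (31 * (1 + |s.im|)) ^ 31 := by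
      calc ‖w‖ ^ (w.re - 1/2) ≤ ‖w‖ ^ ((31:ℕ):ℝ) := by
            apply Real.rpow_le_rpow_of_exponent_le hw1
            push_cast; linarith
        _ = ‖w‖ ^ 31 := by rw [Real.rpow_natCast]
        _ ≤ _ := by gcongr
    have : riemannZeta s = feK w * riemannZeta w := by rw [← zeta_fe hwi, ← hzw]
    rw [this, norm_mul]
    calc _ ≤ (C1 * (31 * (1 + |s.im|)) ^ 31) * (4 * C2) := by
          gcongr
          exact k1.trans (by gcongr)
      _ = C1 * (4 * C2) * 31 ^ 31 * (1 + |s.im|) ^ 31 := by ring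
      _ ≤ _ := by gcongr; linarith

lemma zeta_iteratedDeriv_cauchy (k : ℕ) {s : ℂ} {r M : ℝ} (hr : 0 < r) (hr1 : r < |s.im|)
    (hM : ∀ z : ℂ, ‖z - s‖ = r → ‖riemannZeta z‖ ≤ M) :
    ‖iteratedDeriv k riemannZeta s‖ ≤ k.factorial * M / r ^ k := by
  apply Complex.norm_iteratedDeriv_le_of_forall_mem_sphere_norm_le k hr
  · apply DifferentiableOn.diffContOnCl
    rw [closure_ball _ hr.ne']
    intro z hz
    apply DifferentiableAt.differentiableWithinAt
    apply differentiableAt_riemannZeta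
    rintro rfl
    rw [Metric.mem_closedBall, dist_eq_norm] at hz
    have := Complex.abs_im_le_norm (1 - s)
    simp at this
    linarith
  · intro z hz
    exact hM z (by simpa [dist_eq_norm] using hz)

/-- derivative bounds near the critical strip -/
lemma zeta_deriv_strip (k : ℕ) : ∃ C > 0, ∀ (L : ℝ) (s : ℂ), 8 ≤ L → -1 / L ≤ s.re → s.re ≤ 1 →
    2 ≤ |s.im| → |s.im| ≤ Real.exp L →
    ‖iteratedDeriv k riemannZeta s‖ ≤ C * L ^ (k + 1) * |s.im| ^ ((1 - s.re) / 2) := by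
  obtain ⟨C, hC, h⟩ := zeta_convex
  refine ⟨k.factorial * (C * 3 * Real.exp 2), by positivity, ?_⟩
  intro L s hL h1 h2 h3 h4
  have hL0 : 0 < L := by linarith
  have hrL : 1 / L ≤ 1/8 := by gcongr
  have hrL0 : 0 < 1/L := by positivity
  have e2 : 2 / L = 2 * (1/L) := by ring
  have e1 : -1 / L = -(1/L) := by ring
  rw [e1] at h1
  have := zeta_iteratedDeriv_cauchy k (s := s) (r := 1/L) (M := C * L * (3 * Real.exp 2 * |s.im| ^ ((1 - s.re)/2))) hrL0 (by linarith) ?_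
  · refine this.trans (le_of_eq ?_)
    rw [one_div, inv_pow, div_inv_eq_mul, pow_succ]; ring
  · intro z hz
    have hre : |z.re - s.re| ≤ 1/L := by
      have := Complex.abs_re_le_norm (z - s); rw [hz] at this; simpa using this
    have him : |z.im - s.im| ≤ 1/L := by
      have := Complex.abs_im_le_norm (z - s); rw [hz] at this; simpa using this
    rw [abs_le] at hre
    have him1 : |z.im| ≤ |s.im| + 1/L := by
      have := abs_add_le s.im (z.im - s.im); simp at this; linarith [him]
    have him2 : |s.im| ≤ |z.im| + 1/L := by
      have := abs_sub_abs_le_abs_sub s.im z.im; rw [abs_sub_comm] at this; linarith [him]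
    have b := h (2/L) z (by positivity) (by linarith) (by linarith) (by linarith) (by linarith)
    refine b.trans ?_
    have hs0 : 0 < |s.im| := by linarith
    have c1 : (1 + |z.im|) ^ ((1 + 2/L - z.re)/2) ≤ 3 * Real.exp 2 * |s.im| ^ ((1 - s.re)/2) := by
      calc (1 + |z.im|) ^ ((1 + 2/L - z.re)/2) ≤ (3 * |s.im|) ^ ((1 + 2/L - z.re)/2) := by
            gcongr
            · linarith
            · linarith
        _ ≤ (3 * |s.im|) ^ ((1 - s.re)/2 + 2 / L) := by
            apply Real.rpow_le_rpow_of_exponent_le (by linarith)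
            linarith
        _ = 3 ^ ((1 - s.re)/2 + 2 / L) * (|s.im| ^ ((1 - s.re)/2) * |s.im| ^ (2/L)) := by
            rw [Real.mul_rpow (by norm_num) hs0.le, ← Real.rpow_add hs0]
        _ ≤ 3 ^ (1:ℝ) * (|s.im| ^ ((1 - s.re)/2) * (Real.exp L) ^ (2/L)) := by
            gcongr
            · norm_num
            · linarith
        _ = _ := by
            rw [← Real.exp_mul, Real.rpow_one]
            have : L * (2 / L) = 2 := by field_simp
            rw [this]; ring
    have c2 : C / (2/L) ≤ C * L := by
      rw [div_div_eq_mul_div]; nlinarith [mul_pos hC hL0]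
    gcongr

lemma zeta_deriv_right (k : ℕ) : ∃ C > 0, ∀ (L : ℝ) (s : ℂ), 8 ≤ L → 1 ≤ s.re →
    2 ≤ |s.im| → |s.im| ≤ Real.exp L →
    ‖iteratedDeriv k riemannZeta s‖ ≤ C * L ^ (k + 1) := by
  obtain ⟨C, hC, h⟩ := zeta_convex
  obtain ⟨C2, hC2, h2⟩ := zeta_right
  refine ⟨k.factorial * (C * 3 * Real.exp 2 + C2), by positivity, ?_⟩
  intro L s hL h1 h3 h4
  have hL0 : 0 < L := by linarith
  have hrL : 1 / L ≤ 1/8 := by gcongr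
  have hrL0 : 0 < 1/L := by positivity
  have e2 : 2 / L = 2 * (1/L) := by ring
  have := zeta_iteratedDeriv_cauchy k (s := s) (r := 1/L) (M := (C * 3 * Real.exp 2 + C2) * L) hrL0 (by linarith) ?_
  · refine this.trans (le_of_eq ?_)
    rw [one_div, inv_pow, div_inv_eq_mul, pow_succ]; ring
  · intro z hz
    have hre : |z.re - s.re| ≤ 1/L := by
      have := Complex.abs_re_le_norm (z - s); rw [hz] at this; simpa using this
    have him : |z.im - s.im| ≤ 1/L := by
      have := Complex.abs_im_le_norm (z - s); rw [hz] at this; simpa using this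
    rw [abs_le] at hre
    have him1 : |z.im| ≤ |s.im| + 1/L := by
      have := abs_add_le s.im (z.im - s.im); simp at this; linarith [him]
    have him2 : |s.im| ≤ |z.im| + 1/L := by
      have := abs_sub_abs_le_abs_sub s.im z.im; rw [abs_sub_comm] at this; linarith [him]
    have c2 : ∀ C : ℝ, 0 < C → C / (2/L) ≤ C * L := by
      intro C hC
      rw [div_div_eq_mul_div]; nlinarith [mul_pos hC hL0]
    have hs0 : 0 < |s.im| := by linarith
    have hp1 : 0 < C * 3 * Real.exp 2 * L := by positivity
    have hp2 : 0 < C2 * L := by positivity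
    rcases le_total z.re (1 + 2/L) with hz1 | hz1
    · have b := h (2/L) z (by positivity) (by linarith) (by linarith) (by linarith) (by linarith)
      refine b.trans ?_
      have c1 : (1 + |z.im|) ^ ((1 + 2/L - z.re)/2) ≤ 3 * Real.exp 2 := by
        calc (1 + |z.im|) ^ ((1 + 2/L - z.re)/2) ≤ (3 * |s.im|) ^ ((1 + 2/L - z.re)/2) := by
              gcongr
              · linarith
          _ ≤ (3 * |s.im|) ^ (2 / L) := by
              apply Real.rpow_le_rpow_of_exponent_le (by linarith)
              linarith
          _ = 3 ^ (2 / L) * |s.im| ^ (2/L) := by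
              rw [Real.mul_rpow (by norm_num) hs0.le]
          _ ≤ 3 ^ (1:ℝ) * (Real.exp L) ^ (2/L) := by
              gcongr
              · norm_num
              · linarith
          _ = _ := by
              rw [← Real.exp_mul, Real.rpow_one]
              have : L * (2 / L) = 2 := by field_simp
              rw [this]
      calc _ ≤ (C * L) * (3 * Real.exp 2) := by gcongr; exact c2 C hC
        _ ≤ _ := by linarith
    · have b := h2 (2/L) z (by positivity) (by linarith) hz1
      have := c2 C2 hC2
      linarith

/-- Borel–Carathéodory for a nonvanishing function: bounds for the logarithmic derivative. -/
lemma logDeriv_bound {g : ℂ → ℂ} {s₀ : ℂ} {R M : ℝ} (hR : 0 < R) (hM : 0 < M)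
    (hg : DifferentiableOn ℂ g (Metric.ball s₀ R)) (h0 : ∀ z ∈ Metric.ball s₀ R, g z ≠ 0)
    (hb : ∀ z ∈ Metric.ball s₀ R, ‖g z‖ ≤ Real.exp M * ‖g s₀‖) (z : ℂ) (hz : ‖z - s₀‖ ≤ R / 2) :
    ‖logDeriv g z‖ ≤ 24 * M / R ∧ ‖deriv (logDeriv g) z‖ ≤ 192 * M / R ^ 2 := by
  have hs0 : s₀ ∈ Metric.ball s₀ R := Metric.mem_ball_self hR
  have hgd : DifferentiableOn ℂ (fun z => deriv g z / g z) (Metric.ball s₀ R) :=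
    (hg.deriv Metric.isOpen_ball).div hg h0
  obtain ⟨h, hh0, hh⟩ := hgd.isExactOn_ball.with_val_at s₀ 0
  have hgat : ∀ z ∈ Metric.ball s₀ R, HasDerivAt g (deriv g z) z := fun z hz =>
    (hg.differentiableAt (Metric.isOpen_ball.mem_nhds hz)).hasDerivAt
  have hconst : ∀ z ∈ Metric.ball s₀ R, g z * cexp (-h z) = g s₀ := by
    intro z hz
    have hd : ∀ w ∈ Metric.ball s₀ R, HasDerivAt (fun w => g w * cexp (-h w)) 0 w := by
      intro w hw
      have := (hgat w hw).mul ((hh w hw).neg.cexp)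
      refine this.congr_deriv ?_
      have hne := h0 w hw
      have e : deriv g w / g w * g w = deriv g w := div_mul_cancel₀ _ hne
      linear_combination -cexp (-h w) * e
    have := (convex_ball s₀ R).is_const_of_fderivWithin_eq_zero (𝕜 := ℂ) (f := fun w => g w * cexp (-h w))
      (fun w hw => (hd w hw).differentiableAt.differentiableWithinAt) (fun w hw => by
        rw [fderivWithin_of_isOpen Metric.isOpen_ball hw]
        ext
        simp [(hd w hw).deriv]) hz hs0
    simpa [hh0] using this
  have hre : ∀ z ∈ Metric.ball s₀ R, (h z).re ≤ M := by
    intro z hz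
    have h1 := hb z hz
    have h2 := congrArg norm (hconst z hz)
    rw [norm_mul, Complex.norm_exp] at h2
    simp only [neg_re] at h2
    rw [Real.exp_neg] at h2
    have hgp : 0 < ‖g z‖ := norm_pos_iff.mpr (h0 z hz)
    have hep := Real.exp_pos (h z).re
    rw [← h2] at h1
    have h3 : Real.exp (h z).re ≤ Real.exp M := by
      have : ‖g z‖ * Real.exp (h z).re ≤ ‖g z‖ * Real.exp M := by
        calc ‖g z‖ * Real.exp (h z).re ≤ (Real.exp M * (‖g z‖ * (Real.exp (h z).re)⁻¹)) * Real.exp (h z).re := by gcongr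
          _ = _ := by field_simp
      exact le_of_mul_le_mul_left this hgp
    exact Real.exp_le_exp.mp h3
  have hmem : ∀ w : ℂ, w ∈ Metric.ball (0:ℂ) R → s₀ + w ∈ Metric.ball s₀ R := by
    intro w hw; simpa using hw
  have hbc : ∀ z : ℂ, ‖z - s₀‖ ≤ 3 * R / 4 → ‖h z‖ ≤ 6 * M := by
    intro z hz
    have hz' : z - s₀ ∈ Metric.ball (0:ℂ) R := by simp; linarith
    have := Complex.borelCaratheodory_zero (f := fun w => h (s₀ + w)) (R := R) (z := z - s₀) hM
      (fun w hw => by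
        apply DifferentiableAt.differentiableWithinAt
        exact (hh _ (hmem w hw)).differentiableAt.comp w (by fun_prop))
      (fun w hw => hre _ (hmem w hw)) hR hz' (by simpa using hh0)
    simp only [add_sub_cancel] at this
    refine this.trans ?_
    rw [div_le_iff₀ (by linarith)]
    nlinarith
  have hderiv : Set.EqOn (logDeriv g) (deriv h) (Metric.ball s₀ R) := by
    intro w hw
    rw [(hh w hw).deriv, logDeriv_apply]
  have hzb : z ∈ Metric.ball s₀ R := by simp [dist_eq_norm]; linarith
  have hR4 : 0 < R / 4 := by linarith
  have hsub : Metric.closedBall z (R/4) ⊆ Metric.ball s₀ R := by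
    intro w hw
    simp only [Metric.mem_closedBall, Metric.mem_ball, dist_eq_norm] at *
    have := norm_add_le (w - z) (z - s₀)
    rw [sub_add_sub_cancel] at this
    linarith
  have hdc : DiffContOnCl ℂ h (Metric.ball z (R/4)) := by
    apply DifferentiableOn.diffContOnCl
    rw [closure_ball _ hR4.ne']
    intro w hw
    exact (hh w (hsub hw)).differentiableAt.differentiableWithinAt
  have hsph : ∀ w ∈ Metric.sphere z (R/4), ‖h w‖ ≤ 6 * M := by
    intro w hw
    apply hbc
    simp only [Metric.mem_sphere, dist_eq_norm] at hw
    have := norm_add_le (w - z) (z - s₀)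
    rw [sub_add_sub_cancel] at this
    linarith
  constructor
  · rw [hderiv hzb]
    have := Complex.norm_deriv_le_of_forall_mem_sphere_norm_le hR4 hdc hsph
    refine this.trans (le_of_eq ?_)
    field_simp; ring
  · have e : deriv (logDeriv g) z = deriv (deriv h) z := by
      apply Filter.EventuallyEq.deriv_eq
      exact hderiv.eventuallyEq_of_mem (Metric.isOpen_ball.mem_nhds hzb)
    rw [e]
    have := Complex.norm_iteratedDeriv_le_of_forall_mem_sphere_norm_le 2 hR4 hdc hsph
    rw [show iteratedDeriv 2 h = deriv (deriv h) by rw [iteratedDeriv_succ, iteratedDeriv_one]] at this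
    refine this.trans (le_of_eq ?_)
    simp only [Nat.factorial]
    field_simp; ring

lemma landau_lemma {f : ℂ → ℂ} {s₀ : ℂ} {R M d : ℝ} (hR : 0 < R) (hM : 0 < M) (hd : 0 < d)
    (hf : DifferentiableOn ℂ f (Metric.ball s₀ R)) (h0 : f s₀ ≠ 0)
    (hb : ∀ z ∈ Metric.ball s₀ R, ‖f z‖ ≤ Real.exp M * ‖f s₀‖) (z : ℂ) (hz : ‖z - s₀‖ ≤ R / 8)
    (hzd : ∀ ρ : ℂ, ‖ρ - s₀‖ ≤ R / 4 → f ρ = 0 → d ≤ ‖z - ρ‖) :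
    ‖logDeriv f z‖ ≤ 2 * M / d + 96 * M / R := by
  classical
  let P : ℕ → Prop := fun n => ∃ (ρ : ℕ → ℂ) (g : ℂ → ℂ), (∀ i, i < n → ‖ρ i - s₀‖ ≤ R / 4) ∧
    DifferentiableOn ℂ g (Metric.ball s₀ R) ∧
    ∀ w ∈ Metric.ball s₀ R, f w = (∏ i ∈ range n, (w - ρ i)) * g w
  have hs0 : s₀ ∈ Metric.ball s₀ R := Metric.mem_ball_self hR
  have hf0 : 0 < ‖f s₀‖ := norm_pos_iff.mpr h0
  -- the key bound
  have key : ∀ (n : ℕ) (ρ : ℕ → ℂ) (g : ℂ → ℂ), (∀ i, i < n → ‖ρ i - s₀‖ ≤ R / 4) →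
    DifferentiableOn ℂ g (Metric.ball s₀ R) →
    (∀ w ∈ Metric.ball s₀ R, f w = (∏ i ∈ range n, (w - ρ i)) * g w) →
    ∀ w ∈ Metric.ball s₀ (7 * R / 8), ‖g w‖ * (5/2 : ℝ) ^ n ≤ Real.exp M * ‖g s₀‖ := by
    intro n ρ g hρ hg hfg w hw
    have hclos : Metric.closedBall s₀ (7 * R / 8) ⊆ Metric.ball s₀ R :=
      Metric.closedBall_subset_ball (by linarith)
    have hr : 0 < 7 * R / 8 := by linarith
    have h1 : ‖g w‖ ≤ Real.exp M * ‖f s₀‖ / (5 * R / 8) ^ n := by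
      apply Complex.norm_le_of_forall_mem_frontier_norm_le Metric.isBounded_ball
        (U := Metric.ball s₀ (7 * R / 8)) _ _ (subset_closure hw)
      · apply DifferentiableOn.diffContOnCl
        rw [closure_ball _ hr.ne']
        exact hg.mono hclos
      · intro v hv
        rw [frontier_ball _ hr.ne'] at hv
        have hvb : v ∈ Metric.ball s₀ R := hclos (Metric.sphere_subset_closedBall hv)
        rw [le_div_iff₀ (by positivity)]
        have h2 := hb v hvb
        rw [hfg v hvb, norm_mul, mul_comm] at h2
        refine le_trans ?_ h2
        gcongr
        rw [norm_prod]
        have : (5 * R / 8) ^ n = ∏ i ∈ range n, (5 * R / 8) := by rw [Finset.prod_const, Finset.card_range]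
        rw [this]
        apply Finset.prod_le_prod
        · intro i _; positivity
        · intro i hi
          have h3 := hρ i (Finset.mem_range.mp hi)
          have h4 : ‖v - s₀‖ = 7 * R / 8 := by simpa [dist_eq_norm] using hv
          have h5 := norm_add_le (v - ρ i) (ρ i - s₀)
          rw [sub_add_sub_cancel] at h5
          linarith
    have h2 : ‖f s₀‖ ≤ (R/4) ^ n * ‖g s₀‖ := by
      rw [hfg s₀ hs0, norm_mul, norm_prod]
      gcongr
      have : (R/4) ^ n = ∏ i ∈ range n, (R/4) := by rw [Finset.prod_const, Finset.card_range]
      rw [this]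
      apply Finset.prod_le_prod
      · intro i _; positivity
      · intro i hi
        rw [norm_sub_rev]
        exact hρ i (Finset.mem_range.mp hi)
    calc ‖g w‖ * (5/2 : ℝ) ^ n ≤ (Real.exp M * ((R/4) ^ n * ‖g s₀‖) / (5 * R / 8) ^ n) * (5/2 : ℝ) ^ n := by
          gcongr
          exact h1.trans (by gcongr)
      _ = Real.exp M * ‖g s₀‖ * ((R/4) ^ n * (5/2 : ℝ) ^ n / (5 * R / 8) ^ n) := by ring
      _ = Real.exp M * ‖g s₀‖ := by
          rw [← mul_pow, ← div_pow]
          have : R / 4 * (5/2) / (5 * R / 8) = 1 := by field_simp; norm_num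
          rw [this]; simp
  have hbound : ∀ n, P n → (n : ℝ) ≤ 2 * M := by
    rintro n ⟨ρ, g, hρ, hg, hfg⟩
    have h1 := key n ρ g hρ hg hfg s₀ (Metric.mem_ball_self (by linarith))
    have hg0 : 0 < ‖g s₀‖ := by
      apply norm_pos_iff.mpr
      intro h; apply h0; rw [hfg s₀ hs0, h, mul_zero]
    have h2 : (5/2 : ℝ) ^ n ≤ Real.exp M := by
      rw [mul_comm] at h1
      exact le_of_mul_le_mul_right h1 hg0
    have h3 : Real.exp (n * (1/2)) ≤ (5/2 : ℝ) ^ n := by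
      rw [Real.exp_nat_mul]
      gcongr
      have h4 := Real.exp_one_lt_d9
      have h5 : Real.exp (1/2) ^ 2 = Real.exp 1 := by rw [← Real.exp_nat_mul]; norm_num
      have := Real.exp_pos (1/2 : ℝ)
      nlinarith
    have := Real.exp_le_exp.mp (h3.trans h2)
    linarith
  have hP0 : P 0 := ⟨fun _ => 0, f, by simp, hf, by simp⟩
  obtain ⟨N, hN⟩ := exists_nat_ge (2 * M)
  set n := Nat.findGreatest P N with hn
  have hPn : P n := Nat.findGreatest_spec (Nat.zero_le N) hP0
  have hmax : ¬ P (n + 1) := by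
    intro h
    have h1 : n + 1 ≤ N := by
      have := (hbound _ h).trans hN
      exact_mod_cast this
    have := Nat.le_findGreatest h1 h
    omega
  have hnM := hbound n hPn
  obtain ⟨ρ, g, hρ, hg, hfg⟩ := hPn
  have hgne : ∀ w, ‖w - s₀‖ ≤ R / 4 → g w ≠ 0 := by
    intro w hw hgw
    apply hmax
    have hwb : w ∈ Metric.ball s₀ R := by simp [dist_eq_norm]; linarith
    refine ⟨fun i => if i = n then w else ρ i, dslope g w, ?_, ?_, ?_⟩
    · intro i hi
      by_cases h : i = n
      · simpa [h] using hw
      · simp only [h, if_false]; exact hρ i (by omega)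
    · exact (Complex.differentiableOn_dslope (Metric.isOpen_ball.mem_nhds hwb)).mpr hg
    · intro v hv
      rw [hfg v hv, Finset.prod_range_succ, mul_assoc]
      simp only [if_true]
      congr 1
      · apply Finset.prod_congr rfl
        intro i hi
        rw [if_neg (by have := Finset.mem_range.mp hi; omega)]
      · have := sub_smul_dslope g w v
        rw [hgw, sub_zero, smul_eq_mul] at this
        exact this.symm
  have hball : Metric.ball s₀ (R/4) ⊆ Metric.ball s₀ R := Metric.ball_subset_ball (by linarith)
  have hlog := logDeriv_bound (g := g) (s₀ := s₀) (R := R/4) (M := M) (by linarith) hM (hg.mono hball)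
    (fun w hw => hgne w (by simp [dist_eq_norm] at hw; linarith))
    (fun w hw => by
      have := key n ρ g hρ hg hfg w (Metric.ball_subset_ball (by linarith) hw)
      refine le_trans ?_ this
      exact le_mul_of_one_le_right (norm_nonneg _) (one_le_pow₀ (by norm_num))) z (by linarith)
  have hzb : z ∈ Metric.ball s₀ R := by simp [dist_eq_norm]; linarith
  have hρ0 : ∀ i ∈ range n, f (ρ i) = 0 := by
    intro i hi
    have h1 := hρ i (Finset.mem_range.mp hi)
    rw [hfg (ρ i) (by simp [dist_eq_norm]; linarith), Finset.prod_eq_zero hi (by simp), zero_mul]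
  have hdz : ∀ i ∈ range n, d ≤ ‖z - ρ i‖ := fun i hi =>
    hzd _ (hρ i (Finset.mem_range.mp hi)) (hρ0 i hi)
  have hne : ∀ i ∈ range n, z - ρ i ≠ 0 := fun i hi => by
    apply norm_pos_iff.mp; linarith [hdz i hi]
  have e1 : logDeriv f z = logDeriv (fun w => (∏ i ∈ range n, (w - ρ i)) * g w) z := by
    rw [logDeriv_apply, logDeriv_apply]
    rw [Filter.EventuallyEq.deriv_eq (Filter.eventuallyEq_of_mem (Metric.isOpen_ball.mem_nhds hzb) hfg), hfg z hzb]
  rw [e1, logDeriv_mul z (Finset.prod_ne_zero_iff.mpr hne) (hgne z (by linarith)) (by fun_prop)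
    (hg.differentiableAt (Metric.isOpen_ball.mem_nhds hzb)),
    logDeriv_prod (f := fun i w => w - ρ i) hne (fun i _ => by fun_prop)]
  refine (norm_add_le _ _).trans ?_
  have h2 : ‖∑ i ∈ range n, logDeriv (fun w => w - ρ i) z‖ ≤ 2 * M / d := by
    calc _ ≤ ∑ i ∈ range n, 1 / d := by
          refine norm_sum_le_of_le _ fun i hi => ?_
          rw [logDeriv_apply]
          simp only [deriv_sub_const_fun, deriv_id'', norm_div, norm_one]
          gcongr
          exact hdz i hi
      _ = n * (1 / d) := by simp
      _ ≤ (2 * M) * (1 / d) := by gcongr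
      _ = _ := by ring
  have h3 : 24 * M / (R/4) = 96 * M / R := by field_simp; ring
  rw [h3] at hlog
  linarith [hlog.1]

lemma cos_half_ne_zero {w : ℂ} (h : w.im ≠ 0) : cos (Real.pi * w / 2) ≠ 0 := by
  intro h0
  obtain ⟨k, hk⟩ := Complex.cos_eq_zero_iff.mp h0
  have := congrArg im hk
  simp at this
  have h2 : ((2 * (k : ℂ) + 1) * Real.pi / 2).im = 0 := by
    rw [show ((2 * (k : ℂ) + 1) * Real.pi / 2) = (((2 * k + 1) * Real.pi / 2 : ℝ) : ℂ) by push_cast; ring]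
    exact ofReal_im _
  rw [← hk] at h2
  simp at h2
  exact h h2

lemma Gamma_ne_zero_im {w : ℂ} (h : w.im ≠ 0) : Gamma w ≠ 0 := by
  apply Complex.Gamma_ne_zero
  intro m hm; rw [hm] at h; simp at h

lemma two_pi_ne : (2 * Real.pi : ℂ) ≠ 0 := by
  have : (Real.pi : ℂ) ≠ 0 := by exact_mod_cast Real.pi_ne_zero
  simpa using this

lemma feK_ne_zero {w : ℂ} (h : w.im ≠ 0) : feK w ≠ 0 := by
  unfold feK
  refine mul_ne_zero (mul_ne_zero (mul_ne_zero two_ne_zero ?_) (Gamma_ne_zero_im h)) (cos_half_ne_zero h)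
  rw [Ne, Complex.cpow_eq_zero_iff]
  simp [two_pi_ne]

lemma feK_mul {w : ℂ} (h : w.im ≠ 0) : feK w * feK (1 - w) = 1 := by
  have h1 := Complex.Gamma_mul_Gamma_one_sub w
  have h2 := sin_pi_mul_ne_zero_im h
  rw [eq_div_iff h2] at h1
  have h3 : sin (Real.pi * w) = 2 * sin (Real.pi * w / 2) * cos (Real.pi * w / 2) := by
    rw [← Complex.sin_two_mul]; ring_nf
  have h4 : cos (Real.pi * (1 - w) / 2) = sin (Real.pi * w / 2) := by
    rw [← Complex.cos_pi_div_two_sub]; ring_nf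
  have h5 : (2 * Real.pi : ℂ) ^ (-w) * (2 * Real.pi : ℂ) ^ (-(1 - w)) = ((2 * Real.pi : ℂ))⁻¹ := by
    rw [← Complex.cpow_add _ _ two_pi_ne, ← Complex.cpow_neg_one]; ring_nf
  have hpi : (Real.pi : ℂ) ≠ 0 := by exact_mod_cast Real.pi_ne_zero
  unfold feK
  rw [h4]
  rw [h3] at h1
  calc _ = 4 * ((2 * Real.pi : ℂ) ^ (-w) * (2 * Real.pi : ℂ) ^ (-(1 - w))) * ((Gamma w * Gamma (1 - w) * (2 * sin (Real.pi * w / 2) * cos (Real.pi * w / 2))) / 2) := by ring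
    _ = 1 := by rw [h5, h1]; field_simp; norm_num

lemma zeta_zero_strip {ρ : ℂ} (h : riemannZeta ρ = 0) (him : ρ.im ≠ 0) : IsNontrivialZero ρ := by
  refine ⟨h, ?_, ?_⟩
  · by_contra hre
    push Not at hre
    have hw : (1 - ρ).im ≠ 0 := by simpa using him
    have h1 := zeta_fe hw
    rw [sub_sub_cancel, h] at h1
    have h2 : riemannZeta (1 - ρ) ≠ 0 := by
      apply riemannZeta_ne_zero_of_one_le_re
      simp; linarith
    exact mul_ne_zero (feK_ne_zero hw) h2 h1.symm
  · by_contra hre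
    push Not at hre
    exact riemannZeta_ne_zero_of_one_le_re hre h

lemma zeta_two_lower (t : ℝ) : 1/3 ≤ ‖riemannZeta (2 + t * I)‖ := by
  have hs : HasSum (fun n : ℕ => 1 / ((n:ℝ) + 1 + 1) ^ 2) (Real.pi ^ 2 / 6 - 1) := by
    have := hasSum_zeta_two
    rw [← hasSum_nat_add_iff' 2] at this
    simp [Finset.sum_range_succ] at this
    have e : (fun n:ℕ => 1/((n:ℝ)+1+1)^2) = fun n : ℕ => (((n:ℝ)+2)^2)⁻¹ := by
      ext n; rw [one_div]; ring_nf
    rw [e]; exact this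
  have hre : 1 < (2 + t * I : ℂ).re := by simp
  have hsum : Summable (fun n : ℕ => 1 / ((n:ℂ) + 1) ^ (2 + t * I : ℂ)) := by
    have := (Complex.summable_one_div_nat_cpow (p := 2 + t * I)).mpr hre
    exact_mod_cast (summable_nat_add_iff 1).mpr this
  have e : riemannZeta (2 + t * I) = 1 + ∑' n : ℕ, 1 / ((n:ℂ) + 1 + 1) ^ (2 + t * I : ℂ) := by
    rw [zeta_eq_tsum_one_div_nat_add_one_cpow hre, hsum.tsum_eq_zero_add]
    simp
  have hb : ‖∑' n : ℕ, 1 / ((n:ℂ) + 1 + 1) ^ (2 + t * I : ℂ)‖ ≤ Real.pi ^ 2 / 6 - 1 := by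
    apply tsum_of_norm_bounded hs
    intro n
    rw [norm_div, norm_one]
    have : ((n : ℂ) + 1 + 1) = ((n + 1 + 1 : ℝ) : ℂ) := by push_cast; rfl
    rw [this, norm_cpow_eq_rpow_re_of_pos (by positivity)]
    simp
  have hpi : Real.pi ^ 2 < 10 := by
    have := Real.pi_lt_d2; have := Real.pi_pos; nlinarith
  rw [e]
  have := norm_sub_le (1 + ∑' n : ℕ, 1 / ((n:ℂ) + 1 + 1) ^ (2 + t * I : ℂ)) (∑' n : ℕ, 1 / ((n:ℂ) + 1 + 1) ^ (2 + t * I : ℂ))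
  rw [add_sub_cancel_right, norm_one] at this
  linarith

lemma zeta_logDeriv_top (δ : ℝ) (hδ : 0 < δ) : ∃ C > 0, ∃ T₁ : ℝ, ∀ T ≥ T₁, AdmissibleHeight δ T →
    ∀ σ : ℝ, -1/8 ≤ σ → σ ≤ 3 → riemannZeta (σ + T * I) ≠ 0 ∧
      ‖logDeriv riemannZeta (σ + T * I)‖ ≤ C * Real.log T ^ 2 := by
  obtain ⟨A, hA, hz⟩ := zeta_poly
  refine ⟨2 * 32 / δ + 96 * 32 / 24, by positivity, 3 * A * 2 ^ 31 + 30, ?_⟩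
  intro T hT hadm σ hσ1 hσ2
  have hA' : 0 < 3 * A * 2 ^ 31 := by positivity
  have hT30 : 30 ≤ T := by linarith
  have hT0 : 0 < T := by linarith
  have hlog1 : 1 ≤ Real.log T := by
    rw [Real.le_log_iff_exp_le hT0]; linarith [Real.exp_one_lt_d9]
  have hd : 0 < δ / Real.log T := by positivity
  constructor
  · intro h0
    have := hadm _ (zeta_zero_strip h0 (by simp; linarith))
    simp at this
    linarith
  · have hM : 0 < 32 * Real.log T := by positivity
    have hexp : Real.exp (32 * Real.log T) = T ^ 32 := by
      rw [show (32:ℝ) * Real.log T = ((32:ℕ):ℝ) * Real.log T by norm_num, Real.exp_nat_mul, Real.exp_log hT0]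
    have hin : ∀ z ∈ Metric.ball (2 + T * I : ℂ) 24, -30 ≤ z.re ∧ T - 24 ≤ z.im ∧ z.im ≤ T + 24 := by
      intro z hz
      rw [Metric.mem_ball, dist_eq_norm] at hz
      have h1 := Complex.abs_re_le_norm (z - (2 + T * I))
      have h2 := Complex.abs_im_le_norm (z - (2 + T * I))
      simp at h1 h2
      rw [abs_le] at h1 h2
      refine ⟨?_, ?_, ?_⟩ <;> linarith [h1.1, h2.1, h2.2]
    have := landau_lemma (f := riemannZeta) (s₀ := 2 + T * I) (R := 24) (M := 32 * Real.log T)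
      (d := δ / Real.log T) (by norm_num) hM hd ?_ ?_ ?_ (σ + T * I) ?_ ?_
    · refine this.trans ?_
      have e : 2 * (32 * Real.log T) / (δ / Real.log T) = 2 * 32 / δ * Real.log T ^ 2 := by
        field_simp
      rw [e]
      nlinarith
    · intro z hz
      apply DifferentiableAt.differentiableWithinAt
      apply differentiableAt_riemannZeta
      rintro rfl
      have := (hin _ hz).2.1
      simp at this
      linarith
    · intro h
      have := zeta_two_lower T
      rw [h] at this
      simp at this
      linarith
    · intro z hzb
      obtain ⟨h1, h2, h3⟩ := hin z hzb
      have himp : 0 < z.im := by linarith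
      have h4 := hz z h1 (by rw [abs_of_pos himp]; linarith)
      rw [abs_of_pos himp] at h4
      have h5 := zeta_two_lower T
      calc ‖riemannZeta z‖ ≤ A * (1 + z.im) ^ 31 := h4
        _ ≤ A * (2 * T) ^ 31 := by gcongr; linarith
        _ = (3 * A * 2 ^ 31) * T ^ 31 * (1/3) := by ring
        _ ≤ T * T ^ 31 * ‖riemannZeta (2 + T * I)‖ := by gcongr; linarith
        _ = _ := by rw [hexp]; ring
    · rw [show (σ + T * I - (2 + T * I) : ℂ) = ((σ - 2 : ℝ) : ℂ) by push_cast; ring, Complex.norm_real, Real.norm_eq_abs, abs_le]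
      constructor <;> linarith
    · intro ρ h1 h2
      have := Complex.abs_im_le_norm (ρ - (2 + T * I))
      simp at this
      rw [abs_le] at this
      have h3 := hadm ρ (zeta_zero_strip h2 (by linarith [this.1]))
      have h4 := Complex.abs_im_le_norm (σ + T * I - ρ)
      simp at h4
      linarith

lemma feK_left_bound : ∃ C > 0, ∀ w : ℂ, w.re ≤ 3/2 → 1 ≤ |w.im| →
    ‖feK w‖ ≤ C * (2 * Real.pi) ^ (-w.re) * |w.im| ^ (w.re - 1/2) := by
  obtain ⟨C, hC, h⟩ := Gamma_left
  refine ⟨2 * C, by positivity, fun w h1 h2 => ?_⟩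
  have g := h w h1 h2
  have c := norm_cos_le (Real.pi * w / 2)
  have h5 : |((Real.pi : ℂ) * w / 2).im| = Real.pi * |w.im| / 2 := by
    simp [abs_mul, abs_div, abs_of_pos Real.pi_pos]
  rw [h5] at c
  rw [feK, norm_mul, norm_mul, norm_mul, Complex.norm_ofNat]
  have p : ‖(2 * Real.pi : ℂ) ^ (-w)‖ = (2 * Real.pi) ^ (-w.re) := by
    have : (2 * Real.pi : ℂ) = ((2 * Real.pi : ℝ) : ℂ) := by push_cast; rfl
    rw [this, norm_cpow_eq_rpow_re_of_pos (by positivity)]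
    simp
  rw [p]
  calc _ ≤ 2 * (2 * Real.pi) ^ (-w.re) * (C * |w.im| ^ (w.re - 1 / 2) * Real.exp (-Real.pi * |w.im| / 2)) * Real.exp (Real.pi * |w.im| / 2) := by gcongr
    _ = 2 * C * (2 * Real.pi) ^ (-w.re) * |w.im| ^ (w.re - 1 / 2) * (Real.exp (-Real.pi * |w.im| / 2) * Real.exp (Real.pi * |w.im| / 2)) := by ring
    _ = _ := by rw [← Real.exp_add]; ring_nf; simp

lemma differentiableAt_feK {w : ℂ} (h : w.im ≠ 0) : DifferentiableAt ℂ feK w := by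
  unfold feK
  have hG : DifferentiableAt ℂ Gamma w := by
    apply Complex.differentiableAt_Gamma
    intro m hm; rw [hm] at h; simp at h
  have hp : DifferentiableAt ℂ (fun w : ℂ => (2 * Real.pi : ℂ) ^ (-w)) w := by
    apply DifferentiableAt.const_cpow (by fun_prop)
    left; exact two_pi_ne
  fun_prop

lemma feK_logDeriv : ∃ C > 0, ∀ w : ℂ, 1/2 ≤ w.re → w.re ≤ 2 → 2 ≤ |w.im| →
    ‖logDeriv feK w‖ ≤ C * Real.log |w.im| ∧
    ‖deriv (logDeriv feK) w‖ ≤ C * (Real.log |w.im| / |w.im|) := by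
  obtain ⟨C1, hC1, h1⟩ := feK_bound
  obtain ⟨C2, hC2, h2⟩ := feK_left_bound
  set C3 := (C1 + C2) * (C2 * 7 + 1) with hC3
  have hC3p : 0 < C3 := by positivity
  refine ⟨768 * (C3 + 8), by positivity, ?_⟩
  intro w₀ hr1 hr2 ht
  set t := |w₀.im| with htdef
  have hlogt : 1/2 ≤ Real.log t := by
    have : Real.log 2 ≤ Real.log t := Real.log_le_log (by norm_num) ht
    linarith [Real.log_two_gt_d9]
  have hx1 : 1 ≤ t * Real.log t := by nlinarith
  have hpi2 : 2 * Real.pi ≤ 7 := by linarith [Real.pi_lt_d2]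
  have hpi1 : 1 ≤ 2 * Real.pi := by linarith [Real.pi_gt_three]
  have h7t : (1:ℝ) ≤ 7 * t := by linarith
  have hB : (7 * t) ^ (2 + t / 2) ≤ Real.exp (8 * (t * Real.log t)) := by
    have a1 : 7 * t ≤ t ^ 4 := by
      have : 2 ^ 3 ≤ t ^ 3 := by gcongr
      nlinarith
    calc (7 * t) ^ (2 + t/2) ≤ (7 * t) ^ (2 * t) := by
          apply Real.rpow_le_rpow_of_exponent_le h7t; linarith
      _ ≤ (t ^ 4) ^ (2 * t) := by gcongr
      _ = Real.exp (8 * (t * Real.log t)) := by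
          rw [Real.rpow_def_of_pos (by positivity), Real.log_pow]
          congr 1; push_cast; ring
  have hM : 0 < (C3 + 8) * (t * Real.log t) := by positivity
  have hexp : C3 * (7 * t) ^ (2 + t/2) ≤ Real.exp ((C3 + 8) * (t * Real.log t)) := by
    rw [add_mul, Real.exp_add]
    gcongr
    calc C3 ≤ Real.exp C3 := by linarith [Real.add_one_le_exp C3]
      _ ≤ _ := by apply Real.exp_le_exp.mpr; nlinarith
  have hin : ∀ z ∈ Metric.ball w₀ (t/2), t/2 ≤ |z.im| ∧ |z.im| ≤ 3/2 * t ∧ |z.re| ≤ 2 + t/2 := by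
    intro z hz
    rw [Metric.mem_ball, dist_eq_norm] at hz
    have a1 := Complex.abs_re_le_norm (z - w₀)
    have a2 := Complex.abs_im_le_norm (z - w₀)
    simp only [sub_re, sub_im] at a1 a2
    have a3 := abs_sub_abs_le_abs_sub w₀.im z.im
    have a4 := abs_sub_abs_le_abs_sub z.im w₀.im
    rw [abs_sub_comm] at a3
    have a1' := abs_le.mp a1
    rw [← htdef] at a3 a4
    refine ⟨by linarith, by linarith, abs_le.mpr ⟨by linarith [a1'.1], by linarith [a1'.2]⟩⟩
  have him0 : ∀ z ∈ Metric.ball w₀ (t/2), z.im ≠ 0 := by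
    intro z hz h
    have := (hin z hz).1
    rw [h, abs_zero] at this; linarith
  have hw₀ : w₀ ∈ Metric.ball w₀ (t/2) := Metric.mem_ball_self (by linarith)
  have hlow : 1 ≤ (C2 * 7 + 1) * ‖feK w₀‖ := by
    have e := feK_mul (him0 _ hw₀)
    have e' := congrArg norm e
    rw [norm_mul, norm_one] at e'
    have b := h2 (1 - w₀) (by simp; linarith) (by simp; linarith)
    simp only [sub_re, one_re, sub_im, one_im, zero_sub, abs_neg] at b
    have b1 : (2 * Real.pi) ^ (-(1 - w₀.re)) ≤ 7 := by
      calc (2 * Real.pi) ^ (-(1 - w₀.re)) ≤ (2 * Real.pi) ^ (1:ℝ) := by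
            apply Real.rpow_le_rpow_of_exponent_le hpi1; linarith
        _ ≤ 7 := by rw [Real.rpow_one]; exact hpi2
    have b2 : |w₀.im| ^ (1 - w₀.re - 1/2) ≤ 1 := by
      apply Real.rpow_le_one_of_one_le_of_nonpos <;> linarith
    have b3 : ‖feK (1 - w₀)‖ ≤ C2 * 7 + 1 := by
      refine b.trans ?_
      calc _ ≤ C2 * 7 * 1 := by gcongr
        _ ≤ _ := by linarith
    calc 1 = ‖feK w₀‖ * ‖feK (1-w₀)‖ := e'.symm
      _ ≤ ‖feK w₀‖*(C2*7+1) := by gcongr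
      _ = _ := mul_comm _ _
  have main := logDeriv_bound (g := feK) (s₀ := w₀) (R := t/2) (M := (C3 + 8) * (t * Real.log t))
    (by linarith) hM (fun z hz => (differentiableAt_feK (him0 z hz)).differentiableWithinAt)
    (fun z hz => feK_ne_zero (him0 z hz)) ?_ w₀ (by simp; linarith)
  · have ht0 : 0 < t := by linarith
    constructor
    · refine main.1.trans ?_
      have : 24 * ((C3 + 8) * (t * Real.log t)) / (t / 2) = 48 * (C3 + 8) * Real.log t := by
        field_simp; ring
      rw [this]
      gcongr; norm_num
    · refine main.2.trans (le_of_eq ?_)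
      field_simp; ring
  · intro z hz
    obtain ⟨a1, a2, a3⟩ := hin z hz
    have a4 := abs_le.mp a3
    have hub : ‖feK z‖ ≤ (C1 + C2) * (7 * t) ^ (2 + t/2) := by
      rcases le_total (1/2) z.re with hz1 | hz1
      · have b := h1 z hz1 (by linarith)
        have hn : ‖z‖ ≤ 7 * t := by
          have := Complex.norm_le_abs_re_add_abs_im z; linarith
        refine b.trans ?_
        calc C1 * ‖z‖ ^ (z.re - 1/2) ≤ C1 * (7 * t) ^ (z.re - 1/2) := by
              gcongr
          _ ≤ C1 * (7 * t) ^ (2 + t/2) := by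
              gcongr
              linarith
          _ ≤ _ := by gcongr; linarith
      · have b := h2 z (by linarith) (by linarith)
        refine b.trans ?_
        have b2 : |z.im| ^ (z.re - 1/2) ≤ 1 := by
          apply Real.rpow_le_one_of_one_le_of_nonpos <;> linarith
        calc _ ≤ C2 * (7 * t) ^ (2 + t/2) * 1 := by
              gcongr
              calc (2 * Real.pi) ^ (-z.re) ≤ (2 * Real.pi) ^ (2 + t/2) := by
                    apply Real.rpow_le_rpow_of_exponent_le hpi1; linarith
                _ ≤ _ := Real.rpow_le_rpow (by positivity) (by linarith : 2*Real.pi ≤ 7*t) (by linarith)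
          _ ≤ _ := by rw [mul_one]; gcongr; linarith
    calc ‖feK z‖ ≤ (C1 + C2) * (7 * t) ^ (2 + t/2) * 1 := by rw [mul_one]; exact hub
      _ ≤ (C1 + C2) * (7 * t) ^ (2 + t/2) * ((C2 * 7 + 1) * ‖feK w₀‖) := by gcongr
      _ = (C3 * (7 * t) ^ (2 + t/2)) * ‖feK w₀‖ := by rw [hC3]; ring
      _ ≤ _ := by gcongr

/-- Boundary integral over a rectangle. -/
noncomputable def rectInt (f : ℂ → ℂ) (x0 x1 y0 y1 : ℝ) : ℂ :=
  (∫ x in x0..x1, f (x + y0 * I)) - (∫ x in x0..x1, f (x + y1 * I)) +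
    I * (∫ y in y0..y1, f (x1 + y * I)) - I * ∫ y in y0..y1, f (x0 + y * I)

lemma rectInt_eq_zero {f : ℂ → ℂ} {x0 x1 y0 y1 : ℝ} (hx : x0 ≤ x1) (hy : y0 ≤ y1)
    (h : ∀ z : ℂ, x0 ≤ z.re → z.re ≤ x1 → y0 ≤ z.im → z.im ≤ y1 → DifferentiableAt ℂ f z) :
    rectInt f x0 x1 y0 y1 = 0 := by
  have := Complex.integral_boundary_rect_eq_zero_of_differentiableOn f (x0 + y0 * I) (x1 + y1 * I) ?_
  · simpa [rectInt] using this
  · intro z hz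
    simp [mem_reProdIm, Set.uIcc_of_le hx, Set.uIcc_of_le hy] at hz
    exact (h z hz.1.1 hz.1.2 hz.2.1 hz.2.2).differentiableWithinAt

/-- continuity of `f` on the boundary of the rectangle -/
def BdCont (f : ℂ → ℂ) (x0 x1 y0 y1 : ℝ) : Prop :=
  ∀ z : ℂ, x0 ≤ z.re → z.re ≤ x1 → y0 ≤ z.im → z.im ≤ y1 →
    (z.re = x0 ∨ z.re = x1 ∨ z.im = y0 ∨ z.im = y1) → ContinuousAt f z

lemma intervalIntegrable_horiz {f : ℂ → ℂ} {x0 x1 y : ℝ} (hx : x0 ≤ x1)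
    (h : ∀ x : ℝ, x0 ≤ x → x ≤ x1 → ContinuousAt f (x + y * I)) :
    IntervalIntegrable (fun x : ℝ => f (x + y * I)) MeasureTheory.volume x0 x1 := by
  apply ContinuousOn.intervalIntegrable
  rw [Set.uIcc_of_le hx]
  intro x hx
  apply ContinuousAt.continuousWithinAt
  exact ContinuousAt.comp (f := fun x : ℝ => (x + y * I : ℂ)) (h x hx.1 hx.2) (by fun_prop)

lemma intervalIntegrable_vert {f : ℂ → ℂ} {x y0 y1 : ℝ} (hy : y0 ≤ y1)
    (h : ∀ y : ℝ, y0 ≤ y → y ≤ y1 → ContinuousAt f (x + y * I)) :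
    IntervalIntegrable (fun y : ℝ => f (x + y * I)) MeasureTheory.volume y0 y1 := by
  apply ContinuousOn.intervalIntegrable
  rw [Set.uIcc_of_le hy]
  intro y hy
  apply ContinuousAt.continuousWithinAt
  exact ContinuousAt.comp (f := fun y : ℝ => (x + y * I : ℂ)) (h y hy.1 hy.2) (by fun_prop)

lemma BdCont.integrable {f : ℂ → ℂ} {x0 x1 y0 y1 : ℝ} (hx : x0 ≤ x1) (hy : y0 ≤ y1) (h : BdCont f x0 x1 y0 y1) :
    IntervalIntegrable (fun x : ℝ => f (x + y0 * I)) MeasureTheory.volume x0 x1 ∧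
    IntervalIntegrable (fun x : ℝ => f (x + y1 * I)) MeasureTheory.volume x0 x1 ∧
    IntervalIntegrable (fun y : ℝ => f (x1 + y * I)) MeasureTheory.volume y0 y1 ∧
    IntervalIntegrable (fun y : ℝ => f (x0 + y * I)) MeasureTheory.volume y0 y1 := by
  refine ⟨intervalIntegrable_horiz hx ?_, intervalIntegrable_horiz hx ?_, intervalIntegrable_vert hy ?_, intervalIntegrable_vert hy ?_⟩
  all_goals intro u hu1 hu2
  all_goals apply h <;> simp [*]

lemma rectInt_add {f g : ℂ → ℂ} {x0 x1 y0 y1 : ℝ} (hx : x0 ≤ x1) (hy : y0 ≤ y1)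
    (hf : BdCont f x0 x1 y0 y1) (hg : BdCont g x0 x1 y0 y1) :
    rectInt (fun z => f z + g z) x0 x1 y0 y1 = rectInt f x0 x1 y0 y1 + rectInt g x0 x1 y0 y1 := by
  obtain ⟨f1, f2, f3, f4⟩ := hf.integrable hx hy
  obtain ⟨g1, g2, g3, g4⟩ := hg.integrable hx hy
  unfold rectInt
  rw [intervalIntegral.integral_add f1 g1, intervalIntegral.integral_add f2 g2,
    intervalIntegral.integral_add f3 g3, intervalIntegral.integral_add f4 g4]
  ring

lemma rectInt_const_mul (c : ℂ) (f : ℂ → ℂ) (x0 x1 y0 y1 : ℝ) :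
    rectInt (fun z => c * f z) x0 x1 y0 y1 = c * rectInt f x0 x1 y0 y1 := by
  unfold rectInt
  simp only [intervalIntegral.integral_const_mul]
  ring

lemma bdCont_sum {ι : Type*} (S : Finset ι) (f : ι → ℂ → ℂ) {x0 x1 y0 y1 : ℝ}
    (h : ∀ i ∈ S, BdCont (f i) x0 x1 y0 y1) : BdCont (fun z => ∑ i ∈ S, f i z) x0 x1 y0 y1 := by
  intro z h1 h2 h3 h4 h5
  exact tendsto_finsetSum _ (fun i hi => h i hi z h1 h2 h3 h4 h5)

lemma rectInt_sum {ι : Type*} (S : Finset ι) (f : ι → ℂ → ℂ) {x0 x1 y0 y1 : ℝ} (hx : x0 ≤ x1) (hy : y0 ≤ y1)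
    (h : ∀ i ∈ S, BdCont (f i) x0 x1 y0 y1) :
    rectInt (fun z => ∑ i ∈ S, f i z) x0 x1 y0 y1 = ∑ i ∈ S, rectInt (f i) x0 x1 y0 y1 := by
  classical
  induction S using Finset.induction_on with
  | empty => simp [rectInt]
  | insert a S ha ih =>
    simp only [Finset.sum_insert ha]
    rw [rectInt_add hx hy (h a (by simp)) (bdCont_sum S f (fun i hi => h i (by simp [hi]))), ih (fun i hi => h i (by simp [hi]))]

lemma rectInt_congr {f g : ℂ → ℂ} {x0 x1 y0 y1 : ℝ} (hx : x0 ≤ x1) (hy : y0 ≤ y1)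
    (h : ∀ z : ℂ, x0 ≤ z.re → z.re ≤ x1 → y0 ≤ z.im → z.im ≤ y1 →
    (z.re = x0 ∨ z.re = x1 ∨ z.im = y0 ∨ z.im = y1) → f z = g z) :
    rectInt f x0 x1 y0 y1 = rectInt g x0 x1 y0 y1 := by
  unfold rectInt
  have e1 : (∫ x in x0..x1, f (x + y0 * I)) = ∫ x in x0..x1, g (x + y0 * I) := by
    apply intervalIntegral.integral_congr
    intro u hu; rw [Set.uIcc_of_le hx] at hu; obtain ⟨hu1, hu2⟩ := hu
    apply h <;> simp [*]
  have e2 : (∫ x in x0..x1, f (x + y1 * I)) = ∫ x in x0..x1, g (x + y1 * I) := by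
    apply intervalIntegral.integral_congr
    intro u hu; rw [Set.uIcc_of_le hx] at hu; obtain ⟨hu1, hu2⟩ := hu
    apply h <;> simp [*]
  have e3 : (∫ y in y0..y1, f (x1 + y * I)) = ∫ y in y0..y1, g (x1 + y * I) := by
    apply intervalIntegral.integral_congr
    intro u hu; rw [Set.uIcc_of_le hy] at hu; obtain ⟨hu1, hu2⟩ := hu
    apply h <;> simp [*]
  have e4 : (∫ y in y0..y1, f (x0 + y * I)) = ∫ y in y0..y1, g (x0 + y * I) := by
    apply intervalIntegral.integral_congr
    intro u hu; rw [Set.uIcc_of_le hy] at hu; obtain ⟨hu1, hu2⟩ := hu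
    apply h <;> simp [*]
  rw [e1, e2, e3, e4]

lemma integral_horiz_eq {F f : ℂ → ℂ} {x0 x1 y : ℝ} (hx : x0 ≤ x1)
    (hd : ∀ x : ℝ, x0 ≤ x → x ≤ x1 → HasDerivAt F (f (x + y * I)) (x + y * I))
    (hc : ∀ x : ℝ, x0 ≤ x → x ≤ x1 → ContinuousAt f (x + y * I)) :
    (∫ x in x0..x1, f (x + y * I)) = F (x1 + y * I) - F (x0 + y * I) := by
  have := intervalIntegral.integral_eq_sub_of_hasDerivAt (f := fun x : ℝ => F (x + y * I))
    (f' := fun x : ℝ => f (x + y * I)) (a := x0) (b := x1) ?_ (intervalIntegrable_horiz hx hc)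
  · exact this
  · intro x hx'
    rw [Set.uIcc_of_le hx] at hx'
    have h1 := hd x hx'.1 hx'.2
    have h2 : HasDerivAt (fun x : ℝ => (x + y * I : ℂ)) 1 x := by
      simpa using (Complex.ofRealCLM.hasDerivAt (x := x)).add_const (y * I)
    exact (h1.comp x h2).congr_deriv (mul_one _)

lemma integral_vert_eq {F f : ℂ → ℂ} {x y0 y1 : ℝ} (hy : y0 ≤ y1)
    (hd : ∀ y : ℝ, y0 ≤ y → y ≤ y1 → HasDerivAt F (f (x + y * I)) (x + y * I))
    (hc : ∀ y : ℝ, y0 ≤ y → y ≤ y1 → ContinuousAt f (x + y * I)) :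
    I * (∫ y in y0..y1, f (x + y * I)) = F (x + y1 * I) - F (x + y0 * I) := by
  have := intervalIntegral.integral_eq_sub_of_hasDerivAt (f := fun y : ℝ => F (x + y * I))
    (f' := fun y : ℝ => I * f (x + y * I)) (a := y0) (b := y1) ?_ ((intervalIntegrable_vert hy hc).const_mul I)
  · rw [← this, intervalIntegral.integral_const_mul]
  · intro y hy'
    rw [Set.uIcc_of_le hy] at hy'
    have h1 := hd y hy'.1 hy'.2
    have h2 : HasDerivAt (fun y : ℝ => (x + y * I : ℂ)) I y := by
      simpa using ((Complex.ofRealCLM.hasDerivAt (x := y)).mul_const I).const_add (x : ℂ)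
    exact (h1.comp y h2).congr_deriv (mul_comm _ _)

lemma log_neg_of_im_neg {z : ℂ} (h : z.im < 0) : log (-z) = log z + Real.pi * I := by
  unfold Complex.log
  rw [Complex.arg_neg_eq_arg_add_pi_of_im_neg h, norm_neg]; push_cast; ring

lemma log_neg_of_im_pos {z : ℂ} (h : 0 < z.im) : log (-z) = log z - Real.pi * I := by
  unfold Complex.log
  rw [Complex.arg_neg_eq_arg_sub_pi_of_im_pos h, norm_neg]; push_cast; ring

lemma rectInt_inv {ρ : ℂ} {x0 x1 y0 y1 : ℝ} (h1 : x0 < ρ.re) (h2 : ρ.re < x1) (h3 : y0 < ρ.im) (h4 : ρ.im < y1) :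
    rectInt (fun z => (z - ρ)⁻¹) x0 x1 y0 y1 = 2 * Real.pi * I := by
  have hx : x0 ≤ x1 := by linarith
  have hy : y0 ≤ y1 := by linarith
  have hcont : ∀ z : ℂ, z ≠ ρ → ContinuousAt (fun z => (z - ρ)⁻¹) z := by
    intro z hz
    exact ContinuousAt.inv₀ (by fun_prop) (sub_ne_zero.mpr hz)
  have hlog : ∀ z : ℂ, z - ρ ∈ slitPlane → HasDerivAt (fun z => log (z - ρ)) ((z - ρ)⁻¹) z := by
    intro z hz
    simpa using ((hasDerivAt_id z).sub_const ρ).clog hz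
  have hlog' : ∀ z : ℂ, -(z - ρ) ∈ slitPlane → HasDerivAt (fun z => log (-(z - ρ))) ((z - ρ)⁻¹) z := by
    intro z hz
    have := ((hasDerivAt_id z).sub_const ρ).neg.clog hz
    exact this.congr_deriv (by simp [div_eq_inv_mul]; rw [← inv_neg, neg_sub])
  have a1 := integral_horiz_eq (F := fun z => log (z - ρ)) (f := fun z => (z - ρ)⁻¹) (y := y0) hx
    (fun x _ _ => hlog _ (by right; simp; intro h; linarith)) (fun x _ _ => hcont _ (by intro h; have := congrArg im h; simp at this; linarith))
  have a2 := integral_horiz_eq (F := fun z => log (z - ρ)) (f := fun z => (z - ρ)⁻¹) (y := y1) hx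
    (fun x _ _ => hlog _ (by right; simp; intro h; linarith)) (fun x _ _ => hcont _ (by intro h; have := congrArg im h; simp at this; linarith))
  have a3 := integral_vert_eq (F := fun z => log (z - ρ)) (f := fun z => (z - ρ)⁻¹) (x := x1) hy
    (fun x _ _ => hlog _ (by left; simp; linarith)) (fun x _ _ => hcont _ (by intro h; have := congrArg re h; simp at this; linarith))
  have a4 := integral_vert_eq (F := fun z => log (-(z - ρ))) (f := fun z => (z - ρ)⁻¹) (x := x0) hy
    (fun x _ _ => hlog' _ (by left; simp; linarith)) (fun x _ _ => hcont _ (by intro h; have := congrArg re h; simp at this; linarith))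
  unfold rectInt
  rw [a1, a2, a3, a4]
  rw [log_neg_of_im_neg (z := x0 + y0 * I - ρ) (by simp; linarith), log_neg_of_im_pos (z := x0 + y1 * I - ρ) (by simp; linarith)]
  ring

/-- local structure near a zero -/
lemma local_residue {f g : ℂ → ℂ} {ρ : ℂ} {m : ℕ} (hf : AnalyticAt ℂ f ρ) (hg : AnalyticAt ℂ g ρ)
    (hm : analyticOrderAt f ρ = m) : ∃ φ : ℂ → ℂ, AnalyticAt ℂ φ ρ ∧
      ∀ᶠ z in nhdsWithin ρ {ρ}ᶜ, g z * logDeriv f z - m * g ρ * (z - ρ)⁻¹ = φ z := by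
  obtain ⟨k, hk, hk0, hfk⟩ := (hf.analyticOrderAt_eq_natCast).mp hm
  refine ⟨fun z => m * dslope g ρ z + g z * logDeriv k z, ?_, ?_⟩
  · have h1 : AnalyticAt ℂ (dslope g ρ) ρ := by
      obtain ⟨p, hp⟩ := hg
      exact hp.has_fpower_series_dslope_fslope.analyticAt
    have h2 : AnalyticAt ℂ (logDeriv k) ρ := hk.deriv.div hk hk0
    exact (analyticAt_const.mul h1).add (hg.mul h2)
  · have e1 : ∀ᶠ z in nhds ρ, k z ≠ 0 := hk.continuousAt.eventually_ne hk0
    have e2 : ∀ᶠ z in nhds ρ, DifferentiableAt ℂ k z := hk.eventually_analyticAt.mono fun z hz => hz.differentiableAt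
    have e3 := hfk.eventually_nhds
    filter_upwards [nhdsWithin_le_nhds e1, nhdsWithin_le_nhds e2, nhdsWithin_le_nhds e3, self_mem_nhdsWithin] with z h1 h2 h3 h4
    have h4' : z - ρ ≠ 0 := sub_ne_zero.mpr h4
    have h3' : f =ᶠ[nhds z] fun z => (z - ρ) ^ m * k z := by
      filter_upwards [h3] with w hw; simpa using hw
    have h5 : logDeriv f z = m * (z - ρ)⁻¹ + logDeriv k z := by
      have : logDeriv f z = logDeriv (fun z => (z - ρ) ^ m * k z) z := by
        rw [logDeriv_apply, logDeriv_apply, h3'.deriv_eq, h3'.eq_of_nhds]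
      rw [this, logDeriv_mul (f := fun z => (z - ρ) ^ m) (g := k) z (pow_ne_zero _ h4') h1 (by fun_prop) h2]
      congr 1
      have := logDeriv_fun_pow (f := fun z => z - ρ) (x := z) (by fun_prop) m
      rw [this, logDeriv_apply]
      simp
    rw [h5, dslope_of_ne _ h4, slope_def_field]
    field_simp
    ring

lemma residue_core {F0 c : ℂ → ℂ} {x0 x1 y0 y1 : ℝ} (hx : x0 ≤ x1) (hy : y0 ≤ y1) (S : Finset ℂ)
    (hlan : ∀ z : ℂ, x0 ≤ z.re → z.re ≤ x1 → y0 ≤ z.im → z.im ≤ y1 → z ∉ S → AnalyticAt ℂ F0 z)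
    (hS : ∀ z ∈ S, x0 < z.re ∧ z.re < x1 ∧ y0 < z.im ∧ z.im < y1)
    (hres : ∀ ρ ∈ S, ∃ φ : ℂ → ℂ, AnalyticAt ℂ φ ρ ∧
      ∀ᶠ z in nhdsWithin ρ {ρ}ᶜ, F0 z - c ρ * (z - ρ)⁻¹ = φ z) :
    rectInt F0 x0 x1 y0 y1 = 2 * Real.pi * I * ∑ ρ ∈ S, c ρ := by
  classical
  set G : ℂ → ℂ := fun z => ∑ ρ ∈ S, c ρ * (z - ρ)⁻¹ with hG
  have hGan : ∀ z, z ∉ S → AnalyticAt ℂ G z := by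
    intro z hz
    apply Finset.analyticAt_fun_sum
    intro ρ hρ
    have : z - ρ ≠ 0 := sub_ne_zero.mpr (by rintro rfl; exact hz hρ)
    exact analyticAt_const.mul ((by fun_prop : AnalyticAt ℂ (fun z => z - ρ) z).inv this)
  have hloc : ∀ ρ ∈ S, ∃ φ : ℂ → ℂ, AnalyticAt ℂ φ ρ ∧
      ∀ᶠ z in nhdsWithin ρ {ρ}ᶜ, F0 z - G z = φ z := by
    intro ρ hρ
    obtain ⟨h1, h2, h3, h4⟩ := hS ρ hρ
    obtain ⟨φ, hφ, e⟩ := hres ρ hρ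
    refine ⟨fun z => φ z - ∑ ρ' ∈ S.erase ρ, c ρ' * (z - ρ')⁻¹, ?_, ?_⟩
    · apply hφ.sub
      apply Finset.analyticAt_fun_sum
      intro ρ' hρ'
      have : ρ - ρ' ≠ 0 := sub_ne_zero.mpr (by rintro rfl; simp at hρ')
      exact analyticAt_const.mul ((by fun_prop : AnalyticAt ℂ (fun z => z - ρ') ρ).inv this)
    · filter_upwards [e] with z hz
      rw [← hz, hG]
      simp only
      rw [← Finset.add_sum_erase S _ hρ]
      ring
  choose! φ hφ1 hφ2 using hloc
  set F : ℂ → ℂ := fun z => if z ∈ S then φ z z else F0 z - G z with hF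
  have hclosed : ∀ z, z ∉ S → ∀ᶠ w in nhds z, w ∉ S := fun z hz =>
    (S.finite_toSet.isClosed.isOpen_compl).mem_nhds hz
  have hFd : ∀ z : ℂ, x0 ≤ z.re → z.re ≤ x1 → y0 ≤ z.im → z.im ≤ y1 → DifferentiableAt ℂ F z := by
    intro z h1 h2 h3 h4
    by_cases hz : z ∈ S
    · have : F =ᶠ[nhds z] φ z := by
        have e1 := hφ2 z hz
        have e2 : ∀ᶠ w in nhds z, w ∉ S.erase z :=
          ((S.erase z).finite_toSet.isClosed.isOpen_compl).mem_nhds (by simp)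
        rw [eventually_nhdsWithin_iff] at e1
        filter_upwards [e1, e2] with w hw1 hw2
        by_cases hwz : w = z
        · subst hwz; simp [hF, hz]
        · have hwS : w ∉ S := fun h => hw2 (by simp [h, hwz])
          simp only [hF, hwS, if_false]
          exact hw1 hwz
      exact ((hφ1 z hz).differentiableAt).congr_of_eventuallyEq this
    · have : F =ᶠ[nhds z] fun z => F0 z - G z := by
        filter_upwards [hclosed z hz] with w hw
        simp [hF, hw]
      exact ((hlan z h1 h2 h3 h4 hz).sub (hGan z hz)).differentiableAt.congr_of_eventuallyEq this
  have h0 := rectInt_eq_zero hx hy hFd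
  have hbd : ∀ z : ℂ, (z.re = x0 ∨ z.re = x1 ∨ z.im = y0 ∨ z.im = y1) → z ∉ S := by
    intro z h hz
    obtain ⟨h1, h2, h3, h4⟩ := hS z hz
    rcases h with h | h | h | h <;> linarith
  have hsum : rectInt G x0 x1 y0 y1 = 2 * Real.pi * I * ∑ ρ ∈ S, c ρ := by
    rw [hG, rectInt_sum S _ hx hy, Finset.mul_sum]
    · apply Finset.sum_congr rfl
      intro ρ hρ
      obtain ⟨h1, h2, h3, h4⟩ := hS ρ hρ
      rw [rectInt_const_mul, rectInt_inv h1 h2 h3 h4]; ring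
    · intro ρ hρ z _ _ _ _ h5
      have : z - ρ ≠ 0 := sub_ne_zero.mpr (by rintro rfl; exact hbd _ h5 hρ)
      exact continuousAt_const.mul (ContinuousAt.inv₀ (by fun_prop) this)
  rw [← hsum]
  have e : rectInt F0 x0 x1 y0 y1 = rectInt (fun z => F z + G z) x0 x1 y0 y1 := by
    apply rectInt_congr hx hy
    intro z _ _ _ _ h5
    simp [hF, hbd z h5]
  rw [e, rectInt_add hx hy (fun z h1 h2 h3 h4 _ => (hFd z h1 h2 h3 h4).continuousAt)
    (fun z _ _ _ _ h5 => (hGan z (hbd z h5)).continuousAt), h0, zero_add]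

lemma residue_rect {f g : ℂ → ℂ} {x0 x1 y0 y1 : ℝ} (hx : x0 ≤ x1) (hy : y0 ≤ y1) (S : Finset ℂ) (m : ℂ → ℕ)
    (hf : ∀ z : ℂ, x0 ≤ z.re → z.re ≤ x1 → y0 ≤ z.im → z.im ≤ y1 → AnalyticAt ℂ f z)
    (hg : ∀ z : ℂ, x0 ≤ z.re → z.re ≤ x1 → y0 ≤ z.im → z.im ≤ y1 → AnalyticAt ℂ g z)
    (hS : ∀ z ∈ S, x0 < z.re ∧ z.re < x1 ∧ y0 < z.im ∧ z.im < y1)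
    (hne : ∀ z : ℂ, x0 ≤ z.re → z.re ≤ x1 → y0 ≤ z.im → z.im ≤ y1 → z ∉ S → f z ≠ 0)
    (hm : ∀ z ∈ S, analyticOrderAt f z = m z) :
    rectInt (fun z => g z * logDeriv f z) x0 x1 y0 y1 = 2 * Real.pi * I * ∑ ρ ∈ S, m ρ * g ρ := by
  apply residue_core (c := fun ρ => m ρ * g ρ) hx hy S
  · intro z h1 h2 h3 h4 hz
    exact (hg z h1 h2 h3 h4).mul ((hf z h1 h2 h3 h4).deriv.div (hf z h1 h2 h3 h4) (hne z h1 h2 h3 h4 hz))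
  · exact hS
  · intro ρ hρ
    obtain ⟨h1, h2, h3, h4⟩ := hS ρ hρ
    exact local_residue (hf ρ h1.le h2.le h3.le h4.le) (hg ρ h1.le h2.le h3.le h4.le) (hm ρ hρ)

lemma zeta_analyticAt {z : ℂ} (h : z ≠ 1) : AnalyticAt ℂ riemannZeta z := by
  have : DifferentiableOn ℂ riemannZeta {1}ᶜ := fun z hz => (differentiableAt_riemannZeta hz).differentiableWithinAt
  exact this.analyticAt (isOpen_compl_singleton.mem_nhds h)

lemma iteratedDeriv_analyticAt {f : ℂ → ℂ} {z : ℂ} (n : ℕ) (h : AnalyticAt ℂ f z) :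
    AnalyticAt ℂ (iteratedDeriv n f) z := by
  induction n with
  | zero => simpa using h
  | succ k ih => rw [iteratedDeriv_succ]; exact ih.deriv

lemma zetaZeroOrder_eq {ρ : ℂ} (h : ρ ≠ 1) : analyticOrderAt riemannZeta ρ = zetaZeroOrder ρ := by
  have han := zeta_analyticAt h
  have hfin : analyticOrderAt riemannZeta ρ ≠ ⊤ := by
    rw [Ne, analyticOrderAt_eq_top]
    intro h0
    have h1 := (isCompact_closedBall ρ 1).inter_riemannZetaZeros_finite
    apply infinite_of_mem_nhds ρ _ h1
    exact Filter.inter_mem (Metric.closedBall_mem_nhds _ one_pos) h0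
  obtain ⟨m, hm⟩ := ENat.ne_top_iff_exists.mp hfin
  rw [← hm]
  congr 1
  have h1 := (natCast_le_analyticOrderAt_iff_iteratedDeriv_eq_zero (n := m) han).mp hm.le
  have h2 : iteratedDeriv m riemannZeta ρ ≠ 0 := by
    intro h3
    have := (natCast_le_analyticOrderAt_iff_iteratedDeriv_eq_zero (n := m + 1) han).mpr ?_
    · rw [← hm] at this
      have := Nat.cast_le.mp this
      omega
    · intro i hi
      rcases Nat.lt_succ_iff_lt_or_eq.mp hi with h | h
      · exact h1 i h
      · rw [h]; exact h3
  unfold zetaZeroOrder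
  apply le_antisymm
  · have := Nat.sInf_mem (s := {k : ℕ | iteratedDeriv k riemannZeta ρ ≠ 0}) ⟨m, h2⟩
    by_contra hlt
    push Not at hlt
    exact this (h1 _ hlt)
  · exact Nat.sInf_le h2

lemma zeros_finite (T : ℝ) : {ρ : ℂ | IsNontrivialZero ρ ∧ 0 < ρ.im ∧ ρ.im ≤ T}.Finite := by
  have hc : IsCompact (Set.Icc (0:ℝ) 1 ×ℂ Set.Icc 0 T) := isCompact_Icc.reProdIm isCompact_Icc
  apply hc.inter_riemannZetaZeros_finite.subset
  rintro ρ ⟨⟨h0, h1, h2⟩, h3, h4⟩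
  exact ⟨by simp [mem_reProdIm]; exact ⟨⟨h1.le, h2.le⟩, h3.le, h4⟩, h0⟩

lemma exists_t0 : ∃ t0 : ℝ, 2 ≤ t0 ∧ t0 ≤ 3 ∧ ∀ ρ : ℂ, IsNontrivialZero ρ → ρ.im ≠ t0 := by
  classical
  obtain ⟨t, ht, hn⟩ := (Set.Icc_infinite (show (2:ℝ) < 3 by norm_num)).exists_notMem_finset
    ((zeros_finite 3).toFinset.image im)
  refine ⟨t, ht.1, ht.2, fun ρ hρ h => hn ?_⟩
  rw [Finset.mem_image]
  refine ⟨ρ, ?_, h⟩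
  rw [Set.Finite.mem_toFinset]
  exact ⟨hρ, by rw [h]; linarith [ht.1], by rw [h]; exact ht.2⟩

lemma zetaZeroSum_rect (n : ℕ) {t0 T c : ℝ} (ht0 : 2 ≤ t0) (hT : t0 < T) (hc : c ≤ 0)
    (h0 : ∀ ρ : ℂ, IsNontrivialZero ρ → ρ.im ≠ t0) (h1 : ∀ ρ : ℂ, IsNontrivialZero ρ → ρ.im ≠ T) :
    2 * Real.pi * I * (zetaZeroSum n T - zetaZeroSum n t0) =
      rectInt (fun z => iteratedDeriv n riemannZeta z * logDeriv riemannZeta z) c 3 t0 T := by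
  classical
  set A : Set ℂ := {ρ : ℂ | IsNontrivialZero ρ ∧ 0 < ρ.im ∧ ρ.im ≤ t0}
  set B : Set ℂ := {ρ : ℂ | IsNontrivialZero ρ ∧ t0 < ρ.im ∧ ρ.im ≤ T}
  have hAB : {ρ : ℂ | IsNontrivialZero ρ ∧ 0 < ρ.im ∧ ρ.im ≤ T} = A ∪ B := by
    ext ρ
    simp only [A, B, Set.mem_union, Set.mem_setOf_eq]
    constructor
    · rintro ⟨h, h2, h3⟩
      rcases le_or_gt ρ.im t0 with h4 | h4
      · exact Or.inl ⟨h, h2, h4⟩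
      · exact Or.inr ⟨h, h4, h3⟩
    · rintro (⟨h, h2, h3⟩ | ⟨h, h2, h3⟩)
      · exact ⟨h, h2, by linarith⟩
      · exact ⟨h, by linarith, h3⟩
  have hfin := zeros_finite T
  rw [hAB] at hfin
  have hA : A.Finite := hfin.subset Set.subset_union_left
  have hB : B.Finite := hfin.subset Set.subset_union_right
  have hdis : Disjoint A B := by
    rw [Set.disjoint_left]
    rintro ρ ⟨_, _, h⟩ ⟨_, h', _⟩
    linarith
  have e : zetaZeroSum n T - zetaZeroSum n t0 = ∑ ρ ∈ hB.toFinset, (zetaZeroOrder ρ : ℂ) * iteratedDeriv n riemannZeta ρ := by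
    unfold zetaZeroSum
    rw [hAB, finsum_mem_union hdis hA hB, add_sub_cancel_left, finsum_mem_eq_finite_toFinset_sum _ hB]
  have hne1 : ∀ z : ℂ, t0 ≤ z.im → z ≠ 1 := by
    rintro z h rfl
    simp at h; linarith
  rw [e]
  symm
  apply residue_rect (by linarith) hT.le
  · intro z _ _ h3 _
    exact zeta_analyticAt (hne1 z h3)
  · intro z _ _ h3 _
    exact iteratedDeriv_analyticAt n (zeta_analyticAt (hne1 z h3))
  · intro z hz
    rw [Set.Finite.mem_toFinset] at hz
    obtain ⟨h, h2, h3⟩ := hz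
    refine ⟨by linarith [h.2.1], by linarith [h.2.2], h2, lt_of_le_of_ne h3 (h1 z h)⟩
  · intro z _ _ h3 h4 hz h5
    apply hz
    rw [Set.Finite.mem_toFinset]
    have h := zeta_zero_strip h5 (by linarith)
    exact ⟨h, lt_of_le_of_ne h3 (Ne.symm (h0 z h)), h4⟩
  · intro z hz
    rw [Set.Finite.mem_toFinset] at hz
    exact zetaZeroOrder_eq (hne1 z hz.2.1.le)

/-- the Gonek integrand -/
noncomputable def gk (x : ℝ) (s : ℂ) : ℂ := Gamma s * (x : ℂ) ^ (-s) * exp (-(I * Real.pi * s / 2))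

lemma gk_norm {x : ℝ} (hx : 0 < x) (s : ℂ) :
    ‖gk x s‖ = ‖Gamma s‖ * x ^ (-s.re) * Real.exp (Real.pi * s.im / 2) := by
  unfold gk
  rw [norm_mul, norm_mul, norm_cpow_eq_rpow_re_of_pos hx, Complex.norm_exp]
  congr 2
  simp
  ring

lemma exp_abs_le_one (y : ℝ) : Real.exp (-Real.pi * |y| / 2) * Real.exp (Real.pi * y / 2) ≤ 1 := by
  rw [← Real.exp_add]
  apply Real.exp_le_one_iff.mpr
  have := le_abs_self y
  nlinarith [Real.pi_pos]

lemma gk_left : ∃ C > 0, ∀ x : ℝ, 0 < x → ∀ s : ℂ, s.re ≤ 3/2 → 1 ≤ |s.im| →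
    ‖gk x s‖ ≤ C * |s.im| ^ (s.re - 1/2) * x ^ (-s.re) := by
  obtain ⟨C, hC, h⟩ := Gamma_left
  refine ⟨C, hC, fun x hx s h1 h2 => ?_⟩
  rw [gk_norm hx]
  calc _ ≤ (C * |s.im| ^ (s.re - 1/2) * Real.exp (-Real.pi * |s.im| / 2)) * x ^ (-s.re) * Real.exp (Real.pi * s.im / 2) := by
        gcongr; exact h s h1 h2
    _ = C * |s.im| ^ (s.re - 1/2) * x ^ (-s.re) * (Real.exp (-Real.pi * |s.im| / 2) * Real.exp (Real.pi * s.im / 2)) := by ring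
    _ ≤ C * |s.im| ^ (s.re - 1/2) * x ^ (-s.re) * 1 := by
        gcongr; exact exp_abs_le_one _
    _ = _ := mul_one _

lemma gk_right : ∃ C > 0, ∀ x : ℝ, 0 < x → ∀ s : ℂ, 1/2 ≤ s.re → 1 ≤ |s.im| →
    ‖gk x s‖ ≤ C * ‖s‖ ^ (s.re - 1/2) * x ^ (-s.re) := by
  obtain ⟨C, hC, h⟩ := Gamma_right
  refine ⟨C, hC, fun x hx s h1 h2 => ?_⟩
  rw [gk_norm hx]
  calc _ ≤ (C * ‖s‖ ^ (s.re - 1/2) * Real.exp (-Real.pi * |s.im| / 2)) * x ^ (-s.re) * Real.exp (Real.pi * s.im / 2) := by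
        gcongr; exact h s h1 h2
    _ = C * ‖s‖ ^ (s.re - 1/2) * x ^ (-s.re) * (Real.exp (-Real.pi * |s.im| / 2) * Real.exp (Real.pi * s.im / 2)) := by ring
    _ ≤ C * ‖s‖ ^ (s.re - 1/2) * x ^ (-s.re) * 1 := by
        gcongr; exact exp_abs_le_one _
    _ = _ := mul_one _

lemma Gamma_analyticAt {s : ℂ} (h : ∀ m : ℕ, s ≠ -m) : AnalyticAt ℂ Gamma s := by
  rw [Complex.analyticAt_iff_eventually_differentiableAt]
  have hc : AnalyticAt ℂ (fun s => (Gamma s)⁻¹) s := by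
    apply Complex.differentiable_one_div_Gamma.analyticAt
  have h0 := Complex.Gamma_ne_zero h
  have := hc.inv (inv_ne_zero h0)
  have e : (fun s => (Gamma s)⁻¹)⁻¹ = Gamma := by ext; simp
  rw [e] at this
  exact this.eventually_analyticAt.mono fun z hz => hz.differentiableAt

lemma gk_rest_analyticAt {x : ℝ} (hx : 0 < x) (s : ℂ) :
    AnalyticAt ℂ (fun s => (x : ℂ) ^ (-s) * exp (-(I * Real.pi * s / 2))) s := by
  have hx' : (x : ℂ) ≠ 0 := by exact_mod_cast hx.ne'
  have : Differentiable ℂ (fun s => (x : ℂ) ^ (-s) * exp (-(I * Real.pi * s / 2))) := by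
    intro s
    have hp : DifferentiableAt ℂ (fun s : ℂ => (x : ℂ) ^ (-s)) s :=
      DifferentiableAt.const_cpow (by fun_prop) (Or.inl hx')
    fun_prop
  exact this.analyticAt s

lemma gk_analyticAt {x : ℝ} (hx : 0 < x) {s : ℂ} (h : ∀ m : ℕ, s ≠ -m) : AnalyticAt ℂ (gk x) s := by
  have := (Gamma_analyticAt h).mul (gk_rest_analyticAt hx s)
  refine this.congr (Eventually.of_forall fun z => ?_)
  simp [gk, mul_assoc]

lemma Gamma_shift (k : ℕ) {s : ℂ} (h : ∀ m : ℕ, s ≠ -m) :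
    Gamma s * ∏ j ∈ Finset.range k, (s + j) = Gamma (s + k) := by
  induction k with
  | zero => simp
  | succ k ih =>
    rw [Finset.prod_range_succ, ← mul_assoc, ih, Nat.cast_succ, ← add_assoc, Complex.Gamma_add_one, mul_comm]
    intro h0
    exact h k (eq_neg_of_add_eq_zero_left h0)

lemma prod_neg_range (k : ℕ) : ∏ j ∈ Finset.range k, (-(k:ℂ) + j) = (-1) ^ k * (k.factorial : ℂ) := by
  induction k with
  | zero => simp
  | succ k ih =>
    rw [Finset.prod_range_succ', Nat.factorial_succ]
    have : ∏ j ∈ Finset.range k, (-((k + 1 : ℕ) : ℂ) + ((j + 1 : ℕ) : ℂ)) = ∏ j ∈ Finset.range k, (-(k:ℂ) + j) := by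
      apply Finset.prod_congr rfl; intro j _; push_cast; ring
    rw [this, ih]; push_cast; ring

lemma gk_res {x : ℝ} (hx : 0 < x) (k : ℕ) : ∃ φ : ℂ → ℂ, AnalyticAt ℂ φ (-(k:ℂ)) ∧
    ∀ᶠ z in nhdsWithin (-(k:ℂ)) {-(k:ℂ)}ᶜ, gk x z - ((-(I * x)) ^ k / k.factorial) * (z - (-(k:ℂ)))⁻¹ = φ z := by
  set ψ : ℂ → ℂ := fun s => Gamma (s + (k + 1 : ℕ)) * (∏ j ∈ Finset.range k, (s + j))⁻¹ *
    ((x : ℂ) ^ (-s) * exp (-(I * Real.pi * s / 2))) with hψ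
  have hne : ∏ j ∈ Finset.range k, (-(k:ℂ) + j) ≠ 0 := by
    rw [prod_neg_range]
    exact mul_ne_zero (pow_ne_zero _ (by norm_num)) (by exact_mod_cast Nat.factorial_ne_zero k)
  have hψa : AnalyticAt ℂ ψ (-(k:ℂ)) := by
    refine AnalyticAt.mul (AnalyticAt.mul ?_ ?_) (gk_rest_analyticAt hx _)
    · have h1 : AnalyticAt ℂ Gamma (-(k:ℂ) + (k+1:ℕ)) := by
        apply Gamma_analyticAt
        intro m hm
        have := congrArg re hm
        simp at this
        have hm' : (0:ℝ) ≤ m := m.cast_nonneg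
        linarith
      exact AnalyticAt.fun_comp h1 (by fun_prop)
    · refine AnalyticAt.inv ?_ hne
      apply Finset.analyticAt_fun_prod
      intro j _; fun_prop
  have hval : ψ (-(k:ℂ)) = (-(I * x)) ^ k / k.factorial := by
    have hx' : (x : ℂ) ≠ 0 := by exact_mod_cast hx.ne'
    have e1 : exp (-(I * Real.pi * (-(k:ℂ)) / 2)) = I ^ k := by
      rw [show -(I * Real.pi * (-(k:ℂ)) / 2) = k * (Real.pi / 2 * I) by ring, Complex.exp_nat_mul, Complex.exp_pi_div_two_mul_I]
    simp only [hψ]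
    rw [prod_neg_range, e1, neg_neg, Complex.cpow_natCast]
    have e2 : -(k:ℂ) + (k + 1 : ℕ) = 1 := by push_cast; ring
    rw [e2, Complex.Gamma_one, neg_pow (I * (x:ℂ)), mul_pow, mul_inv, ← inv_pow]
    norm_num
    ring
  refine ⟨dslope ψ (-(k:ℂ)), ?_, ?_⟩
  · obtain ⟨p, hp⟩ := hψa
    exact hp.has_fpower_series_dslope_fslope.analyticAt
  · have e1 : ∀ᶠ z : ℂ in nhds (-(k:ℂ)), ∏ j ∈ Finset.range k, (z + j) ≠ 0 :=
      ContinuousAt.eventually_ne (by fun_prop) hne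
    have e2 : ∀ᶠ z : ℂ in nhds (-(k:ℂ)), 0 < (z + (k + 1 : ℕ)).re := by
      have : ContinuousAt (fun z : ℂ => (z + (k + 1 : ℕ)).re) (-(k:ℂ)) := by fun_prop
      apply this.eventually_const_lt
      simp
    filter_upwards [nhdsWithin_le_nhds e1, nhdsWithin_le_nhds e2, self_mem_nhdsWithin] with z h1 h2 h3
    have h4 : z - (-(k:ℂ)) ≠ 0 := sub_ne_zero.mpr h3
    have hz : ∀ m : ℕ, z ≠ -m := by
      intro m hm
      rcases lt_trichotomy m k with h | h | h
      · apply h1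
        apply Finset.prod_eq_zero (Finset.mem_range.mpr h)
        rw [hm]; ring
      · subst h; exact h3 hm
      · rw [hm] at h2; simp at h2
        have : (k:ℝ) + 1 ≤ m := by exact_mod_cast h
        linarith
    rw [dslope_of_ne _ h3, slope_def_field, hval]
    have e := Gamma_shift (k + 1) hz
    rw [Finset.prod_range_succ] at e
    have : gk x z * (z - (-(k:ℂ))) = ψ z := by
      simp only [hψ, gk]
      rw [← e]
      field_simp
      ring
    rw [← this]
    field_simp

lemma integral_exp_mul {k : ℝ} (hk : k ≠ 0) (a b : ℝ) :
    ∫ σ in a..b, Real.exp (k * σ) = (Real.exp (k * b) - Real.exp (k * a)) / k := by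
  have := intervalIntegral.integral_eq_sub_of_hasDerivAt (f := fun σ : ℝ => Real.exp (k * σ) / k)
    (f' := fun σ => Real.exp (k * σ)) (a := a) (b := b) ?_ (by apply Continuous.intervalIntegrable; fun_prop)
  · rw [this]; ring
  · intro x _
    have := (((hasDerivAt_id x).const_mul k).exp).div_const k
    exact this.congr_deriv (by simp; field_simp)

lemma rpow_mul_rpow_neg {T x : ℝ} (hT : 0 < T) (hx : 0 < x) (σ : ℝ) :
    T ^ (σ - 1/2) * x ^ (-σ) = T ^ (-(1/2) : ℝ) * Real.exp (Real.log (T / x) * σ) := by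
  rw [sub_eq_add_neg, Real.rpow_add hT, Real.exp_mul, Real.exp_log (by positivity), Real.div_rpow hT.le hx.le, Real.rpow_neg hx.le]
  field_simp

lemma gk_continuousAt {x : ℝ} (hx : 0 < x) {s : ℂ} (h : s.im ≠ 0 ∨ 0 < s.re) : ContinuousAt (gk x) s := by
  apply (gk_analyticAt hx _).continuousAt
  intro m hm
  rw [hm] at h
  simp at h
  have : (0:ℝ) ≤ m := m.cast_nonneg
  linarith

lemma log_ge_one_sub {T x : ℝ} (hx : 0 < x) (h : x < T) : (T - x) / T ≤ Real.log (T / x) := by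
  have hT : 0 < T := by linarith
  have := Real.one_sub_inv_le_log_of_pos (x := T / x) (by positivity)
  rw [inv_div] at this
  have e : (T - x) / T = 1 - x / T := by field_simp
  rw [e]; exact this

lemma gk_horiz_left : ∃ C > 0, ∀ x T a b y : ℝ, 0 < x → x < T → a ≤ 3/2 → b ≤ a → 1 ≤ T → |y| = T →
    ‖∫ σ in b..a, gk x (σ + y * I)‖ ≤ C * (T ^ (a - 1/2) * x ^ (-a)) * (T / (T - x)) := by
  obtain ⟨C, hC, h⟩ := gk_left
  refine ⟨C, hC, fun x T a b y hx hxT ha hb hT hy => ?_⟩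
  have hT0 : 0 < T := by linarith
  have hTx : 0 < T - x := by linarith
  set k := Real.log (T / x) with hk
  have hk1 : (T - x) / T ≤ k := log_ge_one_sub hx hxT
  have hk0 : 0 < k := lt_of_lt_of_le (by positivity) hk1
  have hbound : ∀ σ ∈ Set.Ioc b a, ‖gk x (σ + y * I)‖ ≤ C * T ^ (-(1/2) : ℝ) * Real.exp (k * σ) := by
    intro σ hσ
    have := h x hx (σ + y * I) (by simp; linarith [hσ.2]) (by simp; rw [hy]; exact hT)
    simp only [add_re, ofReal_re, mul_re, I_re, mul_zero, ofReal_im, I_im, mul_one, sub_self, add_zero, add_im, mul_im, zero_add] at this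
    rw [hy, mul_assoc, rpow_mul_rpow_neg hT0 hx, ← mul_assoc] at this
    exact this
  calc _ ≤ ∫ σ in b..a, C * T ^ (-(1/2) : ℝ) * Real.exp (k * σ) := by
        apply intervalIntegral.norm_integral_le_of_norm_le hb
        · filter_upwards with σ hσ using hbound σ hσ
        · apply Continuous.intervalIntegrable; fun_prop
    _ = C * T ^ (-(1/2) : ℝ) * ((Real.exp (k * a) - Real.exp (k * b)) / k) := by
        rw [intervalIntegral.integral_const_mul, integral_exp_mul hk0.ne']
    _ ≤ C * T ^ (-(1/2) : ℝ) * (Real.exp (k * a) / ((T - x) / T)) := by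
        gcongr
        linarith [Real.exp_pos (k * b)]
    _ = _ := by rw [rpow_mul_rpow_neg hT0 hx, ← hk]; field_simp

lemma Gamma_far_left (k : ℕ) (y : ℝ) : ‖Gamma (((-(k:ℝ) - 1/2 : ℝ) : ℂ) + y * I)‖ ≤ 8 / k.factorial := by
  induction k with
  | zero =>
    have h1 := Complex.Gamma_add_one (((-((0:ℕ):ℝ) - 1/2 : ℝ) : ℂ) + y * I) (by intro h; have := congrArg re h; simp at this)
    have h2 := norm_Gamma_le_Gamma_re (s := ((-((0:ℕ):ℝ) - 1/2 : ℝ) : ℂ) + y * I + 1) (by simp; norm_num)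
    rw [h1, norm_mul] at h2
    have h3 : (1/2 : ℝ) ≤ ‖((-((0:ℕ):ℝ) - 1/2 : ℝ) : ℂ) + y * I‖ := by
      refine le_trans ?_ (Complex.abs_re_le_norm _)
      simp [abs_of_pos]
    have h4 : Real.Gamma ((((-((0:ℕ):ℝ) - 1/2 : ℝ) : ℂ) + y * I + 1).re) ≤ 2 := by
      have : (((-((0:ℕ):ℝ) - 1/2 : ℝ) : ℂ) + y * I + 1).re = 1/2 := by simp; norm_num
      rw [this, Real.Gamma_one_half_eq]
      rw [Real.sqrt_le_left (by norm_num)]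
      linarith [Real.pi_lt_d2]
    simp only [Nat.factorial_zero, Nat.cast_one, div_one]
    nlinarith [norm_nonneg (Gamma (((-((0:ℕ):ℝ) - 1/2 : ℝ) : ℂ) + y * I))]
  | succ k ih =>
    have h1 := Complex.Gamma_add_one (((-((k+1:ℕ):ℝ) - 1/2 : ℝ) : ℂ) + y * I) (by
      intro h; have := congrArg re h; simp at this
      have hk : (0:ℝ) ≤ k := k.cast_nonneg
      linarith)
    have e : ((-((k+1:ℕ):ℝ) - 1/2 : ℝ) : ℂ) + y * I + 1 = ((-(k:ℝ) - 1/2 : ℝ) : ℂ) + y * I := by push_cast; ring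
    rw [e] at h1
    rw [h1, norm_mul] at ih
    have h3 : (k + 1 : ℝ) ≤ ‖((-((k+1:ℕ):ℝ) - 1/2 : ℝ) : ℂ) + y * I‖ := by
      refine le_trans ?_ (Complex.abs_re_le_norm _)
      refine le_trans ?_ (neg_le_abs _)
      simp
      linarith
    rw [Nat.factorial_succ]
    push_cast
    rw [le_div_iff₀ (by positivity)] at ih ⊢
    calc _ = (((k:ℝ) + 1) * ‖Gamma (((-((k+1:ℕ):ℝ) - 1/2 : ℝ) : ℂ) + y * I)‖) * k.factorial := by push_cast; ring
      _ ≤ _ := by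
        refine le_trans ?_ ih
        gcongr

lemma gk_rect {x a T : ℝ} (hx : 0 < x) (ha : 0 < a) (hT : 0 < T) (K : ℕ) :
    rectInt (gk x) (-(K:ℝ) - 1/2) a (-T) T = 2 * Real.pi * I * ∑ k ∈ Finset.range (K + 1), (-(I * x)) ^ k / k.factorial := by
  classical
  have hK : (0:ℝ) ≤ K := K.cast_nonneg
  have hinj : Function.Injective (fun k : ℕ => -(k:ℂ)) := by
    intro i j h
    simpa using h
  have := residue_core (F0 := gk x) (c := fun z => (-(I * x)) ^ (⌊-z.re⌋₊) / (⌊-z.re⌋₊).factorial)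
    (x0 := -(K:ℝ) - 1/2) (x1 := a) (y0 := -T) (y1 := T)
    (by linarith) (by linarith) ((Finset.range (K+1)).image (fun k : ℕ => -(k:ℂ))) ?_ ?_ ?_
  · rw [this, Finset.sum_image (fun _ _ _ _ h => hinj h)]
    simp
  · intro z h1 _ _ _ hz
    apply gk_analyticAt hx
    intro m hm
    apply hz
    rw [Finset.mem_image]
    refine ⟨m, ?_, hm.symm⟩
    rw [hm] at h1
    simp at h1
    rw [Finset.mem_range]
    have : (m:ℝ) < K + 1 := by linarith
    exact_mod_cast this
  · intro z hz
    rw [Finset.mem_image] at hz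
    obtain ⟨m, hm, rfl⟩ := hz
    rw [Finset.mem_range] at hm
    have : (m:ℝ) ≤ K := by exact_mod_cast Nat.lt_succ_iff.mp hm
    have h0 : (0:ℝ) ≤ m := m.cast_nonneg
    simp
    refine ⟨by linarith, by linarith, hT⟩
  · intro z hz
    rw [Finset.mem_image] at hz
    obtain ⟨m, hm, rfl⟩ := hz
    simpa using gk_res hx m

lemma Gamma_bdd : ∃ M > 0, ∀ a : ℝ, 1 ≤ a → a ≤ 3/2 → Real.Gamma a ≤ M := by
  have hc : ContinuousOn Real.Gamma (Set.Icc 1 (3/2)) := by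
    intro x hx
    apply ContinuousAt.continuousWithinAt
    refine (Real.differentiableAt_Gamma ?_).continuousAt
    intro m hm
    have : (0:ℝ) ≤ m := m.cast_nonneg
    linarith [hx.1]
  obtain ⟨M, hM⟩ := isCompact_Icc.exists_bound_of_continuousOn hc
  refine ⟨|M| + 1, by positivity, fun a h1 h2 => ?_⟩
  have := hM a ⟨h1, h2⟩
  linarith [le_abs_self M, le_abs_self (Real.Gamma a), Real.norm_eq_abs (Real.Gamma a)]

lemma gk_low : ∃ M > 0, ∀ x a T t0 : ℝ, 0 < x → 1 ≤ a → a ≤ 3/2 → t0 ≤ 3 → -T ≤ t0 →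
    ‖∫ y in (-T)..t0, gk x (a + y * I)‖ ≤ M * x ^ (-a) := by
  obtain ⟨M, hM, h⟩ := Gamma_bdd
  refine ⟨M * Real.exp (Real.pi / 2 * 3), by positivity, fun x a T t0 hx h1 h2 h3 h4 => ?_⟩
  have hpi := Real.pi_gt_three
  have hbound : ∀ y ∈ Set.Ioc (-T) t0, ‖gk x (a + y * I)‖ ≤ M * x ^ (-a) * Real.exp (Real.pi / 2 * y) := by
    intro y _
    rw [gk_norm hx]
    have g := norm_Gamma_le_Gamma_re (s := (a + y * I : ℂ)) (by simp; linarith)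
    simp only [add_re, ofReal_re, mul_re, I_re, mul_zero, ofReal_im, I_im, mul_one, sub_self, add_zero, add_im, mul_im, zero_add] at g ⊢
    have := h a h1 h2
    rw [show Real.pi * y / 2 = Real.pi / 2 * y by ring]
    gcongr
    linarith
  calc _ ≤ ∫ y in (-T)..t0, M * x ^ (-a) * Real.exp (Real.pi / 2 * y) := by
        apply intervalIntegral.norm_integral_le_of_norm_le h4
        · filter_upwards with σ hσ using hbound σ hσ
        · apply Continuous.intervalIntegrable; fun_prop
    _ = M * x ^ (-a) * ((Real.exp (Real.pi / 2 * t0) - Real.exp (Real.pi / 2 * (-T))) / (Real.pi / 2)) := by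
        rw [intervalIntegral.integral_const_mul, integral_exp_mul (by positivity)]
    _ ≤ M * x ^ (-a) * (Real.exp (Real.pi / 2 * 3) / 1) := by
        have e1 : Real.exp (Real.pi / 2 * t0) ≤ Real.exp (Real.pi / 2 * 3) := by
          apply Real.exp_le_exp.mpr; nlinarith
        have e2 := Real.exp_pos (Real.pi / 2 * (-T))
        gcongr
        · linarith
        · linarith
    _ = _ := by ring

lemma tendsto_left_zero {x T : ℝ} (hx : 0 < x) (hT : 0 < T) :
    Tendsto (fun K : ℕ => ∫ y in (-T)..T, gk x (((-(K:ℝ) - 1/2 : ℝ) : ℂ) + y * I)) atTop (nhds 0) := by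
  have hlim : Tendsto (fun K : ℕ => (8 * (x ^ (1/2 : ℝ)) * Real.exp (Real.pi * T / 2) * (2 * T)) * (x ^ K / K.factorial)) atTop (nhds 0) := by
    have := (FloorSemiring.tendsto_pow_div_factorial_atTop x).const_mul (8 * (x ^ (1/2 : ℝ)) * Real.exp (Real.pi * T / 2) * (2 * T))
    rwa [mul_zero] at this
  apply squeeze_zero_norm _ hlim
  intro K
  have := intervalIntegral.norm_integral_le_of_norm_le_const (a := -T) (b := T)
    (f := fun y : ℝ => gk x (((-(K:ℝ) - 1/2 : ℝ) : ℂ) + y * I)) (C := 8 / K.factorial * x ^ ((K:ℝ) + 1/2) * Real.exp (Real.pi * T / 2)) ?_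
  · refine this.trans (le_of_eq ?_)
    rw [Real.rpow_add hx, Real.rpow_natCast, show T - -T = 2 * T by ring, abs_of_pos (by linarith)]
    ring
  · intro y hy
    rw [Set.uIoc_of_le (by linarith)] at hy
    rw [gk_norm hx]
    have g := Gamma_far_left K y
    have e1 : (((-(K:ℝ) - 1/2 : ℝ) : ℂ) + y * I).re = -(K:ℝ) - 1/2 := by simp
    have e2 : (((-(K:ℝ) - 1/2 : ℝ) : ℂ) + y * I).im = y := by simp
    rw [e1, e2, show -(-(K:ℝ) - 1/2) = K + 1/2 by ring]
    have : Real.exp (Real.pi * y / 2) ≤ Real.exp (Real.pi * T / 2) := by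
      apply Real.exp_le_exp.mpr; nlinarith [Real.pi_pos, hy.2]
    gcongr

lemma exp_neg_I_two_pi (N : ℕ) : exp (-(I * (2 * Real.pi * N : ℝ))) = 1 := by
  rw [Complex.exp_eq_one_iff]
  exact ⟨-N, by push_cast; ring⟩

lemma gonek_left : ∃ C > 0, ∀ (a T t0 : ℝ) (N : ℕ), 1 ≤ a → a ≤ 3/2 → 3 ≤ T → 2 ≤ t0 → t0 ≤ 3 →
    1 ≤ N → 2 * Real.pi * N < T →
    ‖(∫ y in t0..T, gk (2 * Real.pi * N) (a + y * I)) - 2 * Real.pi‖ ≤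
      C * (T ^ (a - 1/2) * (2 * Real.pi * N) ^ (-a)) * (1 + T / (T - 2 * Real.pi * N)) := by
  obtain ⟨C, hC, h⟩ := gk_horiz_left
  obtain ⟨M, hM, hlow⟩ := gk_low
  refine ⟨2 * C + M, by positivity, fun a T t0 N ha1 ha2 hT h2 h3 hN hx => ?_⟩
  have hN' : (1:ℝ) ≤ N := by exact_mod_cast hN
  have hx0 : 0 < 2 * Real.pi * N := by positivity
  have hexp := exp_neg_I_two_pi N
  set x := 2 * Real.pi * N
  have hTx : 0 < T - x := by linarith
  have hT0 : 0 < T := by linarith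
  set B := C * (T ^ (a - 1/2) * x ^ (-a)) * (T / (T - x)) with hB
  have key : ‖(∫ y in (-T)..T, gk x (a + y * I)) - 2 * Real.pi‖ ≤ 2 * B := by
    have hK : ∀ K : ℕ, ‖(∫ y in (-T)..T, gk x (a + y * I)) - 2 * Real.pi * ∑ k ∈ Finset.range (K + 1), (-(I * x)) ^ k / k.factorial
        - ∫ y in (-T)..T, gk x (((-(K:ℝ) - 1/2 : ℝ) : ℂ) + y * I)‖ ≤ 2 * B := by
      intro K
      have hK0 : (0:ℝ) ≤ K := K.cast_nonneg
      have e := gk_rect (a := a) hx0 (by linarith) hT0 K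
      unfold rectInt at e
      have b1 := h x T a (-(K:ℝ) - 1/2) (-T) hx0 hx ha2 (by linarith) (by linarith) (by rw [abs_neg, abs_of_pos hT0])
      have b2 := h x T a (-(K:ℝ) - 1/2) T hx0 hx ha2 (by linarith) (by linarith) (abs_of_pos hT0)
      rw [← hB] at b1 b2
      set P := ∫ σ in (-(K:ℝ) - 1/2)..a, gk x (σ + ((-T : ℝ) : ℂ) * I)
      set Q := ∫ σ in (-(K:ℝ) - 1/2)..a, gk x (σ + (T : ℂ) * I)
      set R := ∫ y in (-T)..T, gk x (a + y * I)
      set Lf := ∫ y in (-T)..T, gk x (((-(K:ℝ) - 1/2 : ℝ) : ℂ) + y * I)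
      set Sm := ∑ k ∈ Finset.range (K + 1), (-(I * x)) ^ k / (k.factorial : ℂ)
      have : R - 2 * Real.pi * Sm - Lf = I * (P - Q) := by
        have hI := I_mul_I
        linear_combination (-I) * e - (2 * Real.pi * Sm - R + Lf) * hI
      rw [this, norm_mul, norm_I, one_mul]
      linarith [norm_sub_le P Q]
    have hs : Tendsto (fun K : ℕ => ∑ k ∈ Finset.range (K + 1), (-(I * x)) ^ k / (k.factorial : ℂ)) atTop (nhds 1) := by
      have h1 := (NormedSpace.expSeries_div_hasSum_exp (𝔸 := ℂ) (-(I * (x:ℂ)))).tendsto_sum_nat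
      rw [← Complex.exp_eq_exp_ℂ, hexp] at h1
      exact h1.comp (tendsto_add_atTop_nat 1)
    have hl := tendsto_left_zero hx0 hT0
    have hlim := ((tendsto_const_nhds (x := ∫ y in (-T)..T, gk x (a + y * I))).sub (hs.const_mul (2 * Real.pi : ℂ))).sub hl
    have := le_of_tendsto hlim.norm (Eventually.of_forall hK)
    simpa using this
  have hsplit : (∫ y in (-T)..t0, gk x (a + y * I)) + (∫ y in t0..T, gk x (a + y * I)) = ∫ y in (-T)..T, gk x (a + y * I) := by
    apply intervalIntegral.integral_add_adjacent_intervals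
    · apply intervalIntegrable_vert (by linarith)
      intro y _ _; apply gk_continuousAt hx0; right; simp; linarith
    · apply intervalIntegrable_vert (by linarith)
      intro y _ _; apply gk_continuousAt hx0; right; simp; linarith
  have hl := hlow x a T t0 hx0 ha1 ha2 h3 (by linarith)
  have hTa : 1 ≤ T ^ (a - 1/2) := Real.one_le_rpow (by linarith) (by linarith)
  have e : (∫ y in t0..T, gk x (a + y * I)) - 2 * Real.pi = ((∫ y in (-T)..T, gk x (a + y * I)) - 2 * Real.pi) - ∫ y in (-T)..t0, gk x (a + y * I) := by
    rw [← hsplit]; ring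
  rw [e]
  refine (norm_sub_le _ _).trans ?_
  have hq : 0 < T / (T - x) := by positivity
  have hxa : 0 < x ^ (-a) := by positivity
  calc _ ≤ 2 * B + M * x ^ (-a) := add_le_add key hl
    _ ≤ 2 * B + M * (T ^ (a - 1/2) * x ^ (-a)) := by
        gcongr; nlinarith
    _ ≤ _ := by
        rw [hB]
        have : 0 < T ^ (a - 1/2) * x ^ (-a) := by positivity
        have c1 := mul_pos hC this
        have c2 := mul_pos hM this
        have c3 := mul_pos c2 hq
        nlinarith

/-- the bound to the right of the stationary point -/
lemma gonek_right : ∃ C > 0, ∀ (a T t0 u x : ℝ), 1 ≤ a → a ≤ 3/2 → 2 ≤ u → T = u ^ 4 → 2 ≤ t0 → t0 ≤ 3 →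
    T + u ^ 2 ≤ x →
    ‖∫ y in t0..T, gk x (a + y * I)‖ ≤ C * (T ^ (a - 1/2) * x ^ (-a)) * (1 + T / (x - T)) := by
  obtain ⟨C, hC, h⟩ := gk_right
  refine ⟨C * 1000000, by positivity, fun a T t0 u x ha1 ha2 hu hTu h2 h3 hx => ?_⟩
  have hu2 : 4 ≤ u ^ 2 := by nlinarith
  have hu3 : 8 ≤ u ^ 3 := by nlinarith
  have hT16 : 16 ≤ T := by rw [hTu]; nlinarith
  have hT0 : 0 < T := by linarith
  have hx0 : 0 < x := by linarith
  set D := x - T with hD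
  have hDu : u ^ 2 ≤ D := by linarith
  have hD0 : 0 < D := by linarith
  set R := u ^ 4 + u ^ 2 / 2 with hR
  have hR0 : 0 < R := by positivity
  have hRx : R < x := by rw [hR]; linarith
  have hRT : R ≤ 2 * T := by rw [hR, hTu]; nlinarith
  have hTR : T ≤ R := by rw [hR, hTu]; nlinarith
  set b := u ^ 3 with hb
  -- norm bound inside the rectangle
  have hnorm : ∀ σ y : ℝ, a ≤ σ → σ ≤ b → t0 ≤ y → y ≤ T → ‖gk x (σ + y * I)‖ ≤ C * R ^ (-(1/2) : ℝ) * Real.exp (-(Real.log (x / R)) * σ) := by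
    intro σ y h4 h5 h6 h7
    have g := h x hx0 (σ + y * I) (by simp; linarith) (by simp; rw [abs_of_pos (by linarith)]; linarith)
    have hn : ‖(σ + y * I : ℂ)‖ ≤ R := by
      rw [Complex.norm_add_mul_I, Real.sqrt_le_left hR0.le]
      calc σ ^ 2 + y ^ 2 ≤ (u ^ 3) ^ 2 + (u ^ 4) ^ 2 := by
            rw [hTu] at h7
            gcongr
            all_goals linarith
        _ ≤ R ^ 2 := by rw [hR]; nlinarith [sq_nonneg (u^2)]
    simp only [add_re, ofReal_re, mul_re, I_re, mul_zero, ofReal_im, I_im, mul_one, sub_self, add_zero] at g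
    have e := rpow_mul_rpow_neg hR0 hx0 σ
    have e2 : Real.log (R / x) = - Real.log (x / R) := by rw [← Real.log_inv, inv_div]
    rw [e2] at e
    calc _ ≤ C * ‖(σ + y * I : ℂ)‖ ^ (σ - 1/2) * x ^ (-σ) := g
      _ ≤ C * R ^ (σ - 1/2) * x ^ (-σ) := by
          gcongr
          linarith
      _ = _ := by rw [mul_assoc, e, mul_assoc]
  set k := Real.log (x / R) with hk
  have hk1 : D / (2 * x) ≤ k := by
    refine le_trans ?_ (log_ge_one_sub hR0 hRx)
    rw [div_le_div_iff₀ (by positivity) hx0]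
    have : D ≤ 2 * (x - R) := by rw [hR]; linarith
    nlinarith
  have hk0 : 0 < k := lt_of_lt_of_le (by positivity) hk1
  have hkinv : 1 / k ≤ 2 * (1 + T / D) := by
    rw [div_le_iff₀ hk0]
    have : 2 * (1 + T / D) * (D / (2 * x)) = 1 := by
      have : x = D + T := by rw [hD]; ring
      rw [this]
      have : D + T ≠ 0 := by positivity
      field_simp
    calc 1 = 2 * (1 + T / D) * (D / (2 * x)) := this.symm
      _ ≤ _ := by gcongr
  have hRa : R ^ (-(1/2) : ℝ) * Real.exp (-k * a) ≤ 4 * (T ^ (a - 1/2) * x ^ (-a)) := by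
    have e := rpow_mul_rpow_neg hR0 hx0 a
    have e2 : Real.log (R / x) = - k := by rw [hk, ← Real.log_inv, inv_div]
    rw [e2] at e
    rw [← e]
    have : R ^ (a - 1/2) ≤ 4 * T ^ (a - 1/2) := by
      calc R ^ (a - 1/2) ≤ (2 * T) ^ (a - 1/2) := by gcongr; linarith
        _ = 2 ^ (a - 1/2) * T ^ (a - 1/2) := Real.mul_rpow (by norm_num) hT0.le
        _ ≤ 2 ^ (2:ℝ) * T ^ (a - 1/2) := by
            gcongr
            · norm_num
            · linarith
        _ = _ := by norm_num
    calc _ ≤ 4 * T ^ (a - 1/2) * x ^ (-a) := by gcongr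
      _ = _ := by ring
  have hab : a ≤ b := by linarith
  set G := T ^ (a - 1/2) * x ^ (-a) with hG
  have hG0 : 0 < G := by positivity
  have hor : ∀ y : ℝ, t0 ≤ y → y ≤ T → ‖∫ σ in a..b, gk x (σ + y * I)‖ ≤ C * 8 * G * (1 + T / D) := by
    intro y h6 h7
    calc _ ≤ ∫ σ in a..b, C * R ^ (-(1/2) : ℝ) * Real.exp (-k * σ) := by
          apply intervalIntegral.norm_integral_le_of_norm_le hab
          · filter_upwards with σ hσ using hnorm σ y hσ.1.le hσ.2 h6 h7
          · apply Continuous.intervalIntegrable; fun_prop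
      _ = C * R ^ (-(1/2) : ℝ) * ((Real.exp (-k * b) - Real.exp (-k * a)) / (-k)) := by
          rw [intervalIntegral.integral_const_mul, integral_exp_mul (by linarith)]
      _ = C * R ^ (-(1/2) : ℝ) * ((Real.exp (-k * a) - Real.exp (-k * b)) * (1 / k)) := by
          congr 1; field_simp; ring
      _ ≤ C * R ^ (-(1/2) : ℝ) * (Real.exp (-k * a) * (2 * (1 + T / D))) := by
          gcongr
          linarith [Real.exp_pos (-k * b)]
      _ = C * (R ^ (-(1/2) : ℝ) * Real.exp (-k * a)) * (2 * (1 + T / D)) := by ring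
      _ ≤ C * (4 * G) * (2 * (1 + T / D)) := by gcongr
      _ = _ := by ring
  have hvert : ‖∫ y in t0..T, gk x (b + y * I)‖ ≤ C * 900000 * G := by
    have hdec : T * Real.exp (-k * (b - a)) ≤ 200000 := by
      have h5 : u / 8 ≤ k * (b - a) := by
        have : 1 / (4 * u ^ 2) ≤ k := by
          refine le_trans ?_ hk1
          rw [div_le_div_iff₀ (by positivity) (by positivity)]
          have : x = D + u ^ 4 := by rw [hD, hTu]; ring
          rw [this]
          nlinarith [mul_nonneg (sub_nonneg.mpr hDu) (sub_nonneg.mpr hu2), sq_nonneg (u^2)]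
        calc u / 8 = 1 / (4 * u ^ 2) * (u ^ 3 / 2) := by field_simp; norm_num
          _ ≤ k * (b - a) := by
            gcongr
            rw [hb]; linarith
      have h6 : (u / 8) ^ 4 / 24 ≤ Real.exp (k * (b - a)) := by
        refine le_trans ?_ (Real.exp_le_exp.mpr h5)
        have := Real.pow_div_factorial_le_exp (x := u / 8) (by positivity) 4
        simpa [Nat.factorial] using this
      rw [neg_mul, Real.exp_neg, ← div_eq_mul_inv, div_le_iff₀ (Real.exp_pos _), hTu]
      calc u ^ 4 = 98304 * ((u / 8) ^ 4 / 24) := by ring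
        _ ≤ 98304 * Real.exp (k * (b - a)) := by gcongr
        _ ≤ _ := by gcongr; norm_num
    have := intervalIntegral.norm_integral_le_of_norm_le_const (a := t0) (b := T)
      (f := fun y : ℝ => gk x (b + y * I)) (C := C * R ^ (-(1/2) : ℝ) * Real.exp (-k * b)) ?_
    · refine this.trans ?_
      rw [abs_of_nonneg (by linarith)]
      calc _ ≤ C * R ^ (-(1/2) : ℝ) * Real.exp (-k * b) * T := by gcongr; linarith
        _ = C * (R ^ (-(1/2) : ℝ) * Real.exp (-k * a)) * (T * Real.exp (-k * (b - a))) := by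
            rw [show -k * b = -k * a + -k * (b - a) by ring, Real.exp_add]; ring
        _ ≤ C * (4 * G) * 200000 := by gcongr
        _ ≤ _ := by nlinarith [mul_pos hC hG0]
    · intro y hy
      rw [Set.uIoc_of_le (by linarith)] at hy
      exact_mod_cast hnorm b y hab le_rfl hy.1.le hy.2
  have h0 := rectInt_eq_zero (f := gk x) (x0 := a) (x1 := b) (y0 := t0) (y1 := T) hab (by linarith) (by
    intro z hz _ _ _
    apply (gk_analyticAt hx0 _).differentiableAt
    intro m hm
    rw [hm] at hz
    simp at hz
    have : (0:ℝ) ≤ m := m.cast_nonneg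
    linarith)
  unfold rectInt at h0
  have e1 := hor t0 le_rfl (by linarith)
  have e2 := hor T (by linarith) le_rfl
  have e : (∫ y in t0..T, gk x (a + y * I)) = (∫ y in t0..T, gk x (b + y * I)) - I * ((∫ σ in a..b, gk x (σ + t0 * I)) - (∫ σ in a..b, gk x (σ + T * I))) := by
    have hI := I_mul_I
    linear_combination I * h0 + ((∫ y in t0..T, gk x (a + y * I)) - (∫ y in t0..T, gk x (b + y * I))) * hI
  rw [e]
  refine (norm_sub_le _ _).trans ?_
  rw [norm_mul, norm_I, one_mul]
  have e3 := norm_sub_le (∫ σ in a..b, gk x (σ + t0 * I)) (∫ σ in a..b, gk x (σ + T * I))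
  have hTD : 0 < T / D := by positivity
  have c1 := mul_pos hC hG0
  have c2 := mul_pos c1 hTD
  nlinarith

/-- the weight near the stationary point -/
noncomputable def wgt (T : ℝ) (N : ℕ) : ℝ :=
  if (N:ℝ) ≤ T then Real.sqrt T / (|(N:ℝ) - (⌊T / (2 * Real.pi)⌋₊ : ℝ)| + 1) else 0

lemma wgt_nonneg (T : ℝ) (N : ℕ) : 0 ≤ wgt T N := by
  unfold wgt; split_ifs <;> positivity

lemma rpow_log_aux {T : ℝ} (hT : 1000 ≤ T) : T ^ (1 + 1 / Real.log T - 1/2) ≤ 3 * Real.sqrt T := by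
  have hT0 : 0 < T := by linarith
  have hl : 0 < Real.log T := Real.log_pos (by linarith)
  rw [show 1 + 1 / Real.log T - 1/2 = 1/2 + 1 / Real.log T by ring, Real.rpow_add hT0, ← Real.sqrt_eq_rpow, mul_comm]
  gcongr
  rw [Real.rpow_def_of_pos hT0, mul_one_div_cancel hl.ne']
  linarith [Real.exp_one_lt_d9]

lemma wgt_lower {T : ℝ} (hT : 1000 ≤ T) (N : ℕ) (hN : (N:ℝ) ≤ T) {d : ℝ} (hd : |2 * Real.pi * N - T| ≤ d)
    (hd2 : Real.sqrt T ≤ d) : Real.sqrt T / d ≤ wgt T N := by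
  have hT0 : 0 < T := by linarith
  have hpi := Real.pi_gt_three
  have hv : 30 ≤ Real.sqrt T := Real.le_sqrt_of_sq_le (by norm_num; linarith)
  rw [wgt, if_pos hN]
  gcongr
  have h1 := Nat.floor_le (a := T / (2 * Real.pi)) (by positivity)
  have h2 := Nat.lt_floor_add_one (T / (2 * Real.pi))
  set M := (⌊T / (2 * Real.pi)⌋₊ : ℝ)
  have e : |(N:ℝ) - T / (2 * Real.pi)| ≤ d / 6 := by
    have : (N:ℝ) - T / (2 * Real.pi) = (2 * Real.pi * N - T) / (2 * Real.pi) := by field_simp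
    rw [this, abs_div, abs_of_pos (by positivity : 0 < 2 * Real.pi)]
    exact div_le_div₀ (le_trans (abs_nonneg _) hd) hd (by norm_num) (by linarith)
  have e2 : |(N:ℝ) - M| ≤ d / 6 + 1 := by
    rw [abs_le] at e ⊢
    constructor <;> linarith [e.1, e.2]
  linarith

lemma rpow_neg_le_inv {x a : ℝ} (hx : 1 ≤ x) (ha : 1 ≤ a) : x ^ (-a) ≤ 1 / x := by
  rw [one_div, ← Real.rpow_neg_one]
  apply Real.rpow_le_rpow_of_exponent_le hx; linarith

set_option maxHeartbeats 1000000 in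
lemma gonek : ∃ C > 0, ∀ (T t0 : ℝ) (N : ℕ), 1000 ≤ T → 2 ≤ t0 → t0 ≤ 3 → 1 ≤ N →
    ‖(∫ y in t0..T, gk (2 * Real.pi * N) (((1 + 1 / Real.log T : ℝ) : ℂ) + y * I)) -
      (if 2 * Real.pi * N ≤ T then 2 * Real.pi else 0 : ℂ)‖ ≤
      C * (Real.sqrt T * (N:ℝ) ^ (-(1 + 1 / Real.log T)) + wgt T N) := by
  obtain ⟨C1, hC1, hL⟩ := gonek_left
  obtain ⟨C2, hC2, hRt⟩ := gonek_right
  obtain ⟨C3, hC3, hg⟩ := gk_left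
  refine ⟨100 * (C1 + C2 + C3) + 7, by positivity, fun T t0 N hT h2 h3 hN => ?_⟩
  have hT0 : 0 < T := by linarith
  have hpi := Real.pi_gt_three
  have hpi4 := Real.pi_lt_d2
  have hv : 30 ≤ Real.sqrt T := Real.le_sqrt_of_sq_le (by norm_num; linarith)
  have hvv : Real.sqrt T * Real.sqrt T = T := Real.mul_self_sqrt hT0.le
  have hl : 2 ≤ Real.log T := by
    rw [Real.le_log_iff_exp_le hT0]
    have : Real.exp 2 = Real.exp 1 * Real.exp 1 := by rw [← Real.exp_add]; norm_num
    nlinarith [Real.exp_one_lt_d9, Real.exp_pos 1]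
  have hTa := rpow_log_aux hT
  have hT2a : (2 * T) ^ (1 + 1 / Real.log T - 1/2) ≤ 6 * Real.sqrt T := by
    rw [Real.mul_rpow (by norm_num) hT0.le]
    have : (2:ℝ) ^ (1 + 1 / Real.log T - 1/2) ≤ 2 ^ (1:ℝ) := by
      apply Real.rpow_le_rpow_of_exponent_le (by norm_num)
      have : 1 / Real.log T ≤ 1 / 2 := by gcongr
      linarith
    rw [Real.rpow_one] at this
    calc _ ≤ 2 * (3 * Real.sqrt T) := by gcongr
      _ = _ := by ring
  have ha1 : 1 ≤ 1 + 1 / Real.log T := by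
    have : 0 < 1 / Real.log T := by positivity
    linarith
  have ha2 : 1 + 1 / Real.log T ≤ 3/2 := by
    have : 1 / Real.log T ≤ 1 / 2 := by gcongr
    linarith
  set a := 1 + 1 / Real.log T with ha
  set v := Real.sqrt T with hvdef
  have hN' : (1:ℝ) ≤ N := by exact_mod_cast hN
  have hx6 : 6 * (N:ℝ) ≤ 2 * Real.pi * N := by nlinarith
  have hx0 : 0 < 2 * Real.pi * N := by positivity
  have hxN : (2 * Real.pi * N) ^ (-a) ≤ (N:ℝ) ^ (-a) := by
    apply Real.rpow_le_rpow_of_nonpos <;> linarith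
  have hxinv := rpow_neg_le_inv (x := 2 * Real.pi * N) (a := a) (by linarith) ha1
  have hw0 := wgt_nonneg T N
  have hNa : 0 < (N:ℝ) ^ (-a) := by positivity
  have hwl := @wgt_lower T hT N
  set x := 2 * Real.pi * N with hxdef
  -- general treatment of the off-diagonal bound
  have hoff : ∀ D : ℝ, ∀ C : ℝ, 0 < C → v ≤ D → D = |x - T| →
      C * (T ^ (a - 1/2) * x ^ (-a)) * (1 + T / D) ≤ 100 * C * (v * (N:ℝ) ^ (-a) + wgt T N) := by
    intro D C hC hvD hD
    have hD0 : 0 < D := by linarith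
    rcases le_total (T / 2) D with hc | hc
    · have : T / D ≤ 2 := by rw [div_le_iff₀ hD0]; linarith
      calc _ ≤ C * ((3 * v) * (N:ℝ) ^ (-a)) * (1 + 2) := by gcongr
        _ ≤ _ := by
          have := mul_pos hC (mul_pos (by linarith : 0 < v) hNa)
          have := mul_nonneg hC.le hw0
          nlinarith
    · have h1 : T / 2 ≤ x ∧ x ≤ 3 / 2 * T := by
        have := abs_le.mp (le_of_eq hD.symm)
        constructor <;> linarith
      have h2 : x ^ (-a) ≤ 2 / T := by
        refine hxinv.trans ?_
        rw [div_le_div_iff₀ hx0 hT0]; linarith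
      have h3 : 1 ≤ T / D := by rw [le_div_iff₀ hD0]; linarith
      have h4 := hwl (by linarith) hD.symm.le hvD
      calc _ ≤ C * ((3 * v) * (2 / T)) * (T / D + T / D) := by gcongr
        _ = 12 * C * (v / D) := by field_simp; ring
        _ ≤ 12 * C * wgt T N := by gcongr
        _ ≤ _ := by
          have := mul_pos hC (mul_pos (by linarith : 0 < v) hNa)
          have := mul_nonneg hC.le hw0
          nlinarith
  have hE0 : 0 ≤ v * (N:ℝ) ^ (-a) + wgt T N := by positivity
  rcases le_total v (|x - T|) with hc | hc
  · rcases le_or_gt x T with hxT | hxT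
    · rw [if_pos hxT]
      rw [abs_of_nonpos (by linarith)] at hc
      have := hL a T t0 N ha1 ha2 (by linarith) h2 h3 hN (by linarith)
      refine this.trans ?_
      have := hoff (T - x) C1 hC1 (by linarith) (by rw [abs_of_nonpos (by linarith)]; ring)
      refine this.trans ?_
      gcongr; linarith
    · rw [if_neg (by linarith), sub_zero]
      rw [abs_of_pos (by linarith)] at hc
      have hu : 2 ≤ Real.sqrt v := Real.le_sqrt_of_sq_le (by norm_num; linarith)
      have huu : Real.sqrt v ^ 2 = v := Real.sq_sqrt (by linarith)
      have := hRt a T t0 (Real.sqrt v) x ha1 ha2 hu (by rw [show Real.sqrt v ^ 4 = (Real.sqrt v ^ 2) * (Real.sqrt v ^ 2) by ring, huu, hvv]) h2 h3 (by rw [huu]; linarith)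
      refine this.trans ?_
      have := hoff (x - T) C2 hC2 (by linarith) (by rw [abs_of_pos (by linarith)])
      refine this.trans ?_
      gcongr; linarith
  · have hc' := abs_le.mp hc
    have hTv : v * 30 ≤ T := by nlinarith
    have hw1 := hwl (by linarith) hc le_rfl
    rw [div_self (by linarith)] at hw1
    have hx2 : x ^ (-a) ≤ 2 / T := by
      refine hxinv.trans ?_
      rw [div_le_div_iff₀ hx0 hT0]; linarith
    set T' := T + 4 * v with hT'
    have hT'2 : T' ≤ 2 * T := by linarith
    have hT'a : T' ^ (a - 1/2) ≤ 6 * v := le_trans (by gcongr; linarith) hT2a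
    have b1 := hL a T' t0 N ha1 ha2 (by linarith) h2 h3 hN (by linarith)
    have hd : 3 * v ≤ T' - x := by linarith
    have hv0 : 0 < v := by linarith
    have hT'0 : 0 < T' := by linarith
    have hTx0 : 0 < T' - x := by linarith
    have b1' : ‖(∫ y in t0..T', gk x (a + y * I)) - 2 * Real.pi‖ ≤ 12 * C1 := by
      refine b1.trans ?_
      calc _ ≤ C1 * ((6 * v) * (2 / T)) * (1 + 2 * T / (3 * v)) := by gcongr
        _ = C1 * (12 * (v / T) + 8) := by field_simp; ring
        _ ≤ C1 * (12 * (1 / 30) + 8) := by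
            have : v / T ≤ 1 / 30 := by rw [div_le_div_iff₀ hT0 (by norm_num)]; linarith
            exact mul_le_mul_of_nonneg_left (by linarith) hC1.le
        _ ≤ _ := by linarith
    have b2 : ‖∫ y in T..T', gk x (a + y * I)‖ ≤ 48 * C3 := by
      have := intervalIntegral.norm_integral_le_of_norm_le_const (a := T) (b := T')
        (f := fun y : ℝ => gk x (a + y * I)) (C := C3 * (6 * v) * (2 / T)) ?_
      · refine this.trans ?_
        rw [show T' - T = 4 * v by rw [hT']; ring, abs_of_pos (by linarith)]
        have : C3 * (6 * v) * (2 / T) * (4 * v) = 48 * C3 * ((v * v) / T) := by ring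
        rw [this, hvv, div_self hT0.ne', mul_one]
      · intro y hy
        rw [Set.uIoc_of_le (by linarith)] at hy
        have g := hg x hx0 (a + y * I) (by simp; linarith) (by simp; rw [abs_of_pos (by linarith [hy.1])]; linarith [hy.1])
        simp only [add_re, ofReal_re, mul_re, I_re, mul_zero, ofReal_im, I_im, mul_one, sub_self, add_zero, add_im, mul_im, zero_add] at g
        rw [abs_of_pos (by linarith [hy.1])] at g
        refine g.trans ?_
        gcongr
        refine le_trans ?_ hT'a
        apply Real.rpow_le_rpow (by linarith [hy.1]) hy.2 (by linarith)
    have hsplit : (∫ y in t0..T, gk x (a + y * I)) + (∫ y in T..T', gk x (a + y * I)) = ∫ y in t0..T', gk x (a + y * I) := by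
      apply intervalIntegral.integral_add_adjacent_intervals
      · apply intervalIntegrable_vert (by linarith)
        intro y _ _; apply gk_continuousAt hx0; right; simp; linarith
      · apply intervalIntegrable_vert (by linarith)
        intro y _ _; apply gk_continuousAt hx0; right; simp; linarith
    have e : (∫ y in t0..T, gk x (a + y * I)) - (if x ≤ T then 2 * Real.pi else 0 : ℂ) =
        ((∫ y in t0..T', gk x (a + y * I)) - 2 * Real.pi) - (∫ y in T..T', gk x (a + y * I)) + (2 * Real.pi - (if x ≤ T then 2 * Real.pi else 0 : ℂ)) := by
      rw [← hsplit]; ring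
    have b3 : ‖(2 * Real.pi - (if x ≤ T then 2 * Real.pi else 0 : ℂ))‖ ≤ 7 := by
      split_ifs
      · simp
      · rw [sub_zero, norm_mul, Complex.norm_real, Complex.norm_ofNat, Real.norm_eq_abs, abs_of_pos Real.pi_pos]; linarith
    rw [e]
    refine (norm_add_le _ _).trans ?_
    refine (add_le_add (norm_sub_le _ _) le_rfl).trans ?_
    have hone : 1 ≤ v * (N:ℝ) ^ (-a) + wgt T N := by
      have : 0 < v * (N:ℝ) ^ (-a) := by positivity
      linarith
    calc _ ≤ 12 * C1 + 48 * C3 + 7 := add_le_add (add_le_add b1' b2) b3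
      _ ≤ (100 * (C1 + C2 + C3) + 7) * 1 := by linarith
      _ ≤ _ := by gcongr

lemma conj_two : (starRingEnd ℂ) 2 = 2 := Complex.conj_ofReal 2

lemma feK_mul_cpow {N : ℕ} (hN : 1 ≤ N) (w : ℂ) :
    feK w * (N:ℂ) ^ (-w) = (starRingEnd ℂ) (gk (2 * Real.pi * N) ((starRingEnd ℂ) w)) + gk (2 * Real.pi * N) w := by
  have hx0 : 0 < 2 * Real.pi * (N:ℝ) := by
    have : (1:ℝ) ≤ N := by exact_mod_cast hN
    have := Real.pi_pos
    positivity
  have harg : ((2 * Real.pi * (N:ℝ) : ℝ) : ℂ).arg ≠ Real.pi := by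
    rw [arg_ofReal_of_nonneg hx0.le]; exact Real.pi_pos.ne
  have e1 : (starRingEnd ℂ) (gk (2 * Real.pi * N) ((starRingEnd ℂ) w)) =
      Gamma w * ((2 * Real.pi * (N:ℝ) : ℝ) : ℂ) ^ (-w) * exp (I * Real.pi * w / 2) := by
    unfold gk
    rw [map_mul, map_mul, Gamma_conj, Complex.conj_conj, ← Complex.exp_conj]
    congr 2
    · rw [← map_neg, cpow_conj _ _ harg, Complex.conj_conj, Complex.conj_ofReal]
    · simp only [map_neg, map_div₀, map_mul, conj_I, conj_ofReal, Complex.conj_conj, conj_two]; ring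
  rw [e1]
  unfold gk feK
  have e2 : ((2 * Real.pi * (N:ℝ) : ℝ) : ℂ) ^ (-w) = (2 * (Real.pi:ℂ)) ^ (-w) * (N:ℂ) ^ (-w) := by
    have := Complex.mul_cpow_ofReal_nonneg (a := 2 * Real.pi) (b := N) (by positivity) (by positivity) (-w)
    push_cast at this ⊢
    exact this
  rw [e2, Complex.cos]
  rw [show (Real.pi:ℂ) * w / 2 * I = I * Real.pi * w / 2 by ring, show -((Real.pi:ℂ) * w / 2) * I = -(I * Real.pi * w / 2) by ring]
  ring

set_option maxHeartbeats 1000000 in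
lemma gonekK : ∃ C > 0, ∀ (T t0 : ℝ) (N : ℕ), 1000 ≤ T → 2 ≤ t0 → t0 ≤ 3 → 1 ≤ N →
    ‖(∫ y in t0..T, feK (((1 + 1 / Real.log T : ℝ) : ℂ) - y * I) * (N:ℂ) ^ (-(((1 + 1 / Real.log T : ℝ) : ℂ) - y * I))) -
      (if 2 * Real.pi * N ≤ T then 2 * Real.pi else 0 : ℂ)‖ ≤
      C * (Real.sqrt T * (N:ℝ) ^ (-(1 + 1 / Real.log T)) + wgt T N) := by
  obtain ⟨C1, hC1, hG⟩ := gonek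
  obtain ⟨M, hM, hGa⟩ := Gamma_bdd
  refine ⟨C1 + M, by positivity, fun T t0 N hT h2 h3 hN => ?_⟩
  have g := hG T t0 N hT h2 h3 hN
  have hT0 : 0 < T := by linarith
  have hpi := Real.pi_gt_three
  have hv : 30 ≤ Real.sqrt T := Real.le_sqrt_of_sq_le (by norm_num; linarith)
  have hl : 2 ≤ Real.log T := by
    rw [Real.le_log_iff_exp_le hT0]
    have : Real.exp 2 = Real.exp 1 * Real.exp 1 := by rw [← Real.exp_add]; norm_num
    nlinarith [Real.exp_one_lt_d9, Real.exp_pos 1]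
  have ha1 : 1 ≤ 1 + 1 / Real.log T := by
    have : 0 < 1 / Real.log T := by positivity
    linarith
  have ha2 : 1 + 1 / Real.log T ≤ 3/2 := by
    have : 1 / Real.log T ≤ 1 / 2 := by gcongr
    linarith
  set a := 1 + 1 / Real.log T with ha
  have hN' : (1:ℝ) ≤ N := by exact_mod_cast hN
  have hx6 : 6 * (N:ℝ) ≤ 2 * Real.pi * N := by nlinarith
  have hx0 : 0 < 2 * Real.pi * N := by positivity
  have hxN : (2 * Real.pi * N) ^ (-a) ≤ (N:ℝ) ^ (-a) := by
    apply Real.rpow_le_rpow_of_nonpos <;> linarith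
  set x := 2 * Real.pi * N with hxdef
  have hNa : 0 < (N:ℝ) ^ (-a) := by positivity
  have hw0 := wgt_nonneg T N
  have e1 : ∀ y : ℝ, feK ((a:ℂ) - y * I) * (N:ℂ) ^ (-((a:ℂ) - y * I)) =
      (starRingEnd ℂ) (gk x (a + y * I)) + gk x (a + ((-y : ℝ):ℂ) * I) := by
    intro y
    rw [feK_mul_cpow hN]
    congr 2
    · simp [hxdef]
    · push_cast; ring
  have hI1 : IntervalIntegrable (fun y : ℝ => gk x (a + y * I)) MeasureTheory.volume t0 T := by
    apply intervalIntegrable_vert (by linarith)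
    intro y _ _; apply gk_continuousAt hx0; right; simp; linarith
  have hI2 : IntervalIntegrable (fun y : ℝ => gk x (a + ((-y:ℝ):ℂ) * I)) MeasureTheory.volume t0 T := by
    apply ContinuousOn.intervalIntegrable
    intro y _
    apply ContinuousAt.continuousWithinAt
    have := gk_continuousAt hx0 (s := (a + ((-y:ℝ):ℂ) * I)) (by right; simp; linarith)
    exact ContinuousAt.comp (f := fun y : ℝ => (a + ((-y:ℝ):ℂ) * I)) this (by fun_prop)
  have hI1c : IntervalIntegrable (fun y : ℝ => (starRingEnd ℂ) (gk x (a + y * I))) MeasureTheory.volume t0 T := by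
    apply ContinuousOn.intervalIntegrable
    intro y _
    apply ContinuousAt.continuousWithinAt
    have := gk_continuousAt hx0 (s := (a + (y:ℂ) * I)) (by right; simp; linarith)
    have := ContinuousAt.comp (f := fun y : ℝ => (a + (y:ℂ) * I)) this (by fun_prop)
    exact Complex.continuous_conj.continuousAt.comp this
  have hsmall : ‖∫ y in t0..T, gk x (a + ((-y:ℝ):ℂ) * I)‖ ≤ M * (N:ℝ) ^ (-a) := by
    have hb : ‖∫ y in t0..T, gk x (a + ((-y:ℝ):ℂ) * I)‖ ≤ ∫ y in t0..T, M * (N:ℝ) ^ (-a) * Real.exp (-y) := by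
      apply intervalIntegral.norm_integral_le_of_norm_le (by linarith)
      · filter_upwards with y hy
        rw [gk_norm hx0]
        simp only [add_re, ofReal_re, mul_re, I_re, mul_zero, ofReal_im, I_im, mul_one, sub_self, add_zero, add_im, mul_im, zero_add]
        have h1 : ‖Gamma (a + ((-y:ℝ):ℂ) * I)‖ ≤ M := by
          refine (norm_Gamma_le_Gamma_re (by simp; linarith)).trans ?_
          simp only [add_re, ofReal_re, mul_re, I_re, mul_zero, ofReal_im, I_im, mul_one, sub_self, add_zero]
          exact hGa a ha1 ha2
        have h2 : Real.exp (Real.pi * (-y) / 2) ≤ Real.exp (-y) := by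
          apply Real.exp_le_exp.mpr
          nlinarith [hy.1]
        gcongr
      · apply Continuous.intervalIntegrable; fun_prop
    refine hb.trans ?_
    rw [intervalIntegral.integral_const_mul]
    have : ∫ y in t0..T, Real.exp (-y) = Real.exp (-t0) - Real.exp (-T) := by
      rw [intervalIntegral.integral_comp_neg (fun y => Real.exp y), integral_exp]
    rw [this]
    have h1 : Real.exp (-t0) ≤ 1 := Real.exp_le_one_iff.mpr (by linarith)
    have h2 := Real.exp_pos (-T)
    have : 0 < M * (N:ℝ) ^ (-a) := by positivity
    nlinarith
  rw [intervalIntegral.integral_congr (g := fun y : ℝ => (starRingEnd ℂ) (gk x (a + y * I)) + gk x (a + ((-y : ℝ):ℂ) * I)) (fun y _ => e1 y)]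
  rw [intervalIntegral.integral_add hI1c hI2, intervalIntegral.intervalIntegral_conj]
  have e2 : (starRingEnd ℂ) (∫ y in t0..T, gk x (a + y * I)) - (if x ≤ T then 2 * Real.pi else 0 : ℂ) =
      (starRingEnd ℂ) ((∫ y in t0..T, gk x (a + y * I)) - (if x ≤ T then 2 * Real.pi else 0 : ℂ)) := by
    rw [map_sub]; congr 1
    split_ifs <;> simp [conj_two]
  rw [add_sub_right_comm, e2]
  refine (norm_add_le _ _).trans ?_
  rw [RCLike.norm_conj]
  have : M * (N:ℝ) ^ (-a) ≤ M * (Real.sqrt T * (N:ℝ) ^ (-a) + wgt T N) := by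
    gcongr
    nlinarith
  linarith

lemma tsum_rpow_le : ∃ C > 0, ∀ η : ℝ, 0 < η → η ≤ 1/4 →
    Summable (fun N : ℕ => (N:ℝ) ^ (-(1 + η))) ∧ ∑' N : ℕ, (N:ℝ) ^ (-(1 + η)) ≤ C / η := by
  obtain ⟨C, hC, h⟩ := zeta_right
  refine ⟨C, hC, fun η h1 h2 => ?_⟩
  have hs : Summable (fun N : ℕ => (N:ℝ) ^ (-(1 + η))) := Real.summable_nat_rpow.mpr (by linarith)
  refine ⟨hs, ?_⟩
  have g := h η ((1 + η : ℝ) : ℂ) h1 h2 (by simp)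
  rw [zeta_eq_tsum_one_div_nat_cpow (by simp; linarith)] at g
  have e : (∑' n : ℕ, 1 / (n : ℂ) ^ (((1 + η : ℝ)) : ℂ)) = ((∑' N : ℕ, (N:ℝ) ^ (-(1 + η)) : ℝ) : ℂ) := by
    rw [Complex.ofReal_tsum]
    congr 1
    ext n
    rw [Complex.ofReal_cpow (by positivity), one_div, ← Complex.cpow_neg]
    push_cast; rfl
  rw [e, Complex.norm_real, Real.norm_eq_abs] at g
  exact (le_abs_self _).trans g

lemma sum_log_pow (k : ℕ) : ∃ C > 0, ∀ L : ℝ, 2 ≤ L →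
    Summable (fun N : ℕ => Real.log N ^ k * (N:ℝ) ^ (-(1 + 1 / L))) ∧
      ∑' N : ℕ, Real.log N ^ k * (N:ℝ) ^ (-(1 + 1 / L)) ≤ C * L ^ (k + 1) := by
  obtain ⟨C, hC, h⟩ := tsum_rpow_le
  refine ⟨(k.factorial : ℝ) * 2 ^ k * (C * 2), by positivity, fun L hL => ?_⟩
  obtain ⟨hs, ht⟩ := h (1 / (2 * L)) (by positivity) (by rw [div_le_div_iff₀ (by positivity) (by norm_num)]; linarith)
  have hle : ∀ N : ℕ, Real.log N ^ k * (N:ℝ) ^ (-(1 + 1 / L)) ≤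
      ((k.factorial : ℝ) * (2 * L) ^ k) * (N:ℝ) ^ (-(1 + 1 / (2 * L))) := by
    intro N
    rcases Nat.eq_zero_or_pos N with rfl | hN
    · have : -(1 + 1 / L) ≠ 0 := by
        have : 0 < 1 / L := by positivity
        linarith
      rw [Nat.cast_zero, Real.zero_rpow this, mul_zero]
      positivity
    · have hN' : (0:ℝ) < N := by exact_mod_cast hN
      have hN1 : (1:ℝ) ≤ N := by exact_mod_cast hN
      have hlog : 0 ≤ Real.log N := Real.log_nonneg hN1
      have := Real.pow_div_factorial_le_exp (x := Real.log N / (2 * L)) (by positivity) k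
      rw [div_pow, div_div, div_le_iff₀ (by positivity)] at this
      have e : (N:ℝ) ^ (-(1 + 1 / (2 * L))) = Real.exp (Real.log N / (2 * L)) * (N:ℝ) ^ (-(1 + 1 / L)) := by
        rw [show Real.log N / (2 * L) = Real.log N * (1 / (2 * L)) by ring, ← Real.rpow_def_of_pos hN', ← Real.rpow_add hN']
        congr 1
        field_simp; ring
      rw [e]
      calc _ ≤ (Real.exp (Real.log N / (2 * L)) * ((2 * L) ^ k * k.factorial)) * (N:ℝ) ^ (-(1 + 1 / L)) := by gcongr
        _ = _ := by ring
  have hnn : ∀ N : ℕ, 0 ≤ Real.log N ^ k * (N:ℝ) ^ (-(1 + 1 / L)) := by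
    intro N
    have := Real.log_natCast_nonneg N
    positivity
  have hs2 := hs.mul_left ((k.factorial : ℝ) * (2 * L) ^ k)
  have hs3 := Summable.of_nonneg_of_le hnn hle hs2
  refine ⟨hs3, (hs3.tsum_le_tsum hle hs2).trans ?_⟩
  rw [tsum_mul_left]
  calc _ ≤ ((k.factorial : ℝ) * (2 * L) ^ k) * (C / (1 / (2 * L))) := by gcongr
    _ = _ := by rw [mul_pow]; field_simp; ring

lemma harm_le (K : ℕ) : ∑ i ∈ Finset.range K, 1 / ((i:ℝ) + 1) ≤ 1 + Real.log K := by
  have := harmonic_le_one_add_log K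
  rw [harmonic] at this
  push_cast at this
  simpa [one_div] using this

lemma sum_inv_dist (K M : ℕ) (hM : M ≤ K) :
    ∑ N ∈ Finset.range (K + 1), 1 / (|(N:ℝ) - M| + 1) ≤ 2 * (1 + Real.log (K + 1)) := by
  have h1 : ∑ N ∈ Finset.range (M + 1), 1 / (|(N:ℝ) - M| + 1) ≤ 1 + Real.log (K + 1) := by
    rw [← Finset.sum_range_reflect]
    have : ∀ j ∈ Finset.range (M + 1), 1 / (|((M + 1 - 1 - j : ℕ):ℝ) - M| + 1) = 1 / ((j:ℝ) + 1) := by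
      intro j hj
      have hj' : j ≤ M := by simp at hj; omega
      rw [Nat.add_sub_cancel, Nat.cast_sub hj', show (M:ℝ) - j - M = -j by ring, abs_neg, abs_of_nonneg (by positivity)]
    rw [Finset.sum_congr rfl this]
    refine (harm_le _).trans ?_
    push_cast
    gcongr
  obtain ⟨d, rfl⟩ := Nat.exists_eq_add_of_le hM
  rw [show M + d + 1 = (M + 1) + d by ring, Finset.sum_range_add]
  have h2 : ∑ x ∈ Finset.range d, 1 / (|((M + 1 + x : ℕ):ℝ) - M| + 1) ≤ 1 + Real.log (↑(M + d) + 1) := by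
    calc _ ≤ ∑ x ∈ Finset.range d, 1 / ((x:ℝ) + 1) := by
          apply Finset.sum_le_sum
          intro x _
          push_cast
          rw [show (M:ℝ) + 1 + x - M = x + 1 by ring, abs_of_nonneg (by positivity)]
          gcongr
          linarith
      _ ≤ 1 + Real.log d := harm_le _
      _ ≤ _ := by
          rcases Nat.eq_zero_or_pos d with rfl | hd
          · have : 0 ≤ Real.log (↑(M + 0) + 1) := Real.log_nonneg (by simp)
            simpa using this
          · push_cast
            have : (0:ℝ) < d := by exact_mod_cast hd
            gcongr
            have : (0:ℝ) ≤ M := by positivity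
            linarith
  linarith

lemma sum_wgt (k : ℕ) {T : ℝ} (hT : 1000 ≤ T) :
    Summable (fun N : ℕ => Real.log N ^ k * wgt T N) ∧
      ∑' N : ℕ, Real.log N ^ k * wgt T N ≤ 6 * (Real.sqrt T * Real.log T ^ (k + 1)) := by
  have hT0 : 0 < T := by linarith
  have hpi := Real.pi_gt_three
  have hl : 1 ≤ Real.log T := by
    rw [Real.le_log_iff_exp_le hT0]
    linarith [Real.exp_one_lt_d9]
  have hz : ∀ N ∉ Finset.range (⌊T⌋₊ + 1), Real.log N ^ k * wgt T N = 0 := by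
    intro N hN
    have : ¬ (N:ℝ) ≤ T := by
      intro h; apply hN; simp; have := Nat.le_floor h; omega
    rw [wgt, if_neg this, mul_zero]
  have hM : ⌊T / (2 * Real.pi)⌋₊ ≤ ⌊T⌋₊ := by
    apply Nat.floor_le_floor
    apply div_le_self hT0.le; linarith
  refine ⟨summable_of_ne_finset_zero hz, ?_⟩
  rw [tsum_eq_sum hz]
  calc _ ≤ ∑ N ∈ Finset.range (⌊T⌋₊ + 1), Real.log T ^ k * Real.sqrt T * (1 / (|(N:ℝ) - ⌊T / (2 * Real.pi)⌋₊| + 1)) := by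
        apply Finset.sum_le_sum
        intro N hN
        have hNT : (N:ℝ) ≤ T := by
          have : N ≤ ⌊T⌋₊ := by simp at hN; omega
          exact (Nat.cast_le.mpr this).trans (Nat.floor_le hT0.le)
        rw [wgt, if_pos hNT, mul_assoc, mul_one_div]
        have := Real.log_natCast_nonneg N
        have hle : Real.log N ≤ Real.log T := by
          rcases Nat.eq_zero_or_pos N with rfl | h
          · simp; linarith
          · exact Real.log_le_log (by exact_mod_cast h) hNT
        have hle2 := pow_le_pow_left₀ this hle k
        exact mul_le_mul_of_nonneg_right hle2 (by positivity)
    _ = Real.log T ^ k * Real.sqrt T * ∑ N ∈ Finset.range (⌊T⌋₊ + 1), (1 / (|(N:ℝ) - ⌊T / (2 * Real.pi)⌋₊| + 1)) := by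
        rw [Finset.mul_sum]
    _ ≤ Real.log T ^ k * Real.sqrt T * (6 * Real.log T) := by
        gcongr
        refine (sum_inv_dist _ _ hM).trans ?_
        have : Real.log (⌊T⌋₊ + 1) ≤ Real.log T + 1 := by
          have h1 : (⌊T⌋₊ : ℝ) + 1 ≤ T * Real.exp 1 := by
            have := Nat.floor_le hT0.le
            have := Real.add_one_le_exp 1
            nlinarith
          have h2 := Real.log_le_log (by positivity) h1
          rwa [Real.log_mul hT0.ne' (Real.exp_pos 1).ne', Real.log_exp] at h2
        linarith
    _ = _ := by ring

lemma left_main (k : ℕ) : ∃ C > 0, ∀ (T t0 : ℝ) (b : ℕ → ℂ), 1000 ≤ T → 2 ≤ t0 → t0 ≤ 3 → b 0 = 0 →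
    (∀ N, ‖b N‖ ≤ Real.log N ^ k) →
    ‖(∫ y in t0..T, feK (((1 + 1 / Real.log T : ℝ) : ℂ) - y * I) * LSeries b (((1 + 1 / Real.log T : ℝ) : ℂ) - y * I)) -
      2 * Real.pi * ∑ N ∈ Finset.Icc 1 ⌊T / (2 * Real.pi)⌋₊, b N‖ ≤ C * (Real.sqrt T * Real.log T ^ (k + 1)) := by
  obtain ⟨C1, hC1, hG⟩ := gonekK
  obtain ⟨C2, hC2, hS⟩ := sum_log_pow k
  refine ⟨C1 * (C2 + 6), by positivity, fun T t0 b hT h2 h3 hb0 hb => ?_⟩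
  have hT0 : 0 < T := by linarith
  have hpi := Real.pi_gt_three
  have hl : 2 ≤ Real.log T := by
    rw [Real.le_log_iff_exp_le hT0]
    have : Real.exp 2 = Real.exp 1 * Real.exp 1 := by rw [← Real.exp_add]; norm_num
    nlinarith [Real.exp_one_lt_d9, Real.exp_pos 1]
  obtain ⟨hs1, ht1⟩ := hS (Real.log T) hl
  obtain ⟨hs2, ht2⟩ := sum_wgt k hT
  have hG' := fun N => hG T t0 N hT h2 h3
  set a := 1 + 1 / Real.log T with ha
  have ha1 : 1 < a := by
    have : 0 < 1 / Real.log T := by positivity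
    linarith
  have hterm : ∀ (y : ℝ) (N : ℕ), ‖LSeries.term b ((a:ℂ) - y * I) N‖ ≤ Real.log N ^ k * (N:ℝ) ^ (-a) := by
    intro y N
    rw [LSeries.norm_term_eq]
    split_ifs with h
    · rw [h, Nat.cast_zero, Real.zero_rpow (by linarith), mul_zero]
    · simp only [sub_re, ofReal_re, mul_re, I_re, mul_zero, ofReal_im, I_im, mul_one, sub_self, sub_zero]
      rw [Real.rpow_neg (by positivity), ← div_eq_mul_inv]
      gcongr
      exact hb N
  -- bound for feK on the segment
  have hcont : ContinuousOn (fun y : ℝ => feK ((a:ℂ) - y * I)) (Set.Icc t0 T) := by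
    intro y hy
    apply ContinuousAt.continuousWithinAt
    have := (differentiableAt_feK (w := (a:ℂ) - y * I) (by simp; linarith [hy.1])).continuousAt
    exact ContinuousAt.comp (f := fun y : ℝ => (a:ℂ) - y * I) this (by fun_prop)
  obtain ⟨B, hB⟩ := isCompact_Icc.exists_bound_of_continuousOn hcont
  have hB0 : 0 ≤ B := (norm_nonneg _).trans (hB t0 ⟨le_rfl, by linarith⟩)
  have hsum : HasSum (fun N : ℕ => ∫ y in t0..T, feK ((a:ℂ) - y * I) * LSeries.term b ((a:ℂ) - y * I) N)
      (∫ y in t0..T, feK ((a:ℂ) - y * I) * LSeries b ((a:ℂ) - y * I)) := by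
    refine intervalIntegral.hasSum_integral_of_dominated_convergence (ι := ℕ)
      (F := fun N y => feK ((a:ℂ) - y * I) * LSeries.term b ((a:ℂ) - y * I) N)
      (f := fun y : ℝ => feK ((a:ℂ) - y * I) * LSeries b ((a:ℂ) - y * I))
      (bound := fun N _ => B * (Real.log N ^ k * (N:ℝ) ^ (-a))) ?_ ?_ ?_ ?_ ?_
    · intro N
      rw [Set.uIoc_of_le (by linarith)]
      apply ContinuousOn.aestronglyMeasurable _ measurableSet_Ioc
      apply ContinuousOn.mul (hcont.mono Set.Ioc_subset_Icc_self)
      apply Continuous.continuousOn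
      rw [show (fun y : ℝ => LSeries.term b ((a:ℂ) - y * I) N) = fun y : ℝ => b N * (N:ℂ) ^ (-((a:ℂ) - y * I)) from
        funext fun y => LSeries.term_def₀ hb0 _ _]
      rcases Nat.eq_zero_or_pos N with rfl | h
      · simp [hb0]; exact continuous_const
      · have : (N:ℂ) ≠ 0 := by exact_mod_cast h.ne'
        apply Continuous.mul continuous_const
        apply Continuous.const_cpow (by fun_prop) (Or.inl this)
    · intro N
      filter_upwards with y hy
      rw [Set.uIoc_of_le (by linarith)] at hy
      rw [norm_mul]
      have := hterm y N
      have := hB y ⟨hy.1.le, hy.2⟩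
      gcongr
    · filter_upwards with y _
      exact hs1.mul_left B
    · exact intervalIntegrable_const
    · filter_upwards with y _
      apply HasSum.mul_left
      apply Summable.hasSum
      exact Summable.of_norm_bounded hs1 (hterm y)
  have hmain : HasSum (fun N : ℕ => b N * (if 2 * Real.pi * N ≤ T then 2 * Real.pi else 0 : ℂ))
      (2 * Real.pi * ∑ N ∈ Finset.Icc 1 ⌊T / (2 * Real.pi)⌋₊, b N) := by
    have : 2 * (Real.pi:ℂ) * ∑ N ∈ Finset.Icc 1 ⌊T / (2 * Real.pi)⌋₊, b N =
        ∑ N ∈ Finset.Icc 1 ⌊T / (2 * Real.pi)⌋₊, b N * (if 2 * Real.pi * N ≤ T then 2 * Real.pi else 0 : ℂ) := by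
      rw [Finset.mul_sum]
      apply Finset.sum_congr rfl
      intro N hN
      rw [Finset.mem_Icc] at hN
      have h1 := (Nat.le_floor_iff (by positivity)).mp hN.2
      rw [le_div_iff₀ (by positivity)] at h1
      rw [if_pos (by linarith)]; ring
    rw [this]
    apply hasSum_sum_of_ne_finset_zero
    intro N hN
    rcases Nat.eq_zero_or_pos N with rfl | h
    · simp [hb0]
    · rw [if_neg, mul_zero]
      intro h'
      apply hN
      rw [Finset.mem_Icc]
      refine ⟨h, Nat.le_floor ?_⟩
      rw [le_div_iff₀ (by positivity)]; linarith
  have hdiff := hsum.sub hmain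
  have hbd := ((hs1.hasSum.mul_left (Real.sqrt T)).add hs2.hasSum).mul_left C1
  refine (hdiff.norm_le_of_bounded hbd ?_).trans ?_
  · intro N
    rcases Nat.eq_zero_or_pos N with rfl | h
    · have := wgt_nonneg T 0
      have h0 : 0 ≤ Real.log ((0:ℕ):ℝ) := by simp
      simp only [LSeries.term_zero, hb0, mul_zero, zero_mul, intervalIntegral.integral_zero, sub_zero, norm_zero]
      positivity
    · have e : (∫ y in t0..T, feK ((a:ℂ) - y * I) * LSeries.term b ((a:ℂ) - y * I) N) =
          b N * ∫ y in t0..T, feK ((a:ℂ) - y * I) * (N:ℂ) ^ (-((a:ℂ) - y * I)) := by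
        rw [← intervalIntegral.integral_const_mul]
        congr 1; ext y
        rw [LSeries.term_def₀ hb0]; ring
      rw [e, ← mul_sub, norm_mul]
      have h0 := Real.log_natCast_nonneg N
      calc _ ≤ Real.log N ^ k * (C1 * (Real.sqrt T * (N:ℝ) ^ (-a) + wgt T N)) :=
            mul_le_mul (hb N) (hG' N h) (norm_nonneg _) (by positivity)
        _ = _ := by ring
  · calc _ ≤ C1 * (Real.sqrt T * (C2 * Real.log T ^ (k + 1)) + 6 * (Real.sqrt T * Real.log T ^ (k + 1))) := by gcongr
      _ = _ := by ring

noncomputable def lam (n : ℕ) : ℕ → ℂ := LSeries.logMul^[n] (fun r => (ArithmeticFunction.vonMangoldt r : ℂ))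

lemma lam_eq (n r : ℕ) : lam n r = ((ArithmeticFunction.vonMangoldt r * Real.log r ^ n : ℝ) : ℂ) := by
  induction n with
  | zero => simp [lam]
  | succ n ih =>
    have : lam (n + 1) r = Complex.log r * lam n r := by
      rw [lam, Function.iterate_succ', Function.comp_apply]; rfl
    rw [this, ih, ← Complex.natCast_log]
    push_cast; ring

lemma lam_succ (n : ℕ) : lam (n + 1) = LSeries.logMul (lam n) := by
  rw [lam, Function.iterate_succ', Function.comp_apply]; rfl

lemma lam_norm (n r : ℕ) : ‖lam n r‖ ≤ Real.log r ^ (n + 1) := by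
  have h0 := Real.log_natCast_nonneg r
  have h1 : 0 ≤ ArithmeticFunction.vonMangoldt r := ArithmeticFunction.vonMangoldt_nonneg
  rw [lam_eq, Complex.norm_real, Real.norm_eq_abs, abs_of_nonneg (by positivity), pow_succ, mul_comm]
  gcongr
  exact ArithmeticFunction.vonMangoldt_le_log

lemma lam_abscissa (n : ℕ) : LSeries.abscissaOfAbsConv (lam n) ≤ 1 := by
  rw [lam, LSeries.absicssaOfAbsConv_logPowMul]
  apply LSeries.abscissaOfAbsConv_le_of_forall_lt_LSeriesSummable
  intro y hy
  apply ArithmeticFunction.LSeriesSummable_vonMangoldt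
  simpa using hy

noncomputable def Hn (n : ℕ) (s : ℂ) : ℂ := LSeries (lam n) (1 - s)

lemma Hn_deriv (n : ℕ) {s : ℂ} (hs : s.re < 0) : HasDerivAt (Hn n) (Hn (n + 1) s) s := by
  have h : LSeries.abscissaOfAbsConv (lam n) < (1 - s).re := by
    refine (lam_abscissa n).trans_lt ?_
    have : (1:ℝ) < (1 - s).re := by simp; linarith
    exact_mod_cast this
  have h1 := LSeries_hasDerivAt h
  have h2 : HasDerivAt (fun z : ℂ => 1 - z) (-1) s := (hasDerivAt_id s).const_sub 1
  have := h1.comp s h2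
  refine this.congr_deriv ?_
  rw [Hn, lam_succ]; ring

lemma Hn_zero {s : ℂ} (hs : s.re < 0) : Hn 0 s = - logDeriv riemannZeta (1 - s) := by
  rw [Hn, lam, Function.iterate_zero, id, ArithmeticFunction.LSeries_vonMangoldt_eq_deriv_riemannZeta_div (by simp; linarith), logDeriv_apply]
  ring

lemma Hn_bound (n : ℕ) : ∃ C > 0, ∀ (L : ℝ) (s : ℂ), 2 ≤ L → s.re = -1 / L → ‖Hn n s‖ ≤ C * L ^ (n + 2) := by
  obtain ⟨C, hC, h⟩ := sum_log_pow (n + 1)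
  refine ⟨C, hC, fun L s hL hs => ?_⟩
  obtain ⟨h1, h2⟩ := h L hL
  refine le_trans ?_ h2
  rw [Hn, LSeries]
  apply tsum_of_norm_bounded h1.hasSum
  intro N
  rw [LSeries.norm_term_eq]
  have hL0 : 0 < 1 / L := by positivity
  split_ifs with h0
  · rw [h0, Nat.cast_zero, Real.zero_rpow (by linarith), mul_zero]
  · rw [show (1 - s).re = 1 + 1 / L by rw [sub_re, hs, one_re]; ring, Real.rpow_neg (by positivity), ← div_eq_mul_inv]
    gcongr
    exact lam_norm n N

noncomputable def bcoef (n : ℕ) : ℕ → ℂ := LSeries.convolution (1 : ℕ → ℂ) (lam n)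

lemma bcoef_eq (n N : ℕ) : bcoef n N =
    ((∑ p ∈ N.divisorsAntidiagonal, ArithmeticFunction.vonMangoldt p.2 * Real.log p.2 ^ n : ℝ) : ℂ) := by
  rw [bcoef, LSeries.convolution_def]
  push_cast
  apply Finset.sum_congr rfl
  intro p _
  rw [lam_eq]; simp

lemma bcoef_zero (n : ℕ) : bcoef n 0 = 0 := by rw [bcoef_eq]; simp

lemma bcoef_norm (n N : ℕ) : ‖bcoef n N‖ ≤ Real.log N ^ (n + 1) := by
  rw [bcoef_eq, Complex.norm_real, Real.norm_eq_abs, abs_of_nonneg]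
  · calc _ ≤ ∑ p ∈ N.divisorsAntidiagonal, ArithmeticFunction.vonMangoldt p.2 * Real.log N ^ n := by
          apply Finset.sum_le_sum
          intro p hp
          have h1 : 0 ≤ ArithmeticFunction.vonMangoldt p.2 := ArithmeticFunction.vonMangoldt_nonneg
          have h0 := Real.log_natCast_nonneg p.2
          rw [Nat.mem_divisorsAntidiagonal] at hp
          have h2 : 0 < p.2 := by
            rcases Nat.eq_zero_or_pos p.2 with h | h
            · exfalso; apply hp.2; rw [← hp.1, h, mul_zero]
            · exact h
          have hle : p.2 ≤ N := Nat.le_of_dvd (Nat.pos_of_ne_zero hp.2) ⟨p.1, by rw [← hp.1]; ring⟩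
          have h3 : Real.log p.2 ≤ Real.log N := Real.log_le_log (by exact_mod_cast h2) (by exact_mod_cast hle)
          exact mul_le_mul_of_nonneg_left (pow_le_pow_left₀ h0 h3 n) h1
      _ = (∑ p ∈ N.divisorsAntidiagonal, ArithmeticFunction.vonMangoldt p.2) * Real.log N ^ n := by rw [Finset.sum_mul]
      _ = Real.log N * Real.log N ^ n := by
          rw [Nat.sum_divisorsAntidiagonal' (fun _ i => ArithmeticFunction.vonMangoldt i), ArithmeticFunction.vonMangoldt_sum]
      _ ≤ _ := by rw [pow_succ, mul_comm]
  · apply Finset.sum_nonneg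
    intro p _
    have h1 : 0 ≤ ArithmeticFunction.vonMangoldt p.2 := ArithmeticFunction.vonMangoldt_nonneg
    have h0 := Real.log_natCast_nonneg p.2
    positivity

lemma bcoef_LSeries (n : ℕ) {w : ℂ} (hw : 1 < w.re) :
    riemannZeta w * LSeries (lam n) w = LSeries (bcoef n) w := by
  rw [bcoef, LSeries_convolution', LSeries_one_eq_riemannZeta hw]
  · exact LSeriesSummable_one_iff.mpr hw
  · apply LSeriesSummable_of_abscissaOfAbsConv_lt_re
    exact (lam_abscissa n).trans_lt (by exact_mod_cast hw)

lemma bcoef_sum (n : ℕ) {Y : ℝ} (hY : 0 ≤ Y) : ∑ N ∈ Finset.Icc 1 ⌊Y⌋₊, bcoef n N = ((vonMangoldtPairSum n Y : ℝ) : ℂ) := by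
  rw [Finset.sum_congr rfl (fun N _ => bcoef_eq n N), ← Complex.ofReal_sum]
  congr 1
  rw [vonMangoldtPairSum, ← Finset.sum_fiberwise_of_maps_to (t := Finset.Icc 1 ⌊Y⌋₊) (g := fun p : ℕ × ℕ => p.1 * p.2)]
  · apply Finset.sum_congr rfl
    intro N hN
    apply Finset.sum_congr _ (fun _ _ => rfl)
    ext p
    simp only [Nat.mem_divisorsAntidiagonal, Finset.mem_filter, Finset.mem_product, Finset.mem_Icc] at hN ⊢
    constructor
    · rintro ⟨h1, h2⟩
      have hp1 : p.1 ≠ 0 := by rintro h; rw [h] at h1; simp at h1; omega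
      have hp2 : p.2 ≠ 0 := by rintro h; rw [h] at h1; simp at h1; omega
      have a1 : p.1 ≤ p.1 * p.2 := Nat.le_mul_of_pos_right _ (Nat.pos_of_ne_zero hp2)
      have a2 : p.2 ≤ p.1 * p.2 := Nat.le_mul_of_pos_left _ (Nat.pos_of_ne_zero hp1)
      refine ⟨⟨⟨⟨by omega, by omega⟩, ⟨by omega, by omega⟩⟩, ?_⟩, h1⟩
      rw [← Nat.cast_mul, h1]
      exact (Nat.le_floor_iff hY).mp hN.2
    · rintro ⟨⟨h1, h2⟩, h3⟩
      exact ⟨h3, by omega⟩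
  · intro p hp
    simp only [Finset.mem_filter, Finset.mem_product, Finset.mem_Icc] at hp ⊢
    refine ⟨Nat.mul_pos (by omega) (by omega), Nat.le_floor ?_⟩
    push_cast; exact hp.2

lemma ibp_vert {u u' v v' : ℂ → ℂ} {c t0 T : ℝ} (h : t0 ≤ T)
    (hu : ∀ y : ℝ, t0 ≤ y → y ≤ T → HasDerivAt u (u' (c + y * I)) (c + y * I))
    (hv : ∀ y : ℝ, t0 ≤ y → y ≤ T → HasDerivAt v (v' (c + y * I)) (c + y * I))
    (hu' : ∀ y : ℝ, t0 ≤ y → y ≤ T → ContinuousAt u' (c + y * I))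
    (hv' : ∀ y : ℝ, t0 ≤ y → y ≤ T → ContinuousAt v' (c + y * I)) :
    ‖(∫ y in t0..T, u' (c + y * I) * v (c + y * I)) + (∫ y in t0..T, u (c + y * I) * v' (c + y * I))‖ ≤
      ‖u (c + T * I)‖ * ‖v (c + T * I)‖ + ‖u (c + t0 * I)‖ * ‖v (c + t0 * I)‖ := by
  have e := integral_vert_eq (F := fun z => u z * v z) (f := fun z => u' z * v z + u z * v' z) (x := c) h
    (fun y h1 h2 => (hu y h1 h2).mul (hv y h1 h2))
    (fun y h1 h2 => ((hu' y h1 h2).mul (hv y h1 h2).continuousAt).add ((hu y h1 h2).continuousAt.mul (hv' y h1 h2)))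
  have i1 := intervalIntegrable_vert (f := fun z => u' z * v z) (x := c) h
    (fun y h1 h2 => (hu' y h1 h2).mul (hv y h1 h2).continuousAt)
  have i2 := intervalIntegrable_vert (f := fun z => u z * v' z) (x := c) h
    (fun y h1 h2 => (hu y h1 h2).continuousAt.mul (hv' y h1 h2))
  rw [intervalIntegral.integral_add i1 i2] at e
  have e2 := congrArg norm e
  rw [norm_mul, norm_I, one_mul] at e2
  rw [e2]
  refine (norm_sub_le _ _).trans ?_
  rw [norm_mul, norm_mul]

lemma ne_one_of_im {s : ℂ} (h : s.im ≠ 0) : s ≠ 1 := by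
  rintro rfl; simp at h

lemma zeta_iter_hasDeriv (j : ℕ) {s : ℂ} (h : s ≠ 1) :
    HasDerivAt (iteratedDeriv j riemannZeta) (iteratedDeriv (j + 1) riemannZeta s) s := by
  rw [iteratedDeriv_succ]
  exact (iteratedDeriv_analyticAt j (zeta_analyticAt h)).differentiableAt.hasDerivAt

lemma zeta_line (j : ℕ) : ∃ C > 0, ∀ T y : ℝ, 8 ≤ Real.log T → 0 < T → 2 ≤ y → y ≤ T →
    ‖iteratedDeriv j riemannZeta (((-1 / Real.log T : ℝ) : ℂ) + y * I)‖ ≤ C * Real.log T ^ (j + 1) * Real.sqrt y := by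
  obtain ⟨C, hC, h⟩ := zeta_deriv_strip j
  refine ⟨2 * C, by positivity, fun T y hl hT h1 h2 => ?_⟩
  have hy0 : 0 < y := by linarith
  have g := h (Real.log T) (((-1 / Real.log T : ℝ) : ℂ) + y * I) hl
  simp only [add_re, ofReal_re, mul_re, I_re, mul_zero, ofReal_im, I_im, mul_one, sub_self, add_zero, add_im, mul_im, zero_add] at g
  rw [abs_of_pos hy0, Real.exp_log hT] at g
  have hneg : -1 / Real.log T ≤ 1 := by
    rw [div_le_iff₀ (by linarith)]; linarith
  refine (g le_rfl hneg h1 h2).trans ?_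
  have e : y ^ ((1 - -1 / Real.log T) / 2) ≤ 2 * Real.sqrt y := by
    rw [show (1 - -1 / Real.log T) / 2 = 1/2 + 1 / (2 * Real.log T) by field_simp; ring, Real.rpow_add hy0, ← Real.sqrt_eq_rpow, mul_comm]
    gcongr
    calc y ^ (1 / (2 * Real.log T)) ≤ T ^ (1 / (2 * Real.log T)) := by gcongr
      _ = Real.exp (1/2) := by
          rw [Real.rpow_def_of_pos hT]; congr 1
          field_simp
      _ ≤ 2 := by
          have h3 : Real.exp (1/2) * Real.exp (1/2) = Real.exp 1 := by rw [← Real.exp_add]; norm_num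
          nlinarith [Real.exp_one_lt_d9, Real.exp_pos (1/2)]
  calc _ ≤ C * Real.log T ^ (j + 1) * (2 * Real.sqrt y) := by gcongr
    _ = _ := by ring

lemma partB (j : ℕ) : ∀ m : ℕ, ∃ C > 0, ∀ T t0 : ℝ, 8 ≤ Real.log T → 1000 ≤ T → 2 ≤ t0 → t0 ≤ 3 →
    ‖(∫ y in t0..T, iteratedDeriv j riemannZeta (((-1 / Real.log T : ℝ) : ℂ) + y * I) * Hn m (((-1 / Real.log T : ℝ) : ℂ) + y * I)) -
      (-1) ^ j * (∫ y in t0..T, riemannZeta (((-1 / Real.log T : ℝ) : ℂ) + y * I) * Hn (m + j) (((-1 / Real.log T : ℝ) : ℂ) + y * I))‖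
      ≤ C * (Real.sqrt T * Real.log T ^ (m + j + 2)) := by
  induction j with
  | zero =>
    intro m
    refine ⟨1, one_pos, fun T t0 hl hT h2 h3 => ?_⟩
    simp only [iteratedDeriv_zero, pow_zero, one_mul, add_zero, sub_self, norm_zero]
    positivity
  | succ j ih =>
    intro m
    obtain ⟨C1, hC1, hI⟩ := ih (m + 1)
    obtain ⟨C2, hC2, hz⟩ := zeta_line j
    obtain ⟨C3, hC3, hH⟩ := Hn_bound m
    refine ⟨C1 + 2 * (C2 * C3), by positivity, fun T t0 hl hT h2 h3 => ?_⟩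
    have hT0 : 0 < T := by linarith
    have hc : -1 / Real.log T < 0 := div_neg_of_neg_of_pos (by norm_num) (by linarith)
    have hI := hI T t0 hl hT h2 h3
    have hzT := hz T T hl hT0 (by linarith) le_rfl
    have hz0 := hz T t0 hl hT0 h2 (by linarith)
    have hH' : ∀ y : ℝ, ‖Hn m (((-1 / Real.log T : ℝ) : ℂ) + y * I)‖ ≤ C3 * Real.log T ^ (m + 2) :=
      fun y => hH (Real.log T) _ (by linarith) (by simp)
    set c := -1 / Real.log T
    have hne : ∀ y : ℝ, t0 ≤ y → (c:ℂ) + y * I ≠ 1 := fun y hy => ne_one_of_im (by simp; linarith)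
    have hre : ∀ y : ℝ, ((c:ℂ) + y * I).re < 0 := fun y => by simpa using hc
    have hibp := ibp_vert (u := iteratedDeriv j riemannZeta) (u' := iteratedDeriv (j + 1) riemannZeta)
      (v := Hn m) (v' := Hn (m + 1)) (c := c) (t0 := t0) (T := T) (by linarith)
      (fun y hy _ => zeta_iter_hasDeriv j (hne y hy)) (fun y _ _ => Hn_deriv m (hre y))
      (fun y hy _ => (zeta_iter_hasDeriv (j + 1) (hne y hy)).continuousAt)
      (fun y _ _ => (Hn_deriv (m + 1) (hre y)).continuousAt)
    have hb : ‖iteratedDeriv j riemannZeta (c + T * I)‖ * ‖Hn m (c + T * I)‖ + ‖iteratedDeriv j riemannZeta (c + t0 * I)‖ * ‖Hn m (c + t0 * I)‖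
        ≤ 2 * (C2 * C3) * (Real.sqrt T * Real.log T ^ (m + (j + 1) + 2)) := by
      have s0 : Real.sqrt t0 ≤ Real.sqrt T := Real.sqrt_le_sqrt (by linarith)
      calc _ ≤ (C2 * Real.log T ^ (j + 1) * Real.sqrt T) * (C3 * Real.log T ^ (m + 2)) +
            (C2 * Real.log T ^ (j + 1) * Real.sqrt T) * (C3 * Real.log T ^ (m + 2)) := by
              have hz0' : ‖iteratedDeriv j riemannZeta (c + t0 * I)‖ ≤ C2 * Real.log T ^ (j + 1) * Real.sqrt T :=
                hz0.trans (by gcongr)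
              apply add_le_add
              · exact mul_le_mul hzT (hH' T) (norm_nonneg _) (by positivity)
              · exact mul_le_mul hz0' (hH' t0) (norm_nonneg _) (by positivity)
        _ = _ := by rw [show m + (j + 1) + 2 = (j + 1) + (m + 2) by ring, pow_add _ (j+1)]; ring
    set A := ∫ y in t0..T, iteratedDeriv (j + 1) riemannZeta (c + y * I) * Hn m (c + y * I)
    set B := ∫ y in t0..T, iteratedDeriv j riemannZeta (c + y * I) * Hn (m + 1) (c + y * I)
    rw [show m + (j + 1) = m + 1 + j by ring] at hb ⊢
    set D := ∫ y in t0..T, riemannZeta (c + y * I) * Hn (m + 1 + j) (c + y * I)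
    have e : A - (-1) ^ (j + 1) * D = (A + B) - (B - (-1) ^ j * D) := by ring
    rw [e]
    refine (norm_sub_le _ _).trans ?_
    have := hibp.trans hb
    rw [add_mul]
    linarith

lemma partB_main (n : ℕ) : ∃ C > 0, ∀ T t0 : ℝ, 8 ≤ Real.log T → 1000 ≤ T → 2 ≤ t0 → t0 ≤ 3 →
    ‖(∫ y in t0..T, iteratedDeriv n riemannZeta (((-1 / Real.log T : ℝ) : ℂ) + y * I) * Hn 0 (((-1 / Real.log T : ℝ) : ℂ) + y * I)) -
      (-1) ^ n * (2 * Real.pi * ((vonMangoldtPairSum n (T / (2 * Real.pi)) : ℝ) : ℂ))‖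
      ≤ C * (Real.sqrt T * Real.log T ^ (n + 2)) := by
  obtain ⟨C1, hC1, h1⟩ := partB n 0
  obtain ⟨C2, hC2, h2⟩ := left_main (n + 1)
  refine ⟨C1 + C2, by positivity, fun T t0 hl hT ht2 ht3 => ?_⟩
  have h1 := h1 T t0 hl hT ht2 ht3
  have h2 := h2 T t0 (bcoef n) hT ht2 ht3 (bcoef_zero n) (bcoef_norm n)
  have hT0 : 0 < T := by linarith
  have hpi := Real.pi_pos
  rw [bcoef_sum n (by positivity)] at h2
  rw [zero_add] at h1
  have hL0 : 0 < 1 / Real.log T := by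
    have : 0 < Real.log T := by linarith
    positivity
  have e : (∫ y in t0..T, riemannZeta (((-1 / Real.log T : ℝ) : ℂ) + y * I) * Hn n (((-1 / Real.log T : ℝ) : ℂ) + y * I)) =
      ∫ y in t0..T, feK (((1 + 1 / Real.log T : ℝ) : ℂ) - y * I) * LSeries (bcoef n) (((1 + 1 / Real.log T : ℝ) : ℂ) - y * I) := by
    apply intervalIntegral.integral_congr
    intro y hy
    rw [Set.uIcc_of_le (by linarith)] at hy
    have hw : (((-1 / Real.log T : ℝ) : ℂ) + y * I) = 1 - (((1 + 1 / Real.log T : ℝ) : ℂ) - y * I) := by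
      push_cast; ring
    simp only
    rw [Hn, hw, zeta_fe (by simp; linarith [hy.1]), sub_sub_cancel, mul_assoc, bcoef_LSeries n (by
      simp only [sub_re, ofReal_re, mul_re, I_re, mul_zero, ofReal_im, I_im, mul_one, sub_self, sub_zero]; linarith)]
  rw [e] at h1
  set A := ∫ y in t0..T, feK (((1 + 1 / Real.log T : ℝ) : ℂ) - y * I) * LSeries (bcoef n) (((1 + 1 / Real.log T : ℝ) : ℂ) - y * I)
  set B := ∫ y in t0..T, iteratedDeriv n riemannZeta (((-1 / Real.log T : ℝ) : ℂ) + y * I) * Hn 0 (((-1 / Real.log T : ℝ) : ℂ) + y * I)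
  set V := 2 * (Real.pi:ℂ) * ((vonMangoldtPairSum n (T / (2 * Real.pi)) : ℝ) : ℂ)
  have e2 : B - (-1) ^ n * V = (B - (-1) ^ n * A) + (-1) ^ n * (A - V) := by ring
  rw [e2]
  refine (norm_add_le _ _).trans ?_
  rw [norm_mul, norm_pow, norm_neg, norm_one, one_pow, one_mul, add_mul]
  exact add_le_add h1 h2

lemma feK_analyticAt {w : ℂ} (h : w.im ≠ 0) : AnalyticAt ℂ feK w := by
  have ho : IsOpen {z : ℂ | z.im ≠ 0} := isOpen_ne_fun Complex.continuous_im continuous_const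
  have : DifferentiableOn ℂ feK {z : ℂ | z.im ≠ 0} := fun z hz => (differentiableAt_feK hz).differentiableWithinAt
  exact this.analyticAt (ho.mem_nhds h)

lemma logDeriv_feK_analyticAt {w : ℂ} (h : w.im ≠ 0) : AnalyticAt ℂ (logDeriv feK) w :=
  (feK_analyticAt h).deriv.div (feK_analyticAt h) (feK_ne_zero h)

noncomputable def Qf (s : ℂ) : ℂ := - logDeriv feK (1 - s)
noncomputable def Qf' (s : ℂ) : ℂ := deriv (logDeriv feK) (1 - s)

lemma Qf_deriv {s : ℂ} (h : s.im ≠ 0) : HasDerivAt Qf (Qf' s) s := by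
  have h' : (1 - s).im ≠ 0 := by simpa using h
  have h1 := (logDeriv_feK_analyticAt h').differentiableAt.hasDerivAt
  have h2 : HasDerivAt (fun z : ℂ => 1 - z) (-1) s := (hasDerivAt_id s).const_sub 1
  have := (h1.comp s h2).neg
  refine this.congr_deriv ?_
  rw [Qf']; ring

lemma Qf'_cont {s : ℂ} (h : s.im ≠ 0) : ContinuousAt Qf' s := by
  have h' : (1 - s).im ≠ 0 := by simpa using h
  have h1 := (logDeriv_feK_analyticAt h').deriv.continuousAt
  exact ContinuousAt.comp (f := fun z : ℂ => 1 - z) h1 (by fun_prop)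

lemma zeta_logDeriv_left {s : ℂ} (h : s.im ≠ 0) (hs : s.re < 0) :
    logDeriv riemannZeta s = Qf s + Hn 0 s := by
  have h' : (1 - s).im ≠ 0 := by simpa using h
  rw [Hn_zero hs, Qf]
  have hz : riemannZeta (1 - s) ≠ 0 := riemannZeta_ne_zero_of_one_le_re (by simp; linarith)
  have heq : riemannZeta =ᶠ[nhds s] fun z => feK (1 - z) * riemannZeta (1 - z) := by
    have ho : IsOpen {z : ℂ | z.im ≠ 0} := isOpen_ne_fun Complex.continuous_im continuous_const
    filter_upwards [ho.mem_nhds h] with z hz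
    have : (1 - z).im ≠ 0 := by simpa using hz
    rw [← zeta_fe this, sub_sub_cancel]
  have h2 : HasDerivAt (fun z : ℂ => 1 - z) (-1) s := (hasDerivAt_id s).const_sub 1
  have d1 : HasDerivAt (fun z => feK (1 - z)) (deriv feK (1 - s) * (-1)) s :=
    (differentiableAt_feK h').hasDerivAt.comp s h2
  have d2 : HasDerivAt (fun z => riemannZeta (1 - z)) (deriv riemannZeta (1 - s) * (-1)) s :=
    (differentiableAt_riemannZeta (ne_one_of_im h')).hasDerivAt.comp s h2
  have d3 : deriv (fun z => feK (1 - z) * riemannZeta (1 - z)) s = _ := (d1.mul d2).deriv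
  rw [logDeriv_apply, heq.deriv_eq, heq.eq_of_nhds, d3, logDeriv_apply, logDeriv_apply]
  have := feK_ne_zero h'
  field_simp

lemma partA (j : ℕ) : ∃ C > 0, ∀ T t0 : ℝ, 8 ≤ Real.log T → 1000 ≤ T → 2 ≤ t0 → t0 ≤ 3 →
    ‖(∫ y in t0..T, iteratedDeriv (j + 1) riemannZeta (((-1 / Real.log T : ℝ) : ℂ) + y * I) * Qf (((-1 / Real.log T : ℝ) : ℂ) + y * I))‖
      ≤ C * (Real.sqrt T * Real.log T ^ (j + 2)) := by
  obtain ⟨C2, hC2, hz⟩ := zeta_line j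
  obtain ⟨C3, hC3, hQ⟩ := feK_logDeriv
  refine ⟨4 * (C2 * C3), by positivity, fun T t0 hl hT h2 h3 => ?_⟩
  have hT0 : 0 < T := by linarith
  have hc : -1 / Real.log T < 0 := div_neg_of_neg_of_pos (by norm_num) (by linarith)
  have hc2 : -1 ≤ -1 / Real.log T := by rw [le_div_iff₀ (by linarith)]; linarith
  have hz := fun y h1 h2 => hz T y hl hT0 h1 h2
  set c := -1 / Real.log T
  have hlog : ∀ y : ℝ, 2 ≤ y → y ≤ T → 0 ≤ Real.log y ∧ Real.log y ≤ Real.log T := fun y h1 h2 =>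
    ⟨Real.log_nonneg (by linarith), Real.log_le_log (by linarith) h2⟩
  have hQ1 : ∀ y : ℝ, 2 ≤ y → y ≤ T → ‖Qf (c + y * I)‖ ≤ C3 * Real.log T ∧ ‖Qf' (c + y * I)‖ ≤ C3 * (Real.log T / y) := by
    intro y hy1 hy2
    have g := hQ (1 - (c + y * I))
    have e1 : (1 - ((c:ℂ) + y * I)).re = 1 - c := by simp
    have e2 : |(1 - ((c:ℂ) + y * I)).im| = y := by simp; linarith
    rw [e1, e2] at g
    obtain ⟨g1, g2⟩ := g (by linarith) (by linarith) hy1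
    rw [Qf, Qf', norm_neg]
    have := hlog y hy1 hy2
    constructor
    · exact g1.trans (mul_le_mul_of_nonneg_left this.2 hC3.le)
    · refine g2.trans (mul_le_mul_of_nonneg_left ?_ hC3.le)
      have hy0 : 0 < y := by linarith
      exact div_le_div_of_nonneg_right this.2 hy0.le
  have him : ∀ y : ℝ, t0 ≤ y → ((c:ℂ) + y * I).im ≠ 0 := fun y hy => by simp; linarith
  have hibp := ibp_vert (u := iteratedDeriv j riemannZeta) (u' := iteratedDeriv (j + 1) riemannZeta)
      (v := Qf) (v' := Qf') (c := c) (t0 := t0) (T := T) (by linarith)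
      (fun y hy _ => zeta_iter_hasDeriv j (ne_one_of_im (him y hy))) (fun y hy _ => Qf_deriv (him y hy))
      (fun y hy _ => (zeta_iter_hasDeriv (j + 1) (ne_one_of_im (him y hy))).continuousAt)
      (fun y hy _ => Qf'_cont (him y hy))
  have s0 : Real.sqrt t0 ≤ Real.sqrt T := Real.sqrt_le_sqrt (by linarith)
  have hb : ‖iteratedDeriv j riemannZeta (c + T * I)‖ * ‖Qf (c + T * I)‖ + ‖iteratedDeriv j riemannZeta (c + t0 * I)‖ * ‖Qf (c + t0 * I)‖
        ≤ 2 * (C2 * C3) * (Real.sqrt T * Real.log T ^ (j + 2)) := by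
    have hz0' : ‖iteratedDeriv j riemannZeta (c + t0 * I)‖ ≤ C2 * Real.log T ^ (j + 1) * Real.sqrt T :=
      (hz t0 h2 (by linarith)).trans (by gcongr)
    calc _ ≤ (C2 * Real.log T ^ (j + 1) * Real.sqrt T) * (C3 * Real.log T) +
            (C2 * Real.log T ^ (j + 1) * Real.sqrt T) * (C3 * Real.log T) := by
              apply add_le_add
              · exact mul_le_mul (hz T (by linarith) le_rfl) (hQ1 T (by linarith) le_rfl).1 (norm_nonneg _) (by positivity)
              · exact mul_le_mul hz0' (hQ1 t0 h2 (by linarith)).1 (norm_nonneg _) (by positivity)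
      _ = _ := by ring
  have hIntegr : ‖∫ y in t0..T, iteratedDeriv j riemannZeta (c + y * I) * Qf' (c + y * I)‖ ≤
      2 * (C2 * C3) * (Real.sqrt T * Real.log T ^ (j + 2)) := by
    have h1 : ‖∫ y in t0..T, iteratedDeriv j riemannZeta (c + y * I) * Qf' (c + y * I)‖ ≤
        ∫ y in t0..T, (C2 * C3 * Real.log T ^ (j + 2)) * y ^ (-(1/2) : ℝ) := by
      apply intervalIntegral.norm_integral_le_of_norm_le (by linarith)
      · filter_upwards with y hy
        have hy2 : 2 ≤ y := by linarith [hy.1]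
        have hy0 : 0 < y := by linarith
        rw [norm_mul]
        calc _ ≤ (C2 * Real.log T ^ (j + 1) * Real.sqrt y) * (C3 * (Real.log T / y)) :=
              mul_le_mul (hz y hy2 hy.2) (hQ1 y hy2 hy.2).2 (norm_nonneg _) (by positivity)
          _ = (C2 * C3 * Real.log T ^ (j + 2)) * (Real.sqrt y / y) := by ring
          _ = _ := by
              congr 1
              rw [Real.sqrt_div_self', Real.rpow_neg hy0.le, ← Real.sqrt_eq_rpow, one_div]
      · apply ContinuousOn.intervalIntegrable
        rw [Set.uIcc_of_le (by linarith)]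
        intro y hy
        apply ContinuousAt.continuousWithinAt
        apply ContinuousAt.mul continuousAt_const
        exact Real.continuousAt_rpow_const _ _ (Or.inl (by linarith [hy.1]))
    refine h1.trans ?_
    rw [intervalIntegral.integral_const_mul, integral_rpow (Or.inl (by norm_num))]
    norm_num only
    rw [← Real.sqrt_eq_rpow, ← Real.sqrt_eq_rpow]
    have := Real.sqrt_nonneg t0
    calc _ ≤ C2 * C3 * Real.log T ^ (j + 2) * (Real.sqrt T / (1/2)) := by
          gcongr
          linarith
      _ = _ := by ring
  have e : (∫ y in t0..T, iteratedDeriv (j + 1) riemannZeta (c + y * I) * Qf (c + y * I)) =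
    ((∫ y in t0..T, iteratedDeriv (j + 1) riemannZeta (c + y * I) * Qf (c + y * I)) + (∫ y in t0..T, iteratedDeriv j riemannZeta (c + y * I) * Qf' (c + y * I))) - (∫ y in t0..T, iteratedDeriv j riemannZeta (c + y * I) * Qf' (c + y * I)) := by ring
  rw [e]
  refine (norm_sub_le _ _).trans ?_
  linarith [hibp.trans hb]

lemma left_total (n : ℕ) (hn : 1 ≤ n) : ∃ C > 0, ∀ T t0 : ℝ, 8 ≤ Real.log T → 1000 ≤ T → 2 ≤ t0 → t0 ≤ 3 →
    ‖(∫ y in t0..T, iteratedDeriv n riemannZeta (((-1 / Real.log T : ℝ) : ℂ) + y * I) * logDeriv riemannZeta (((-1 / Real.log T : ℝ) : ℂ) + y * I)) -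
      (-1) ^ n * (2 * Real.pi * ((vonMangoldtPairSum n (T / (2 * Real.pi)) : ℝ) : ℂ))‖
      ≤ C * (Real.sqrt T * Real.log T ^ (n + 2)) := by
  obtain ⟨j, rfl⟩ := Nat.exists_eq_add_of_le' hn
  obtain ⟨C1, hC1, hA⟩ := partA j
  obtain ⟨C2, hC2, hB⟩ := partB_main (j + 1)
  refine ⟨C1 + C2, by positivity, fun T t0 hl hT h2 h3 => ?_⟩
  have hA := hA T t0 hl hT h2 h3
  have hB := hB T t0 hl hT h2 h3
  have hT0 : 0 < T := by linarith
  have hc : -1 / Real.log T < 0 := div_neg_of_neg_of_pos (by norm_num) (by linarith)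
  set c := -1 / Real.log T
  have him : ∀ y : ℝ, t0 ≤ y → ((c:ℂ) + y * I).im ≠ 0 := fun y hy => by simp; linarith
  have hre : ∀ y : ℝ, ((c:ℂ) + y * I).re < 0 := fun y => by simpa using hc
  have e : (∫ y in t0..T, iteratedDeriv (j + 1) riemannZeta (c + y * I) * logDeriv riemannZeta (c + y * I)) =
      (∫ y in t0..T, iteratedDeriv (j + 1) riemannZeta (c + y * I) * Qf (c + y * I)) +
      (∫ y in t0..T, iteratedDeriv (j + 1) riemannZeta (c + y * I) * Hn 0 (c + y * I)) := by
    rw [← intervalIntegral.integral_add]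
    · apply intervalIntegral.integral_congr
      intro y hy
      rw [Set.uIcc_of_le (by linarith)] at hy
      simp only
      rw [zeta_logDeriv_left (him y hy.1) (hre y)]; ring
    · exact intervalIntegrable_vert (f := fun z => iteratedDeriv (j + 1) riemannZeta z * Qf z) (by linarith)
        (fun y hy _ => (zeta_iter_hasDeriv (j + 1) (ne_one_of_im (him y hy))).continuousAt.mul (Qf_deriv (him y hy)).continuousAt)
    · exact intervalIntegrable_vert (f := fun z => iteratedDeriv (j + 1) riemannZeta z * Hn 0 z) (by linarith)
        (fun y hy _ => (zeta_iter_hasDeriv (j + 1) (ne_one_of_im (him y hy))).continuousAt.mul (Hn_deriv 0 (hre y)).continuousAt)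
  rw [e, add_sub_assoc]
  refine (norm_add_le _ _).trans ?_
  have : C1 * (Real.sqrt T * Real.log T ^ (j + 2)) ≤ C1 * (Real.sqrt T * Real.log T ^ (j + 1 + 2)) := by
    gcongr
    · linarith
    · omega
  rw [add_mul]
  linarith

lemma right_bound (n : ℕ) : ∃ C > 0, ∀ T t0 : ℝ, t0 ≤ T →
    ‖∫ y in t0..T, iteratedDeriv n riemannZeta (((3:ℝ):ℂ) + y * I) * logDeriv riemannZeta (((3:ℝ):ℂ) + y * I)‖ ≤ C := by
  set f : ℕ → ℂ := LSeries.convolution (LSeries.logMul^[n] 1) (lam 0) with hf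
  set g : ℕ → ℂ := fun N => f N / Complex.log N with hg
  have hone : LSeries.abscissaOfAbsConv (LSeries.logMul^[n] 1) ≤ 1 := by
    rw [LSeries.absicssaOfAbsConv_logPowMul, LSeries.abscissaOfAbsConv_one]
  have hfa : LSeries.abscissaOfAbsConv f ≤ 1 :=
    (LSeries.abscissaOfAbsConv_convolution_le _ _).trans (max_le hone (lam_abscissa 0))
  have hlg : LSeries.logMul g = f := by
    ext N
    rw [LSeries.logMul, hg]
    rcases Nat.eq_zero_or_pos N with rfl | h
    · simp [hf, LSeries.convolution_map_zero]
    · rcases Nat.lt_or_ge 1 N with h1 | h1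
      · have : Complex.log N ≠ 0 := by
          rw [← Complex.natCast_log]
          have : 0 < Real.log N := Real.log_pos (by exact_mod_cast h1)
          exact_mod_cast this.ne'
        simp only
        field_simp
      · have : N = 1 := by omega
        subst this
        simp [hf, LSeries.convolution_def, lam]
  have hga : LSeries.abscissaOfAbsConv g ≤ 1 := by
    rw [← LSeries.abscissaOfAbsConv_logMul, hlg]; exact hfa
  have h3 : ∀ s : ℂ, 1 < s.re → (1 : EReal) < s.re := fun s hs => by exact_mod_cast hs
  have hprod : ∀ s : ℂ, 1 < s.re → iteratedDeriv n riemannZeta s * logDeriv riemannZeta s = (-1) ^ (n + 1) * LSeries f s := by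
    intro s hs
    have h1 : iteratedDeriv n riemannZeta s = (-1) ^ n * LSeries (LSeries.logMul^[n] 1) s := by
      rw [← LSeries_iteratedDeriv n (by rw [LSeries.abscissaOfAbsConv_one]; exact h3 s hs)]
      apply Filter.EventuallyEq.iteratedDeriv_eq
      have ho : IsOpen {z : ℂ | 1 < z.re} := isOpen_lt continuous_const Complex.continuous_re
      filter_upwards [ho.mem_nhds hs] with z hz
      rw [LSeries_one_eq_riemannZeta hz]
    have h2 : logDeriv riemannZeta s = - LSeries (lam 0) s := by
      rw [lam, Function.iterate_zero, id, ArithmeticFunction.LSeries_vonMangoldt_eq_deriv_riemannZeta_div hs, logDeriv_apply]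
      ring
    rw [h1, h2, hf, LSeries_convolution' (LSeriesSummable_of_abscissaOfAbsConv_lt_re (hone.trans_lt (h3 s hs)))
      (LSeriesSummable_of_abscissaOfAbsConv_lt_re ((lam_abscissa 0).trans_lt (h3 s hs)))]
    ring
  have hsum : Summable fun N => ‖LSeries.term g 3 N‖ :=
    (LSeriesSummable_of_abscissaOfAbsConv_lt_re (hga.trans_lt (h3 3 (by norm_num)))).norm
  have hgb : ∀ s : ℂ, s.re = 3 → ‖LSeries g s‖ ≤ ∑' N, ‖LSeries.term g 3 N‖ := by
    intro s hs
    rw [LSeries]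
    apply tsum_of_norm_bounded hsum.hasSum
    intro N
    apply LSeries.norm_term_le_of_re_le_re
    rw [hs]; norm_num
  have hS0 : 0 ≤ ∑' N, ‖LSeries.term g 3 N‖ := tsum_nonneg fun _ => norm_nonneg _
  refine ⟨2 * (∑' N, ‖LSeries.term g 3 N‖) + 1, by positivity, fun T t0 h => ?_⟩
  have hre : ∀ y : ℝ, (((3:ℝ):ℂ) + y * I).re = 3 := fun y => by simp
  have e := integral_vert_eq (F := fun z => - LSeries g z) (f := LSeries f) (x := 3) h
    (fun y _ _ => by
      have := (LSeries_hasDerivAt (f := g) (s := ((3:ℝ):ℂ) + y * I) (hga.trans_lt (h3 _ (by rw [hre]; norm_num)))).neg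
      rw [neg_neg, hlg] at this
      exact this)
    (fun y _ _ => (LSeries_hasDerivAt (f := f) (s := ((3:ℝ):ℂ) + y * I) (hfa.trans_lt (h3 _ (by rw [hre]; norm_num)))).continuousAt)
  have e2 := congrArg norm e
  rw [norm_mul, norm_I, one_mul] at e2
  rw [intervalIntegral.integral_congr (g := fun y : ℝ => (-1) ^ (n + 1) * LSeries f (((3:ℝ):ℂ) + y * I))
    (fun y _ => hprod _ (by rw [hre]; norm_num)), intervalIntegral.integral_const_mul, norm_mul, norm_pow, norm_neg, norm_one, one_pow, one_mul, e2]
  refine (norm_sub_le _ _).trans ?_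
  rw [norm_neg, norm_neg]
  linarith [hgb _ (hre T), hgb _ (hre t0)]

lemma log_le_sqrt {T : ℝ} (hT : 1 ≤ T) : Real.log T ≤ 2 * Real.sqrt T := by
  have h : 0 < Real.sqrt T := Real.sqrt_pos.mpr (by linarith)
  have h1 := Real.log_le_sub_one_of_pos h
  rw [Real.log_sqrt (by linarith)] at h1
  linarith

lemma top_bound (n : ℕ) (δ : ℝ) (hδ : 0 < δ) : ∃ C > 0, ∃ T₁, ∀ T ≥ T₁, AdmissibleHeight δ T →
    8 ≤ Real.log T → 1000 ≤ T →
    ‖∫ x in (-1 / Real.log T)..3, iteratedDeriv n riemannZeta (x + T * I) * logDeriv riemannZeta (x + T * I)‖ ≤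
      C * (Real.sqrt T * Real.log T ^ (n + 2)) := by
  obtain ⟨C1, hC1, T₁, hL⟩ := zeta_logDeriv_top δ hδ
  obtain ⟨C2, hC2, hz1⟩ := zeta_deriv_strip n
  obtain ⟨C3, hC3, hz2⟩ := zeta_deriv_right n
  refine ⟨(C2 + C3) * C1 * 12, by positivity, T₁, fun T hT hA hl hT1 => ?_⟩
  have hT0 : 0 < T := by linarith
  have hL := hL T hT hA
  have hl0 : 0 < Real.log T := by linarith
  have hc : -1 / Real.log T ≤ 0 := (div_neg_of_neg_of_pos (by norm_num) hl0).le
  have hc2 : -1 / 8 ≤ -1 / Real.log T := by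
    rw [div_le_div_iff₀ (by norm_num) hl0]; linarith
  have hb : ‖∫ x in (-1 / Real.log T)..3, iteratedDeriv n riemannZeta (x + T * I) * logDeriv riemannZeta (x + T * I)‖ ≤
      ∫ x in (-1 / Real.log T)..3, ((C2 + C3) * C1 * Real.log T ^ (n + 3)) * (Real.exp (Real.log T * ((1 - x) / 2)) + 1) := by
    apply intervalIntegral.norm_integral_le_of_norm_le (by linarith)
    · filter_upwards with x hx
      have h1 := (hL x (by linarith [hx.1]) hx.2).2
      have h2 : ‖iteratedDeriv n riemannZeta (x + T * I)‖ ≤ (C2 + C3) * Real.log T ^ (n + 1) * (Real.exp (Real.log T * ((1 - x) / 2)) + 1) := by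
        have e0 := Real.exp_pos (Real.log T * ((1 - x) / 2))
        have p0 : 0 < Real.log T ^ (n + 1) := by positivity
        have q1 : 0 < C2 * Real.log T ^ (n + 1) := by positivity
        have q2 : 0 < C3 * Real.log T ^ (n + 1) := by positivity
        rcases le_total x 1 with h | h
        · have g := hz1 (Real.log T) (x + T * I) hl
          simp only [add_re, ofReal_re, mul_re, I_re, mul_zero, ofReal_im, I_im, mul_one, sub_self, add_zero, add_im, mul_im, zero_add] at g
          rw [abs_of_pos hT0, Real.exp_log hT0, Real.rpow_def_of_pos hT0] at g
          refine (g hx.1.le h (by linarith) le_rfl).trans ?_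
          nlinarith [mul_pos q2 e0]
        · have g := hz2 (Real.log T) (x + T * I) hl
          simp only [add_re, ofReal_re, mul_re, I_re, mul_zero, ofReal_im, I_im, mul_one, sub_self, add_zero, add_im, mul_im, zero_add] at g
          rw [abs_of_pos hT0, Real.exp_log hT0] at g
          refine (g h (by linarith) le_rfl).trans ?_
          nlinarith [mul_pos q2 e0, mul_pos q1 e0]
      rw [norm_mul]
      calc _ ≤ ((C2 + C3) * Real.log T ^ (n + 1) * (Real.exp (Real.log T * ((1 - x) / 2)) + 1)) * (C1 * Real.log T ^ 2) :=
            mul_le_mul h2 h1 (norm_nonneg _) (by positivity)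
        _ = _ := by ring
    · apply Continuous.intervalIntegrable; fun_prop
  refine hb.trans ?_
  rw [intervalIntegral.integral_const_mul]
  have hIntegr : ∫ x in (-1 / Real.log T)..3, (Real.exp (Real.log T * ((1 - x) / 2)) + 1) ≤ 12 * (Real.sqrt T / Real.log T) := by
    have e : ∫ x in (-1 / Real.log T)..3, (Real.exp (Real.log T * ((1 - x) / 2)) + 1) =
      (-(2 / Real.log T) * Real.exp (Real.log T * ((1 - 3) / 2)) + 3) - (-(2 / Real.log T) * Real.exp (Real.log T * ((1 - (-1 / Real.log T)) / 2)) + (-1 / Real.log T)) := by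
      apply intervalIntegral.integral_eq_sub_of_hasDerivAt
        (f := fun x => -(2 / Real.log T) * Real.exp (Real.log T * ((1 - x) / 2)) + x)
      · intro x _
        have h1 : HasDerivAt (fun x : ℝ => Real.log T * ((1 - x) / 2)) (Real.log T * (-1 / 2)) x :=
          (((hasDerivAt_id x).const_sub 1).div_const 2).const_mul _
        refine ((h1.exp.const_mul (-(2 / Real.log T))).add (hasDerivAt_id x)).congr_deriv ?_
        field_simp
      · apply Continuous.intervalIntegrable; fun_prop
    rw [e]
    have e1 : Real.exp (Real.log T * ((1 - (-1 / Real.log T)) / 2)) ≤ 2 * Real.sqrt T := by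
      rw [show Real.log T * ((1 - (-1 / Real.log T)) / 2) = 1/2 + Real.log T * (1/2) by field_simp; ring, Real.exp_add, ← Real.rpow_def_of_pos hT0, ← Real.sqrt_eq_rpow]
      gcongr
      have h3 : Real.exp (1/2) * Real.exp (1/2) = Real.exp 1 := by rw [← Real.exp_add]; norm_num
      nlinarith [Real.exp_one_lt_d9, Real.exp_pos (1/2)]
    have e2 : 0 < 2 / Real.log T * Real.exp (Real.log T * ((1 - 3) / 2)) := by positivity
    have e3 : 2 / Real.log T * Real.exp (Real.log T * ((1 - (-1 / Real.log T)) / 2)) ≤ 4 * (Real.sqrt T / Real.log T) := by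
      calc _ ≤ 2 / Real.log T * (2 * Real.sqrt T) := by gcongr
        _ = _ := by ring
    have e4 : 1 / 2 ≤ Real.sqrt T / Real.log T := by
      rw [div_le_div_iff₀ (by norm_num) hl0]
      linarith [log_le_sqrt (T := T) (by linarith)]
    linarith
  calc _ ≤ ((C2 + C3) * C1 * Real.log T ^ (n + 3)) * (12 * (Real.sqrt T / Real.log T)) := by gcongr
    _ = _ := by rw [pow_succ _ (n + 2)]; field_simp

lemma bottom_bound (n : ℕ) {t0 : ℝ} (ht : 2 ≤ t0) (h0 : ∀ ρ, IsNontrivialZero ρ → ρ.im ≠ t0) :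
    ∃ C > 0, ∀ c : ℝ, -1/8 ≤ c → c ≤ 0 →
    ‖∫ x in c..3, iteratedDeriv n riemannZeta (x + t0 * I) * logDeriv riemannZeta (x + t0 * I)‖ ≤ C := by
  have hcont : ContinuousOn (fun x : ℝ => iteratedDeriv n riemannZeta (x + t0 * I) * logDeriv riemannZeta (x + t0 * I)) (Set.Icc (-1/8) 3) := by
    intro x _
    apply ContinuousAt.continuousWithinAt
    have him : ((x:ℂ) + t0 * I).im ≠ 0 := by simp; linarith
    have hz := zeta_analyticAt (ne_one_of_im him)
    have hne : riemannZeta (x + t0 * I) ≠ 0 := by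
      intro h
      exact h0 _ (zeta_zero_strip h him) (by simp)
    have h1 : ContinuousAt (fun z => iteratedDeriv n riemannZeta z * logDeriv riemannZeta z) ((x:ℂ) + t0 * I) :=
      (iteratedDeriv_analyticAt n hz).continuousAt.mul (hz.deriv.div hz hne).continuousAt
    exact ContinuousAt.comp (f := fun x : ℝ => (x:ℂ) + t0 * I) h1 (by fun_prop)
  obtain ⟨M, hM⟩ := isCompact_Icc.exists_bound_of_continuousOn hcont
  have hM0 : 0 ≤ M := (norm_nonneg _).trans (hM 0 (by norm_num))
  refine ⟨M * 4 + 1, by positivity, fun c h1 h2 => ?_⟩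
  have := intervalIntegral.norm_integral_le_of_norm_le_const (a := c) (b := 3)
    (f := fun x : ℝ => iteratedDeriv n riemannZeta (x + t0 * I) * logDeriv riemannZeta (x + t0 * I)) (C := M) ?_
  · refine this.trans ?_
    rw [abs_of_pos (by linarith)]
    nlinarith
  · intro x hx
    rw [Set.uIoc_of_le (by linarith)] at hx
    exact hM x ⟨by linarith [hx.1], hx.2⟩

theorem main_thm (n : ℕ) (hn : 1 ≤ n) (δ : ℝ) (hδ : 0 < δ) :
    ∃ K > (0 : ℝ), ∃ T₀ : ℝ, ∀ T ≥ T₀, AdmissibleHeight δ T →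
      ‖zetaZeroSum n T -
          (-1 : ℂ) ^ (n + 1) * ((vonMangoldtPairSum n (T / (2 * Real.pi)) : ℝ) : ℂ)‖ ≤
        K * T ^ ((1 : ℝ) / 2) * Real.log T ^ (n + 2) := by
  obtain ⟨t0, ht2, ht3, hz0⟩ := exists_t0
  obtain ⟨C1, hC1, hleft⟩ := left_total n hn
  obtain ⟨C2, hC2, hright⟩ := right_bound n
  obtain ⟨C3, hC3, T₁, htop⟩ := top_bound n δ hδ
  obtain ⟨C4, hC4, hbot⟩ := bottom_bound n ht2 hz0
  refine ⟨‖zetaZeroSum n t0‖ + C1 + C2 + C3 + C4, by positivity, max T₁ (max 1000 (Real.exp 8)), fun T hT hA => ?_⟩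
  have hT1 : T₁ ≤ T := (le_max_left _ _).trans hT
  have hT2 : 1000 ≤ T := ((le_max_left _ _).trans (le_max_right _ _)).trans hT
  have hT3 : Real.exp 8 ≤ T := ((le_max_right _ _).trans (le_max_right _ _)).trans hT
  have hT0 : 0 < T := by linarith
  have hl : 8 ≤ Real.log T := (Real.le_log_iff_exp_le hT0).mpr hT3
  have hl0 : 0 < Real.log T := by linarith
  have hc : -1 / Real.log T ≤ 0 := (div_neg_of_neg_of_pos (by norm_num) hl0).le
  have hc2 : -1 / 8 ≤ -1 / Real.log T := by
    rw [div_le_div_iff₀ (by norm_num) hl0]; linarith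
  have hzT : ∀ ρ, IsNontrivialZero ρ → ρ.im ≠ T := by
    intro ρ hρ h
    have := hA ρ hρ
    rw [h, sub_self, abs_zero] at this
    have : 0 < δ / Real.log T := by positivity
    linarith
  have hrect := zetaZeroSum_rect n ht2 (by linarith : t0 < T) hc hz0 hzT
  have hleft := hleft T t0 hl hT2 ht2 ht3
  have hright := hright T t0 (by linarith)
  have htop := htop T hT1 hA hl hT2
  have hbot := hbot _ hc2 hc
  rw [rectInt] at hrect
  set A1 := ∫ y in t0..T, iteratedDeriv n riemannZeta (((-1 / Real.log T : ℝ) : ℂ) + y * I) * logDeriv riemannZeta (((-1 / Real.log T : ℝ) : ℂ) + y * I)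
  set A2 := ∫ y in t0..T, iteratedDeriv n riemannZeta (((3:ℝ):ℂ) + y * I) * logDeriv riemannZeta (((3:ℝ):ℂ) + y * I)
  set A3 := ∫ x in (-1 / Real.log T)..3, iteratedDeriv n riemannZeta (x + T * I) * logDeriv riemannZeta (x + T * I)
  set A4 := ∫ x in (-1 / Real.log T)..3, iteratedDeriv n riemannZeta (x + t0 * I) * logDeriv riemannZeta (x + t0 * I)
  set V := ((vonMangoldtPairSum n (T / (2 * Real.pi)) : ℝ) : ℂ)
  set S := zetaZeroSum n T
  set S0 := zetaZeroSum n t0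
  set E := Real.sqrt T * Real.log T ^ (n + 2) with hE
  have hE1 : 1 ≤ E := by
    have h1 : 1 ≤ Real.sqrt T := Real.one_le_sqrt.mpr (by linarith)
    have h2 : 1 ≤ Real.log T ^ (n + 2) := one_le_pow₀ (by linarith)
    nlinarith
  have hpi := Real.pi_gt_three
  have hpi0 : (Real.pi : ℂ) ≠ 0 := by exact_mod_cast Real.pi_ne_zero
  have key : S - (-1) ^ (n + 1) * V = S0 + (1 / (2 * Real.pi * I)) * (A4 - A3 + I * A2 - I * (A1 - (-1) ^ n * (2 * Real.pi * V))) := by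
    have : S = S0 + (1 / (2 * Real.pi * I)) * (A4 - A3 + I * A2 - I * A1) := by
      rw [← hrect]
      field_simp
      ring
    rw [this, pow_succ]
    field_simp
    ring
  rw [key, ← Real.sqrt_eq_rpow, mul_assoc (‖S0‖ + C1 + C2 + C3 + C4), ← hE]
  have hn1 : ‖(1 / (2 * Real.pi * I) : ℂ)‖ ≤ 1 := by
    rw [norm_div, norm_mul, norm_mul, norm_I, Complex.norm_real, Complex.norm_ofNat, Real.norm_eq_abs, abs_of_pos Real.pi_pos, norm_one,
      div_le_one (by positivity)]
    linarith
  have hn2 : ‖A4 - A3 + I * A2 - I * (A1 - (-1) ^ n * (2 * Real.pi * V))‖ ≤ C4 + C3 * E + C2 + C1 * E := by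
    refine (norm_sub_le _ _).trans (add_le_add ((norm_add_le _ _).trans (add_le_add ((norm_sub_le _ _).trans (add_le_add hbot htop)) ?_)) ?_)
    · rw [norm_mul, norm_I, one_mul]; exact hright
    · rw [norm_mul, norm_I, one_mul]; exact hleft
  refine (norm_add_le _ _).trans ?_
  rw [norm_mul]
  have hn3 := mul_le_mul hn1 hn2 (norm_nonneg _) zero_le_one
  have hS0 := norm_nonneg S0
  nlinarith [mul_le_mul_of_nonneg_left hE1 hS0, mul_le_mul_of_nonneg_left hE1 hC2.le, mul_le_mul_of_nonneg_left hE1 hC4.le]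

/-- for admissible `T → ∞`,
`∑_{0<γ≤T} ζ^{(n)}(ρ) = (-1)^{n+1} ∑_{mr ≤ T/2π} Λ(r) log^n r
+ O(T^{1/2} log^{n+2} T)`. -/
theorem zero_sum_eq_vonMangoldt_sum (n : ℕ) (hn : 1 ≤ n) (δ : ℝ) (hδ : 0 < δ) :
    ∃ K > (0 : ℝ), ∃ T₀ : ℝ, ∀ T ≥ T₀, AdmissibleHeight δ T →
      ‖zetaZeroSum n T -
          (-1 : ℂ) ^ (n + 1) * ((vonMangoldtPairSum n (T / (2 * Real.pi)) : ℝ) : ℂ)‖ ≤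
        K * T ^ ((1 : ℝ) / 2) * Real.log T ^ (n + 2) := by
  exact main_thm n hn δ hδ
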